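/- arXiv:2509.20213 — 2 statements merged into one kernel-verified Lean document; each statement's English description precedes it below -/
import Mathlib

section
/- For any N×N complex matrices A and B, ∫_{U(N)} exp(Tr(X A X† B)) d_*X = Σ_{λ : ℓ(λ) ≤ N} s_λ(A) s_λ(B) / (N)_λ, the absolutely convergent sum over all partitions λ with at most N parts. -/
open scoped BigOperators Classical
open MeasureTheory Matrix

noncomputable section

/-- Complete homogeneous symmetric functions of the eigenvalues of `X`, defined through
Newton's identities from the power sums `p_m = Tr(X^m)`. -/
def hMat {N : ℕ} (X : Matrix (Fin N) (Fin N) ℂ) : ℕ → ℂ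
  | 0 => 1
  | (k+1) => ((k : ℂ) + 1)⁻¹ *
      ∑ m ∈ Finset.range (k+1), (X ^ (m+1)).trace * hMat X (k - m)
  termination_by k => k
  decreasing_by exact Nat.lt_succ_of_le (Nat.sub_le _ _)

def hMatZ {N : ℕ} (X : Matrix (Fin N) (Fin N) ℂ) (k : ℤ) : ℂ :=
  if k < 0 then 0 else hMat X k.toNat

/-- The Schur polynomial `s_λ(X)` of an `N×N` complex matrix `X`, evaluated at the
eigenvalues of `X`, via the Jacobi-Trudi formula `s_λ = det(h_{λ_i - i + j})`.
Here `l : Fin N → ℕ` lists the (at most `N`) parts of the partition `λ`. -/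
def schur {N : ℕ} (l : Fin N → ℕ) (X : Matrix (Fin N) (Fin N) ℂ) : ℂ :=
  (Matrix.of fun i j : Fin N => hMatZ X ((l i : ℤ) - (i : ℤ) + (j : ℤ))).det

/-- Partitions with at most `N` parts (weakly decreasing functions `Fin N → ℕ`). -/
def PartitionN (N : ℕ) := {l : Fin N → ℕ // Antitone l}

/-- The generalized Pochhammer symbol `(N)_λ = ∏_{(i,j) ∈ λ} (N + j - i)`
(cells `(i,j)` of the Young diagram, 1-indexed row `i` and column `j`). -/
def poch (N : ℕ) {M : ℕ} (l : Fin M → ℕ) : ℂ :=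
  ∏ i : Fin M, ∏ j ∈ Finset.range (l i), ((N : ℂ) + (j : ℂ) - ((i : ℕ) : ℂ))

/-- The unitary group `U(N)`. -/
abbrev UN (N : ℕ) := Matrix.unitaryGroup (Fin N) ℂ

instance (N : ℕ) : MeasurableSpace (UN N) := borel _

section Operators

open MvPolynomial

variable {σ : Type*}

theorem pderiv_end_comm (i j : σ) :
    ((pderiv i : Derivation ℂ (MvPolynomial σ ℂ) (MvPolynomial σ ℂ)) :
      Module.End ℂ (MvPolynomial σ ℂ)) *
      ((pderiv j : Derivation ℂ (MvPolynomial σ ℂ) (MvPolynomial σ ℂ)) :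
        Module.End ℂ (MvPolynomial σ ℂ)) =
    ((pderiv j : Derivation ℂ (MvPolynomial σ ℂ) (MvPolynomial σ ℂ)) :
      Module.End ℂ (MvPolynomial σ ℂ)) *
      ((pderiv i : Derivation ℂ (MvPolynomial σ ℂ) (MvPolynomial σ ℂ)) :
        Module.End ℂ (MvPolynomial σ ℂ)) := by
  refine LinearMap.ext fun p => MvPolynomial.ext _ _ fun m => ?_
  have h : m + Finsupp.single i 1 + Finsupp.single j 1 =
      m + Finsupp.single j 1 + Finsupp.single i 1 := add_right_comm _ _ _
  rcases eq_or_ne i j with rfl | hij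
  · rfl
  · simp [coeff_pderiv, h, hij, hij.symm]
    ring

/-- The partial derivative `∂ᵢ` as a linear endomorphism of the polynomial ring. -/
def pd (i : σ) : Module.End ℂ (MvPolynomial σ ℂ) :=
  ((pderiv i : Derivation ℂ (MvPolynomial σ ℂ) (MvPolynomial σ ℂ)) :
    Module.End ℂ (MvPolynomial σ ℂ))

theorem pd_apply (i : σ) (p : MvPolynomial σ ℂ) : pd i p = pderiv i p := rfl

theorem pd_comm (i j : σ) : pd i * pd j = pd j * pd i := pderiv_end_comm i j

/-- The commutative algebra generated by the partial derivatives. -/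
abbrev pdAlgebra (σ : Type*) : Subalgebra ℂ (Module.End ℂ (MvPolynomial σ ℂ)) :=
  Algebra.adjoin ℂ (Set.range pd)

theorem pdAlgebra_comm : IsMulCommutative (pdAlgebra σ) :=
  Algebra.isMulCommutative_adjoin ℂ (by
    rintro _ ⟨i, rfl⟩ _ ⟨j, rfl⟩
    exact pd_comm i j)

instance : CommRing (pdAlgebra σ) :=
  { (inferInstance : Ring (pdAlgebra σ)) with
    mul_comm := pdAlgebra_comm.is_comm.comm }

/-- The constant coefficient differential operator `p(∂)`, where the variable `s` is replaced
by `∂_{τ s}`. -/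
def diffOp (τ : σ → σ) : MvPolynomial σ ℂ →ₐ[ℂ] Module.End ℂ (MvPolynomial σ ℂ) :=
  (pdAlgebra σ).val.comp
    (MvPolynomial.aeval fun s => (⟨pd (τ s), Algebra.subset_adjoin ⟨τ s, rfl⟩⟩ : pdAlgebra σ))

theorem diffOp_X (τ : σ → σ) (s : σ) : diffOp τ (X s) = pd (τ s) := by
  simp [diffOp]

theorem diffOp_C (τ : σ → σ) (a : ℂ) : diffOp τ (C a) = algebraMap ℂ _ a := by
  exact (diffOp τ).commutes a

theorem diffOp_mul_apply (τ : σ → σ) (p q r : MvPolynomial σ ℂ) :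
    diffOp τ (p * q) r = diffOp τ p (diffOp τ q r) := by
  rw [map_mul]; rfl

theorem isHomogeneous_diffOp_monomial (τ : σ → σ) (m : σ →₀ ℕ) (a : ℂ) :
    ∀ {n : ℕ} {q : MvPolynomial σ ℂ}, q.IsHomogeneous n →
      (diffOp τ (monomial m a) q).IsHomogeneous (n - m.degree) := by
  induction m using Finsupp.induction_linear generalizing a with
  | zero =>
    intro n q hq
    have : diffOp τ (monomial 0 a) q = C a * q := by
      have h0 : (monomial (0 : σ →₀ ℕ) a : MvPolynomial σ ℂ) = C a := rfl
      rw [h0, diffOp_C, Module.algebraMap_end_apply, smul_eq_C_mul]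
    rw [this]
    simpa using (isHomogeneous_C σ a).mul hq
  | add f g hf hg =>
    intro n q hq
    have : (monomial (f + g) a : MvPolynomial σ ℂ) = monomial f a * monomial g 1 := by
      simp [monomial_mul]
    rw [this, diffOp_mul_apply, map_add, add_comm, ← Nat.sub_sub]
    exact hf a (hg 1 hq)
  | single s k =>
    intro n q hq
    have : (monomial (Finsupp.single s k) a : MvPolynomial σ ℂ) = C a * X s ^ k := by
      rw [C_mul_X_pow_eq_monomial]
    rw [this, diffOp_mul_apply, diffOp_C, Module.algebraMap_end_apply, smul_eq_C_mul]
    have key : ∀ k : ℕ, (diffOp τ (X s ^ k) q).IsHomogeneous (n - k) := by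
      intro k
      induction k with
      | zero => simpa using hq
      | succ k ih =>
        rw [pow_succ', diffOp_mul_apply, diffOp_X, pd_apply, ← Nat.sub_sub]
        exact ih.pderiv
    simpa using (isHomogeneous_C σ a).mul (key k)

theorem isHomogeneous_diffOp (τ : σ → σ) {k n : ℕ} {p q : MvPolynomial σ ℂ}
    (hp : p.IsHomogeneous k) (hq : q.IsHomogeneous n) :
    (diffOp τ p q).IsHomogeneous (n - k) := by
  rw [p.as_sum, map_sum, LinearMap.sum_apply]
  refine IsHomogeneous.sum _ _ _ fun m hm => ?_
  have hmk : m.degree = k := by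
    rw [← hp (mem_support_iff.mp hm), Finsupp.degree_eq_weight_one]; rfl
  exact hmk ▸ isHomogeneous_diffOp_monomial τ m _ hq

theorem eq_C_of_isHomogeneous_zero {p : MvPolynomial σ ℂ} (hp : p.IsHomogeneous 0) :
    p = C (constantCoeff p) := by
  have h := (totalDegree_eq_zero_iff_eq_C (p := p)).mp (Nat.le_zero.mp hp.totalDegree_le)
  simpa [constantCoeff_eq] using h

theorem constantCoeff_diffOp_monomial (m : σ →₀ ℕ) :
    ∀ q : MvPolynomial σ ℂ, constantCoeff (diffOp id (monomial m 1) q) =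
      (m.prod fun _ k => (k.factorial : ℂ)) * coeff m q := by
  induction m using Finsupp.induction with
  | zero =>
    intro q
    have h0 : (monomial (0 : σ →₀ ℕ) 1 : MvPolynomial σ ℂ) = 1 := rfl
    simp [h0, constantCoeff_eq]
  | single_add s k f hs hk ih =>
    intro q
    have : (monomial (Finsupp.single s k + f) 1 : MvPolynomial σ ℂ) =
        monomial f 1 * X s ^ k := by
      rw [X_pow_eq_monomial, monomial_mul, add_comm, one_mul]
    rw [this, diffOp_mul_apply, ih]
    have hfs : f s = 0 := by simpa using hs
    have key : ∀ (k : ℕ) (g : σ →₀ ℕ) (q : MvPolynomial σ ℂ), g s = 0 →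
        coeff g (diffOp id (X s ^ k) q) =
        k.factorial * coeff (Finsupp.single s k + g) q := by
      intro k g q hg
      induction k generalizing q with
      | zero => simp
      | succ k ihk =>
        rw [pow_succ, diffOp_mul_apply, ihk, diffOp_X, pd_apply, id, coeff_pderiv]
        have : Finsupp.single s k + g + Finsupp.single s 1 = Finsupp.single s (k + 1) + g := by
          rw [add_right_comm, ← Finsupp.single_add]
        rw [this, Nat.factorial_succ]
        simp [hg]
        ring
    rw [key k f q hfs]
    rw [Finsupp.prod_add_index_of_disjoint, Finsupp.prod_single_index (by simp)]
    · ring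
    · rw [Finset.disjoint_left]
      intro x hx hx'
      have := Finsupp.support_single_subset hx
      simp at this
      subst this
      exact hs hx'

variable [Fintype σ]

/-- The Laplacian `∑ ∂_s ∂_{τ s}`. -/
def lap (τ : σ → σ) : Module.End ℂ (MvPolynomial σ ℂ) := ∑ s, pd s * pd (τ s)

theorem lap_apply (τ : σ → σ) (p : MvPolynomial σ ℂ) :
    lap τ p = ∑ s, pderiv s (pderiv (τ s) p) := by
  simp [lap, LinearMap.sum_apply, pd_apply]

/-- The polarization of the Laplacian. -/
def gam (τ : σ → σ) (p q : MvPolynomial σ ℂ) : MvPolynomial σ ℂ :=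
  ∑ s, pderiv s p * pderiv (τ s) q

theorem lap_mul {τ : σ → σ} (hτ : Function.Involutive τ) (p q : MvPolynomial σ ℂ) :
    lap τ (p * q) = p * lap τ q + lap τ p * q + 2 * gam τ p q := by
  have h : ∑ s, pderiv (τ s) p * pderiv s q = ∑ s, pderiv s p * pderiv (τ s) q :=
    Fintype.sum_equiv (hτ.toPerm) _ _ fun s => by simp [hτ s]
  rw [two_mul]
  nth_rewrite 2 [gam]
  rw [← h]
  simp only [lap_apply, gam, pderiv_mul, map_add, Finset.mul_sum, Finset.sum_mul,
    ← Finset.sum_add_distrib]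
  exact Finset.sum_congr rfl fun s _ => by ring

theorem gam_X {τ : σ → σ} (s : σ) (p : MvPolynomial σ ℂ) :
    gam τ (X s) p = pderiv (τ s) p := by
  rw [gam, Finset.sum_eq_single s]
  · simp
  · intro b _ hb
    simp [pderiv_X_of_ne hb.symm]
  · simp

theorem lap_X {τ : σ → σ} (s : σ) : lap τ (X s) = 0 := by
  rw [lap_apply]
  refine Finset.sum_eq_zero fun u _ => ?_
  rw [pderiv_X]
  by_cases h : τ u = s <;> simp [h]

/-- The commutator with the Laplacian. -/
def adLap (τ : σ → σ) (T : Module.End ℂ (MvPolynomial σ ℂ)) :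
    Module.End ℂ (MvPolynomial σ ℂ) := lap τ * T - T * lap τ

theorem adLap_mulLeft_X {τ : σ → σ} (hτ : Function.Involutive τ) (s : σ) :
    adLap τ (LinearMap.mulLeft ℂ (X s)) = (2 : ℂ) • pd (τ s) := by
  refine LinearMap.ext fun p => ?_
  simp [adLap, lap_mul hτ, lap_X, gam_X, pd_apply, two_smul, two_mul]

theorem lap_comm_pd (τ : σ → σ) (s : σ) : lap τ * pd s = pd s * lap τ := by
  rw [lap, Finset.sum_mul, Finset.mul_sum]
  refine Finset.sum_congr rfl fun u _ => ?_
  rw [mul_assoc, pd_comm (τ u) s, ← mul_assoc, pd_comm u s, mul_assoc]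

theorem adLap_iterate_mulLeft_X {τ : σ → σ} (hτ : Function.Involutive τ) (s : σ)
    (T : Module.End ℂ (MvPolynomial σ ℂ)) (n : ℕ) :
    (adLap τ)^[n + 1] (LinearMap.mulLeft ℂ (X s) * T) =
      LinearMap.mulLeft ℂ (X s) * (adLap τ)^[n + 1] T +
        (2 * (n + 1) : ℂ) • (pd (τ s) * (adLap τ)^[n] T) := by
  have hbase : ∀ T, adLap τ (LinearMap.mulLeft ℂ (X s) * T) =
      LinearMap.mulLeft ℂ (X s) * adLap τ T + (2 : ℂ) • (pd (τ s) * T) := by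
    intro T
    have h := adLap_mulLeft_X hτ s
    rw [← smul_mul_assoc, ← h]
    simp only [adLap, mul_sub, sub_mul, mul_assoc]
    abel
  have hadd : ∀ S T, adLap τ (S + T) = adLap τ S + adLap τ T := by
    intro S T; simp only [adLap, mul_add, add_mul]; abel
  have hpd : ∀ (c : ℂ) T, adLap τ (c • (pd (τ s) * T)) = c • (pd (τ s) * adLap τ T) := by
    intro c T
    simp only [adLap]
    have h : lap τ * (pd (τ s) * T) = pd (τ s) * (lap τ * T) := by
      rw [← mul_assoc, lap_comm_pd, mul_assoc]
    rw [mul_smul_comm, smul_mul_assoc, h, mul_assoc, mul_sub, smul_sub]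
  induction n with
  | zero => simp [hbase]
  | succ n ih =>
    rw [Function.iterate_succ_apply', ih, hadd, hbase, hpd]
    simp only [← Function.iterate_succ_apply' (adLap τ)]
    rw [add_assoc, ← add_smul]
    congr 2
    push_cast
    ring

theorem adLap_iterate_monomial {τ : σ → σ} (hτ : Function.Involutive τ) (m : σ →₀ ℕ) (a : ℂ) :
    (adLap τ)^[m.degree] (LinearMap.mulLeft ℂ (monomial m a)) =
        (2 ^ m.degree * m.degree.factorial : ℂ) • diffOp τ (monomial m a) ∧
      (adLap τ)^[m.degree + 1] (LinearMap.mulLeft ℂ (monomial m a)) = 0 := by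
  have h : ∀ (k : ℕ) (m : σ →₀ ℕ), m.degree = k →
    (adLap τ)^[k] (LinearMap.mulLeft ℂ (monomial m a)) =
        (2 ^ k * k.factorial : ℂ) • diffOp τ (monomial m a) ∧
      (adLap τ)^[k + 1] (LinearMap.mulLeft ℂ (monomial m a)) = 0 := by
    intro k
    induction k with
    | zero =>
      intro m hm
      have hm0 : m = 0 := (Finsupp.degree_eq_zero_iff m).mp hm
      subst hm0
      have h0 : (monomial (0 : σ →₀ ℕ) a : MvPolynomial σ ℂ) = C a := rfl
      have h1 : LinearMap.mulLeft ℂ (C a : MvPolynomial σ ℂ) = algebraMap ℂ _ a := by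
        refine LinearMap.ext fun p => ?_
        simp [smul_eq_C_mul]
      rw [h0, diffOp_C, h1]
      refine ⟨by simp, ?_⟩
      simp only [zero_add, Function.iterate_one, adLap]
      rw [Algebra.commutes, sub_self]
    | succ k ih =>
      intro m hm
      obtain ⟨s, hs⟩ : ∃ s, m s ≠ 0 := by
        by_contra! hcon
        have : m = 0 := Finsupp.ext hcon
        simp [this] at hm
      have hle : Finsupp.single s 1 ≤ m := by
        rw [Finsupp.single_le_iff]; omega
      obtain ⟨m', rfl⟩ := exists_add_of_le hle
      have hm' : m'.degree = k := by
        rw [map_add, Finsupp.degree_single] at hm; omega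
      obtain ⟨h1, h2⟩ := ih m' hm'
      have hmul : (monomial (Finsupp.single s 1 + m') a : MvPolynomial σ ℂ) =
          X s * monomial m' a := by
        rw [X, monomial_mul, one_mul]
      have hL : LinearMap.mulLeft ℂ (X s * monomial m' a : MvPolynomial σ ℂ) =
          LinearMap.mulLeft ℂ (X s) * LinearMap.mulLeft ℂ (monomial m' a) :=
        LinearMap.ext fun p => by simp
      rw [hmul, hL, adLap_iterate_mulLeft_X hτ, adLap_iterate_mulLeft_X hτ]
      have h3 : (adLap τ)^[k + 1 + 1] (LinearMap.mulLeft ℂ (monomial m' a)) = 0 := by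
        rw [Function.iterate_succ_apply', h2]
        simp [adLap]
      rw [h2, h3, h1, map_mul, diffOp_X]
      refine ⟨?_, by simp⟩
      rw [mul_zero, zero_add, mul_smul_comm, smul_smul, Nat.factorial_succ]
      congr 1
      push_cast
      ring
  exact h _ m rfl

theorem adLap_iterate_of_isHomogeneous {τ : σ → σ} (hτ : Function.Involutive τ) {k : ℕ}
    {p : MvPolynomial σ ℂ} (hp : p.IsHomogeneous k) :
    (adLap τ)^[k] (LinearMap.mulLeft ℂ p) = (2 ^ k * k.factorial : ℂ) • diffOp τ p := by
  let A : Module.End ℂ (Module.End ℂ (MvPolynomial σ ℂ)) :=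
    LinearMap.mulLeft ℂ (lap τ) - LinearMap.mulRight ℂ (lap τ)
  have hA : ∀ T, (adLap τ)^[k] T = (A ^ k) T := by
    intro T
    rw [Module.End.pow_apply]
    rfl
  have hsum : LinearMap.mulLeft ℂ p =
      ∑ m ∈ p.support, LinearMap.mulLeft ℂ (monomial m (coeff m p)) := by
    refine LinearMap.ext fun q => ?_
    simp only [LinearMap.sum_apply, LinearMap.mulLeft_apply]
    rw [← Finset.sum_mul, ← p.as_sum]
  rw [hsum, hA, map_sum]
  conv_rhs => rw [p.as_sum, map_sum, Finset.smul_sum]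
  refine Finset.sum_congr rfl fun m hm => ?_
  have hmk : m.degree = k := by
    rw [← hp (mem_support_iff.mp hm), Finsupp.degree_eq_weight_one]; rfl
  rw [← hA, ← hmk]
  exact (adLap_iterate_monomial hτ m _).1

end Operators

section JacobiTrudi

variable {R S : Type*} [CommRing R] [Algebra ℂ R] [CommRing S] [Algebra ℂ S] {N : ℕ}

/-- The complete homogeneous elements attached by Newton's identities to a sequence of
power sums `p`. -/
def hSeq (p : ℕ → R) : ℕ → R
  | 0 => 1
  | (k+1) => ((k : ℂ) + 1)⁻¹ • ∑ m ∈ Finset.range (k+1), p (m+1) * hSeq p (k - m)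
  termination_by k => k
  decreasing_by exact Nat.lt_succ_of_le (Nat.sub_le _ _)

/-- Extension of `hSeq` by zero to negative indices. -/
def hSeqZ (p : ℕ → R) (k : ℤ) : R := if k < 0 then 0 else hSeq p k.toNat

/-- The Jacobi-Trudi determinant attached to a sequence of power sums. -/
def jacobiTrudi (p : ℕ → R) (l : Fin N → ℕ) : R :=
  (Matrix.of fun i j : Fin N => hSeqZ p ((l i : ℤ) - (i : ℤ) + (j : ℤ))).det

theorem hSeq_succ (p : ℕ → R) (k : ℕ) :
    hSeq p (k + 1) = ((k : ℂ) + 1)⁻¹ • ∑ m ∈ Finset.range (k+1), p (m+1) * hSeq p (k - m) := by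
  rw [hSeq]

theorem hSeq_zero (p : ℕ → R) : hSeq p 0 = 1 := by rw [hSeq]

theorem hMat_eq_hSeq (X : Matrix (Fin N) (Fin N) ℂ) (k : ℕ) :
    hMat X k = hSeq (fun m => (X ^ m).trace) k := by
  induction k using Nat.strong_induction_on with
  | _ k ih =>
    cases k with
    | zero => rw [hMat, hSeq]
    | succ k =>
      rw [hMat, hSeq, smul_eq_mul]
      congr 1
      exact Finset.sum_congr rfl fun m _ => by rw [ih (k - m) (by omega)]

theorem schur_eq_jacobiTrudi (l : Fin N → ℕ) (X : Matrix (Fin N) (Fin N) ℂ) :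
    schur l X = jacobiTrudi (fun m => (X ^ m).trace) l := by
  simp only [schur, jacobiTrudi, hMatZ, hSeqZ, hMat_eq_hSeq]

theorem map_hSeq (φ : R →ₐ[ℂ] S) (p : ℕ → R) (k : ℕ) :
    φ (hSeq p k) = hSeq (fun m => φ (p m)) k := by
  induction k using Nat.strong_induction_on with
  | _ k ih =>
    cases k with
    | zero => simp [hSeq_zero]
    | succ k =>
      rw [hSeq_succ, hSeq_succ, map_smul, map_sum]
      congr 1
      exact Finset.sum_congr rfl fun m _ => by rw [map_mul, ih (k - m) (by omega)]

theorem map_jacobiTrudi (φ : R →ₐ[ℂ] S) (p : ℕ → R) (l : Fin N → ℕ) :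
    φ (jacobiTrudi p l) = jacobiTrudi (fun m => φ (p m)) l := by
  rw [jacobiTrudi, AlgHom.map_det, jacobiTrudi]
  congr 1
  ext i j
  simp only [AlgHom.mapMatrix_apply, Matrix.map_apply, Matrix.of_apply, hSeqZ]
  split_ifs
  · exact map_zero φ
  · exact map_hSeq φ p _

theorem hSeq_mem {A : Subalgebra ℂ R} {p : ℕ → R} (hp : ∀ m, p m ∈ A) (k : ℕ) :
    hSeq p k ∈ A := by
  induction k using Nat.strong_induction_on with
  | _ k ih =>
    cases k with
    | zero => rw [hSeq_zero]; exact A.one_mem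
    | succ k =>
      rw [hSeq_succ]
      exact A.smul_mem (A.sum_mem fun m _ => A.mul_mem (hp _) (ih _ (by omega))) _

theorem jacobiTrudi_mem {A : Subalgebra ℂ R} {p : ℕ → R} (hp : ∀ m, p m ∈ A)
    (l : Fin N → ℕ) : jacobiTrudi p l ∈ A := by
  rw [jacobiTrudi, Matrix.det_apply']
  refine A.sum_mem fun σ _ => A.mul_mem (A.intCast_mem _) (A.prod_mem fun i _ => ?_)
  simp only [Matrix.of_apply, hSeqZ]
  split_ifs
  · exact A.zero_mem
  · exact hSeq_mem hp _

open MvPolynomial in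
theorem isHomogeneous_hSeq {ι : Type*} {p : ℕ → MvPolynomial ι ℂ}
    (hp : ∀ m, (p m).IsHomogeneous m) (k : ℕ) : (hSeq p k).IsHomogeneous k := by
  induction k using Nat.strong_induction_on with
  | _ k ih =>
    cases k with
    | zero => rw [hSeq_zero]; exact isHomogeneous_one _ _
    | succ k =>
      rw [hSeq_succ, smul_eq_C_mul]
      refine IsHomogeneous.C_mul (IsHomogeneous.sum _ _ _ fun m hm => ?_) _
      have hm' : m < k + 1 := Finset.mem_range.mp hm
      have h := (hp (m + 1)).mul (ih (k - m) (by omega))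
      rwa [show m + 1 + (k - m) = k + 1 by omega] at h

open MvPolynomial in
theorem isHomogeneous_jacobiTrudi {ι : Type*} {p : ℕ → MvPolynomial ι ℂ}
    (hp : ∀ m, (p m).IsHomogeneous m) (l : Fin N → ℕ) :
    (jacobiTrudi p l).IsHomogeneous (∑ i, l i) := by
  rw [jacobiTrudi, Matrix.det_apply]
  refine IsHomogeneous.sum _ _ _ fun σ _ => ?_
  rw [Units.smul_def, ← Int.cast_smul_eq_zsmul ℂ, smul_eq_C_mul]
  refine IsHomogeneous.C_mul ?_ _
  by_cases h : ∃ i, (l (σ i) : ℤ) - (σ i : ℕ) + (i : ℕ) < 0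
  · obtain ⟨i, hi⟩ := h
    rw [Finset.prod_eq_zero (Finset.mem_univ i)]
    · exact isHomogeneous_zero _ _ _
    · simp only [Matrix.of_apply, hSeqZ, hi, if_true]
  · push Not at h
    have hsum : ∑ i, l i = ∑ i, ((l (σ i) : ℤ) - (σ i : ℕ) + (i : ℕ)).toNat := by
      zify
      rw [Finset.sum_congr rfl fun i _ => Int.toNat_of_nonneg (h i)]
      rw [Finset.sum_add_distrib, Finset.sum_sub_distrib,
        Equiv.sum_comp σ fun i => (l i : ℤ), Equiv.sum_comp σ fun i => ((i : ℕ) : ℤ)]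
      ring
    rw [hsum]
    refine IsHomogeneous.prod _ _ _ fun i _ => ?_
    simp only [Matrix.of_apply, hSeqZ, not_lt.mpr (h i), if_false]
    exact isHomogeneous_hSeq hp _

open PowerSeries in
theorem hSeq_powerSum {ι : Type*} [Fintype ι] (x : ι → R) (k : ℕ) :
    hSeq (fun m => ∑ i, x i ^ m) k =
      coeff k (∏ i, (PowerSeries.mk fun n => x i ^ n)) := by
  set G : ι → PowerSeries R := fun i => PowerSeries.mk fun n => x i ^ n with hG
  have hd : ∀ i, derivative R (G i) = G i * (PowerSeries.mk fun n => x i ^ (n + 1)) := by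
    intro i
    ext n
    rw [coeff_derivative, coeff_mul, Finset.sum_congr rfl
      (g := fun _ => x i ^ (n + 1))]
    · simp [hG]; ring
    · intro a ha
      have := Finset.HasAntidiagonal.mem_antidiagonal.mp ha
      simp only [hG, coeff_mk]
      rw [← pow_add, ← this, add_assoc]
  have hprod : ∀ s : Finset ι, derivative R (∏ i ∈ s, G i) =
      (∏ i ∈ s, G i) * ∑ i ∈ s, PowerSeries.mk fun n => x i ^ (n + 1) := by
    intro s
    induction s using Finset.induction_on with
    | empty => simp
    | insert a s ha ih =>
      rw [Finset.prod_insert ha, Finset.sum_insert ha, Derivation.leibniz, ih, hd]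
      simp only [smul_eq_mul]
      ring
  induction k using Nat.strong_induction_on with
  | _ k ih =>
    cases k with
    | zero =>
      rw [hSeq_zero, coeff_zero_eq_constantCoeff_apply, map_prod]
      simp [← coeff_zero_eq_constantCoeff_apply]
    | succ k =>
      have h := congrArg (coeff k) (hprod Finset.univ)
      rw [coeff_derivative, mul_comm _ (∑ i, _), coeff_mul,
        Finset.Nat.sum_antidiagonal_eq_sum_range_succ_mk] at h
      rw [hSeq_succ, inv_smul_eq_iff₀ (by exact_mod_cast Nat.succ_ne_zero k)]
      rw [Algebra.smul_def, map_add, map_natCast, map_one, mul_comm, h]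
      refine Finset.sum_congr rfl fun m hm => ?_
      rw [ih (k - m) (by omega), map_sum]
      simp

/-- The alternant `det (x_k ^ d_i)`. -/
def alternant (x : Fin N → R) (d : Fin N → ℕ) : R :=
  (Matrix.of fun i k : Fin N => x k ^ d i).det

/-- The strictly decreasing exponent vector `λ + δ` with `δ = (N-1, …, 1, 0)`. -/
def addStair (l : Fin N → ℕ) (i : Fin N) : ℕ := l i + (N - 1 - i)

open PowerSeries in
theorem exists_mul_complete (x : Fin N → R) :
    ∃ E : Matrix (Fin N) (Fin N) R, ∀ l : Fin N → ℕ,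
      (Matrix.of fun i k : Fin N => x k ^ addStair l i) =
      (Matrix.of fun i j : Fin N =>
        hSeqZ (fun m => ∑ i, x i ^ m) ((l i : ℤ) - (i : ℤ) + (j : ℤ))) * E := by
  let P : Fin N → Polynomial R := fun k =>
    ∏ i ∈ Finset.univ.erase k, (1 - Polynomial.C (x i) * Polynomial.X)
  have hdeg : ∀ k, (P k).natDegree ≤ N - 1 := by
    intro k
    refine (Polynomial.natDegree_prod_le _ _).trans ?_
    refine (Finset.sum_le_card_nsmul _ _ 1 fun i _ => ?_).trans ?_
    · refine (Polynomial.natDegree_sub_le _ _).trans ?_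
      simpa using (Polynomial.natDegree_C_mul_X_pow_le (x i) 1)
    · simp
  have hgeom : ∀ i, (PowerSeries.mk fun n => x i ^ n) * (1 - C (x i) * X) = 1 := by
    intro i
    ext n
    rw [mul_sub, mul_one, ← mul_assoc, map_sub]
    cases n with
    | zero => simp
    | succ n => simp [coeff_succ_mul_X, coeff_one, pow_succ]
  have hE : ∀ k, (∏ i, (PowerSeries.mk fun n => x i ^ n)) * (P k : PowerSeries R) =
      PowerSeries.mk fun n => x k ^ n := by
    intro k
    have hc : (P k : PowerSeries R) = ∏ i ∈ Finset.univ.erase k, (1 - C (x i) * X) := by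
      have := map_prod (Polynomial.coeToPowerSeries.ringHom (R := R))
        (fun i => (1 - Polynomial.C (x i) * Polynomial.X)) (Finset.univ.erase k)
      simp only [P]
      refine this.trans (Finset.prod_congr rfl fun i _ => ?_)
      simp
    rw [hc, ← Finset.mul_prod_erase _ _ (Finset.mem_univ k), mul_assoc, ← Finset.prod_mul_distrib,
      Finset.prod_congr rfl fun i _ => hgeom i]
    simp
  refine ⟨Matrix.of fun j k => (P k).coeff (N - 1 - j), fun l => ?_⟩
  ext i k
  have h := congrArg (coeff (addStair l i)) (hE k)
  rw [coeff_mk, mul_comm, coeff_mul, Finset.Nat.sum_antidiagonal_eq_sum_range_succ_mk] at h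
  rw [Matrix.of_apply, ← h, Matrix.mul_apply]
  simp only [Matrix.of_apply, Polynomial.coeff_coe]
  have hi := i.2
  -- both sums agree with the sum over `r < N` with `h` extended by zero
  have hN : ∑ r ∈ Finset.range N, hSeqZ (fun m => ∑ i, x i ^ m) ((addStair l i : ℤ) - r) *
      (P k).coeff r =
      ∑ j : Fin N, hSeqZ (fun m => ∑ i, x i ^ m) ((l i : ℤ) - (i : ℤ) + (j : ℤ)) *
        (P k).coeff (N - 1 - j) := by
    rw [Finset.sum_range, ← Equiv.sum_comp Fin.revPerm]
    refine Finset.sum_congr rfl fun j _ => ?_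
    have hj := j.2
    simp only [Fin.revPerm_apply, Fin.val_rev, addStair]
    congr 2
    · omega
    · omega
  rw [← hN]
  set M := max N (addStair l i + 1) with hM
  have h1 : ∑ r ∈ Finset.range N, hSeqZ (fun m => ∑ i, x i ^ m) ((addStair l i : ℤ) - r) *
      (P k).coeff r = ∑ r ∈ Finset.range M,
      hSeqZ (fun m => ∑ i, x i ^ m) ((addStair l i : ℤ) - r) * (P k).coeff r := by
    refine Finset.sum_subset (Finset.range_subset_range.mpr (le_max_left _ _)) fun r _ hr => ?_
    rw [Polynomial.coeff_eq_zero_of_natDegree_lt, mul_zero]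
    have := hdeg k
    simp only [Finset.mem_range] at hr
    omega
  rw [h1]
  symm
  rw [← Finset.sum_subset (Finset.range_subset_range.mpr (le_max_right N (addStair l i + 1)))]
  · refine Finset.sum_congr rfl fun r hr => ?_
    have hr' := Finset.mem_range.mp hr
    rw [hSeqZ, if_neg (by omega), hSeq_powerSum, mul_comm]
    congr 3
    omega
  · intro r _ hr
    simp only [Finset.mem_range] at hr
    rw [hSeqZ, if_pos (by omega), zero_mul]

theorem alternant_eq_jacobiTrudi_mul (x : Fin N → R) (l : Fin N → ℕ) :
    alternant x (addStair l) =
      jacobiTrudi (fun m => ∑ i, x i ^ m) l * alternant x (addStair 0) := by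
  obtain ⟨E, hE⟩ := exists_mul_complete x
  have h0 : jacobiTrudi (fun m => ∑ i, x i ^ m) (0 : Fin N → ℕ) = 1 := by
    rw [jacobiTrudi, Matrix.det_of_isUpperTriangular]
    · refine Finset.prod_eq_one fun i _ => ?_
      simp [hSeqZ, hSeq_zero]
    · intro i j hij
      have : (j : ℕ) < i := hij
      simp only [Matrix.of_apply, hSeqZ, Pi.zero_apply, Nat.cast_zero]
      rw [if_pos (by omega)]
  have h : ∀ l : Fin N → ℕ, alternant x (addStair l) =
      jacobiTrudi (fun m => ∑ i, x i ^ m) l * E.det := by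
    intro l
    rw [alternant, hE, Matrix.det_mul, jacobiTrudi]
  rw [h l, h 0, h0, one_mul]

end JacobiTrudi

section RadialPart

open MvPolynomial

section Gamma

variable {σ : Type*} [Fintype σ] {τ : σ → σ}

theorem gam_add_left (p q r : MvPolynomial σ ℂ) : gam τ (p + q) r = gam τ p r + gam τ q r := by
  simp [gam, add_mul, Finset.sum_add_distrib]

theorem gam_add_right (p q r : MvPolynomial σ ℂ) : gam τ p (q + r) = gam τ p q + gam τ p r := by
  simp [gam, mul_add, Finset.sum_add_distrib]

theorem gam_C_left (a : ℂ) (r : MvPolynomial σ ℂ) : gam τ (C a) r = 0 := by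
  simp [gam]

theorem gam_C_right (a : ℂ) (r : MvPolynomial σ ℂ) : gam τ r (C a) = 0 := by
  simp [gam]

theorem gam_mul_left (p q r : MvPolynomial σ ℂ) :
    gam τ (p * q) r = p * gam τ q r + q * gam τ p r := by
  simp only [gam, pderiv_mul, Finset.mul_sum, ← Finset.sum_add_distrib]
  exact Finset.sum_congr rfl fun s _ => by ring

theorem gam_mul_right (p q r : MvPolynomial σ ℂ) :
    gam τ r (p * q) = p * gam τ r q + q * gam τ r p := by
  simp only [gam, pderiv_mul, Finset.mul_sum, ← Finset.sum_add_distrib]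
  exact Finset.sum_congr rfl fun s _ => by ring

end Gamma

variable {N : ℕ}

/-- The generic `N × N` matrix. -/
abbrev genMat (N : ℕ) : Matrix (Fin N) (Fin N) (MvPolynomial (Fin N × Fin N) ℂ) :=
  Matrix.mvPolynomialX (Fin N) (Fin N) ℂ

/-- The trace of the `m`-th power of the generic matrix. -/
def trPow (N m : ℕ) : MvPolynomial (Fin N × Fin N) ℂ := (genMat N ^ m).trace

/-- The algebra generated by the traces of powers of the generic matrix. -/
def invAlg (N : ℕ) : Subalgebra ℂ (MvPolynomial (Fin N × Fin N) ℂ) :=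
  Algebra.adjoin ℂ (Set.range (trPow N))

theorem trPow_mem (m : ℕ) : trPow N m ∈ invAlg N := Algebra.subset_adjoin ⟨m, rfl⟩

/-- Restriction of a polynomial on matrices to diagonal matrices. -/
def resDiag (N : ℕ) : MvPolynomial (Fin N × Fin N) ℂ →ₐ[ℂ] MvPolynomial (Fin N) ℂ :=
  aeval fun s => if s.1 = s.2 then X s.1 else 0

theorem resDiag_trPow (m : ℕ) :
    resDiag N (trPow N m) = ∑ i, (X i : MvPolynomial (Fin N) ℂ) ^ m := by
  have h : (resDiag N).mapMatrix (genMat N) = Matrix.diagonal X := by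
    ext1 i j
    simp [resDiag, Matrix.mvPolynomialX, Matrix.diagonal_apply]
  have : resDiag N (trPow N m) = ((resDiag N).mapMatrix (genMat N ^ m)).trace := by
    simp [trPow, Matrix.trace]
  rw [this, map_pow, h, Matrix.diagonal_pow, Matrix.trace_diagonal]
  simp

theorem pderiv_genMat_pow (i j a b : Fin N) (k : ℕ) :
    pderiv (i, j) ((genMat N ^ k) a b) =
      ∑ c ∈ Finset.range k, (genMat N ^ c) a i * (genMat N ^ (k - 1 - c)) j b := by
  induction k generalizing b with
  | zero => by_cases h : a = b <;> simp [Matrix.one_apply, h]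
  | succ k ih =>
    have hX : ∀ e, pderiv (i, j) (genMat N e b) =
        if e = i then (if j = b then 1 else 0) else 0 := by
      intro e
      rw [show genMat N e b = X (e, b) from rfl, pderiv_X]
      rcases eq_or_ne e i with rfl | h1
      · by_cases h2 : j = b <;> simp [h2]
      · by_cases h2 : j = b <;> simp [h1, h2]
    rw [pow_succ, Matrix.mul_apply, map_sum]
    simp only [pderiv_mul, hX, ih, Finset.sum_add_distrib, Finset.sum_range_succ]
    congr 1
    · simp only [Finset.sum_mul]
      rw [Finset.sum_comm]
      refine Finset.sum_congr rfl fun c hc => ?_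
      have hc' := Finset.mem_range.mp hc
      simp only [mul_assoc, ← Finset.mul_sum]
      rw [show k + 1 - 1 - c = k - 1 - c + 1 by omega, pow_succ, Matrix.mul_apply]
    · simp [Matrix.one_apply]

theorem pderiv_trPow (i j : Fin N) (k : ℕ) :
    pderiv (i, j) (trPow N k) = k * (genMat N ^ (k - 1)) j i := by
  simp only [trPow, Matrix.trace, Matrix.diag, map_sum, pderiv_genMat_pow]
  rw [Finset.sum_comm, Finset.sum_congr rfl (g := fun _ => (genMat N ^ (k - 1)) j i)]
  · simp
  · intro c hc
    have hc' := Finset.mem_range.mp hc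
    rw [show k - 1 = (k - 1 - c) + c by omega, pow_add, Matrix.mul_apply]
    refine Finset.sum_congr rfl fun a _ => ?_
    rw [mul_comm, show k - 1 - c + c - c = k - 1 - c by omega]

theorem gam_trPow (k l : ℕ) :
    gam Prod.swap (trPow N k) (trPow N l) =
      (k : MvPolynomial (Fin N × Fin N) ℂ) * l * trPow N (k - 1 + (l - 1)) := by
  simp only [gam, Fintype.sum_prod_type, Prod.swap_prod_mk, pderiv_trPow]
  rw [trPow, pow_add, Matrix.trace, Finset.mul_sum, Finset.sum_comm]
  refine Finset.sum_congr rfl fun j _ => ?_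
  rw [Matrix.diag_apply, Matrix.mul_apply, Finset.mul_sum]
  exact Finset.sum_congr rfl fun i _ => by ring

theorem lap_trPow_succ (n : ℕ) :
    lap Prod.swap (trPow N (n + 1)) =
      (n + 1) * ∑ c ∈ Finset.range n, trPow N c * trPow N (n - 1 - c) := by
  simp only [lap_apply, Fintype.sum_prod_type, Prod.swap_prod_mk, pderiv_trPow]
  have h : ∀ i j : Fin N, pderiv (i, j) (((n + 1 : ℕ) : MvPolynomial (Fin N × Fin N) ℂ) *
      (genMat N ^ (n + 1 - 1)) i j) = (n + 1) * ∑ c ∈ Finset.range n,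
        (genMat N ^ c) i i * (genMat N ^ (n - 1 - c)) j j := by
    intro i j
    rw [pderiv_mul, ← map_natCast C, pderiv_C, pderiv_genMat_pow]
    simp
  simp only [h, ← Finset.mul_sum]
  congr 1
  simp only [trPow, Matrix.trace, Matrix.diag_apply, Finset.sum_mul_sum]
  rw [Finset.sum_comm]
  have : ∀ f : Fin N → Fin N → ℕ → MvPolynomial (Fin N × Fin N) ℂ,
      ∑ j, ∑ i, ∑ c ∈ Finset.range n, f i j c = ∑ c ∈ Finset.range n, ∑ i, ∑ j, f i j c := by
    intro f
    rw [Finset.sum_comm' (t' := Finset.univ) (s' := fun _ => Finset.univ) (by simp)]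
    rw [Finset.sum_comm' (s := Finset.range n) (t := fun _ => Finset.univ) (t' := Finset.univ)
      (s' := fun _ => Finset.range n) (by simp)]
    refine Finset.sum_congr rfl fun i _ => ?_
    rw [Finset.sum_comm]
  exact this _

theorem gam_mem_and_resDiag_gam {f g : MvPolynomial (Fin N × Fin N) ℂ}
    (hf : f ∈ invAlg N) (hg : g ∈ invAlg N) :
    gam Prod.swap f g ∈ invAlg N ∧
      resDiag N (gam Prod.swap f g) = gam id (resDiag N f) (resDiag N g) := by
  induction hf using Algebra.adjoin_induction with
  | mem f hf =>
    obtain ⟨k, rfl⟩ := hf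
    induction hg using Algebra.adjoin_induction with
    | mem g hg =>
      obtain ⟨l, rfl⟩ := hg
      rw [gam_trPow]
      refine ⟨mul_mem (mul_mem (natCast_mem _ _) (natCast_mem _ _)) (trPow_mem _), ?_⟩
      rw [map_mul, map_mul, map_natCast, map_natCast]
      simp only [resDiag_trPow, gam, id, map_sum, pderiv_pow]
      rw [Finset.mul_sum]
      refine Finset.sum_congr rfl fun i _ => ?_
      rw [Finset.sum_eq_single i, Finset.sum_eq_single i]
      · simp only [pderiv_X_self, pow_add]; ring
      · intro b _ hb; simp [pderiv_X_of_ne hb]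
      · simp
      · intro b _ hb; simp [pderiv_X_of_ne hb]
      · simp
    | algebraMap r =>
      rw [algebraMap_eq, gam_C_right, algHom_C, algebraMap_eq, gam_C_right]
      exact ⟨zero_mem _, map_zero _⟩
    | add x y hx hy h1 h2 =>
      rw [gam_add_right, map_add, map_add, gam_add_right, h1.2, h2.2]
      exact ⟨add_mem h1.1 h2.1, rfl⟩
    | mul x y hx hy h1 h2 =>
      rw [gam_mul_right, map_add, map_mul, map_mul, map_mul, gam_mul_right, h1.2, h2.2]
      exact ⟨add_mem (mul_mem hx h2.1) (mul_mem hy h1.1), rfl⟩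
  | algebraMap r =>
    rw [algebraMap_eq, gam_C_left, algHom_C, algebraMap_eq, gam_C_left]
    exact ⟨zero_mem _, map_zero _⟩
  | add x y hx hy h1 h2 =>
    rw [gam_add_left, map_add, map_add, gam_add_left, h1.2, h2.2]
    exact ⟨add_mem h1.1 h2.1, rfl⟩
  | mul x y hx hy h1 h2 =>
    rw [gam_mul_left, map_add, map_mul, map_mul, map_mul, gam_mul_left, h1.2, h2.2]
    exact ⟨add_mem (mul_mem hx h2.1) (mul_mem hy h1.1), rfl⟩

/-- The Vandermonde determinant `det (x_k ^ (N-1-i))`. -/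
def vdm (N : ℕ) : MvPolynomial (Fin N) ℂ := alternant X (addStair 0)

theorem exists_vdm_eq_prod (N : ℕ) :
    ∃ ε : ℤ, vdm N = ε • ∏ i, ∏ j ∈ Finset.Ioi i, (X j - X i : MvPolynomial (Fin N) ℂ) := by
  refine ⟨Equiv.Perm.sign (Fin.revPerm : Equiv.Perm (Fin N)), ?_⟩
  have h : (Matrix.of fun i k : Fin N => (X k : MvPolynomial (Fin N) ℂ) ^ addStair 0 i) =
      ((Matrix.vandermonde X)ᵀ).submatrix Fin.revPerm id := by
    ext1 i k
    simp only [Matrix.of_apply, Matrix.submatrix_apply, Matrix.transpose_apply,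
      Matrix.vandermonde_apply, id, addStair, Pi.zero_apply, zero_add, Fin.revPerm_apply,
      Fin.val_rev]
    congr 1
    omega
  rw [vdm, alternant, h, Matrix.det_permute, Matrix.det_transpose, Matrix.det_vandermonde]
  simp

theorem sum_pow_mul_pderiv_vdm (n : ℕ) :
    ∑ i, pderiv i (vdm N) * X i ^ n = vdm N * ∑ i, ∑ j ∈ Finset.Ioi i,
      ∑ c ∈ Finset.range n, (X j : MvPolynomial (Fin N) ℂ) ^ c * X i ^ (n - 1 - c) := by
  let E : Derivation ℂ (MvPolynomial (Fin N) ℂ) (MvPolynomial (Fin N) ℂ) :=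
    MvPolynomial.mkDerivation ℂ fun i => X i ^ n
  have hE : ∀ p, E p = ∑ i, pderiv i p * X i ^ n := by
    intro p
    induction p using MvPolynomial.induction_on with
    | C a => simp [E, derivation_C]
    | add p q hp hq => rw [map_add, hp, hq]; simp [add_mul, Finset.sum_add_distrib]
    | mul_X p j hp =>
      rw [Derivation.leibniz, hp, mkDerivation_X]
      simp only [pderiv_mul, add_mul, Finset.sum_add_distrib, smul_eq_mul, Finset.mul_sum]
      rw [add_comm]
      congr 1
      · exact Finset.sum_congr rfl fun i _ => by ring
      · rw [Finset.sum_eq_single j]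
        · simp
        · intro b _ hb; simp [pderiv_X_of_ne (Ne.symm hb)]
        · simp
  have hprod : ∀ {ι : Type} (s : Finset ι) (f g : ι → MvPolynomial (Fin N) ℂ),
      (∀ i ∈ s, E (f i) = f i * g i) → E (∏ i ∈ s, f i) = (∏ i ∈ s, f i) * ∑ i ∈ s, g i := by
    intro ι s f g
    induction s using Finset.induction_on with
    | empty => simp
    | insert a s ha ih =>
      intro h
      rw [Finset.prod_insert ha, Finset.sum_insert ha, Derivation.leibniz,
        ih fun i hi => h i (Finset.mem_insert_of_mem hi), h a (Finset.mem_insert_self a s)]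
      simp only [smul_eq_mul]
      ring
  obtain ⟨ε, hε⟩ := exists_vdm_eq_prod N
  rw [← hE, hε, Derivation.map_smul_of_tower, smul_mul_assoc]
  congr 1
  refine hprod _ _ _ fun i _ => hprod _ _ _ fun j _ => ?_
  rw [map_sub, mkDerivation_X, mkDerivation_X, ← geom_sum₂_mul, mul_comm]

theorem sum_sum_eq_diag_add {M : Type*} [AddCommMonoid M] (f : Fin N → Fin N → M) :
    ∑ i, ∑ j, f i j = ∑ i, f i i + ∑ i, ∑ j ∈ Finset.Ioi i, (f i j + f j i) := by
  have h : ∀ i, ∑ j, f i j = f i i + ∑ j ∈ Finset.Ioi i, f i j + ∑ j ∈ Finset.Iio i, f i j := by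
    intro i
    rw [← Finset.sum_filter_add_sum_filter_not Finset.univ (fun j => i ≤ j)]
    congr 1
    · rw [← Finset.sum_insert (by simp)]
      refine Finset.sum_congr ?_ fun _ _ => rfl
      ext j
      simp [le_iff_eq_or_lt]
    · refine Finset.sum_congr ?_ fun _ _ => rfl
      ext j
      simp
  simp only [h, Finset.sum_add_distrib]
  rw [add_assoc]
  congr 2
  exact Finset.sum_comm' (by simp)

theorem prod_X_pow_eq_monomial' {ι : Type*} [Fintype ι] (e : ι → ℕ) :
    ∏ i, (X i : MvPolynomial ι ℂ) ^ e i = monomial (Finsupp.equivFunOnFinite.symm e) 1 := by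
  rw [monomial_eq, Finsupp.prod_fintype _ _ (by simp)]
  simp

theorem pderiv_prod_X_pow {ι : Type*} [Fintype ι] [DecidableEq ι] (e : ι → ℕ) (k : ι) :
    pderiv k (∏ i, (X i : MvPolynomial ι ℂ) ^ e i) =
      (e k : ℂ) • ∏ i, (X i : MvPolynomial ι ℂ) ^ (Function.update e k (e k - 1)) i := by
  rw [prod_X_pow_eq_monomial', prod_X_pow_eq_monomial', pderiv_monomial, smul_monomial]
  congr 1
  · congr 1
    ext i
    by_cases h : i = k
    · subst h; simp
    · simp [h, Function.update_of_ne]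
  · simp

theorem alternant_X_eq_sum (d : Fin N → ℕ) :
    alternant (X : Fin N → MvPolynomial (Fin N) ℂ) d =
      ∑ σ : Equiv.Perm (Fin N), Equiv.Perm.sign σ • ∏ i, (X i) ^ d (σ i) := by
  rw [alternant, Matrix.det_apply]
  rfl

theorem lap_alternant (d : Fin N → ℕ) :
    lap id (alternant (X : Fin N → MvPolynomial (Fin N) ℂ) d) =
      ∑ j, ((d j : ℂ) * ((d j - 1 : ℕ) : ℂ)) • alternant X (Function.update d j (d j - 2)) := by
  simp only [alternant_X_eq_sum, Finset.smul_sum, map_sum]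
  rw [Finset.sum_comm]
  refine Finset.sum_congr rfl fun σ _ => ?_
  rw [lap_apply]
  conv_rhs => rw [← Equiv.sum_comp σ]
  refine Finset.sum_congr rfl fun k _ => ?_
  rw [Units.smul_def, map_zsmul, map_zsmul, Units.smul_def, smul_comm]
  congr 1
  have := pderiv_prod_X_pow (fun i => d (σ i)) k
  rw [id, this, Derivation.map_smul, pderiv_prod_X_pow, smul_smul]
  simp only [Function.update_self, Function.update_idem]
  congr 1
  refine Finset.prod_congr rfl fun i _ => ?_
  congr 1
  by_cases h : i = k
  · subst h
    simp only [Function.update_self]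
    omega
  · rw [Function.update_of_ne h, Function.update_of_ne (fun h' => h (σ.injective h'))]

theorem alternant_eq_zero {R : Type*} [CommRing R] (x : Fin N → R) {d : Fin N → ℕ} {i j : Fin N}
    (hij : i ≠ j) (h : d i = d j) : alternant x d = 0 :=
  Matrix.det_zero_of_row_eq hij (by ext k; simp [h])

theorem lap_vdm (N : ℕ) : lap id (vdm N) = 0 := by
  rw [vdm, lap_alternant]
  refine Finset.sum_eq_zero fun j _ => ?_
  have hj := j.2
  by_cases h : addStair (0 : Fin N → ℕ) j < 2
  · rcases Nat.lt_succ_iff_lt_or_eq.mp h with h | h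
    · simp [Nat.lt_one_iff.mp h]
    · simp [h]
  · simp only [addStair, Pi.zero_apply] at h
    have hlt : (j : ℕ) + 2 < N := by omega
    rw [alternant_eq_zero X (i := j) (j := ⟨j + 2, hlt⟩), smul_zero]
    · intro hcon
      have := congrArg Fin.val hcon
      simp at this
    · rw [Function.update_self, Function.update_of_ne]
      · simp only [addStair, Pi.zero_apply]
        omega
      · intro hcon
        have := congrArg Fin.val hcon
        simp at this

theorem vdm_mul_resDiag_lap_trPow (k : ℕ) :
    vdm N * resDiag N (lap Prod.swap (trPow N k)) =
      vdm N * lap id (resDiag N (trPow N k)) + 2 * gam id (vdm N) (resDiag N (trPow N k)) := by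
  have hpd : ∀ i, pderiv i (∑ j, (X j : MvPolynomial (Fin N) ℂ) ^ k) =
      (k : MvPolynomial (Fin N) ℂ) * X i ^ (k - 1) := by
    intro i
    rw [map_sum, Finset.sum_eq_single i]
    · simp
    · intro b _ hb; simp [pderiv_X_of_ne hb]
    · simp
  cases k with
  | zero =>
    have h1 : (∑ j, (X j : MvPolynomial (Fin N) ℂ) ^ 0) = C (N : ℂ) := by simp
    have h2 : trPow N 0 = C (N : ℂ) := by simp [trPow]
    rw [resDiag_trPow, h1, gam_C_right, h2]
    simp [lap_apply]
  | succ n =>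
    have hlap : lap id (∑ j, (X j : MvPolynomial (Fin N) ℂ) ^ (n + 1)) =
        (n + 1) * ∑ i, (n : MvPolynomial (Fin N) ℂ) * X i ^ (n - 1) := by
      rw [lap_apply, Finset.mul_sum]
      refine Finset.sum_congr rfl fun i _ => ?_
      rw [id, hpd, pderiv_mul, ← map_natCast C, pderiv_C]
      simp
    have hgam : gam id (vdm N) (∑ j, (X j : MvPolynomial (Fin N) ℂ) ^ (n + 1)) =
        (n + 1) * ∑ i, pderiv i (vdm N) * X i ^ n := by
      rw [gam, Finset.mul_sum]
      refine Finset.sum_congr rfl fun i _ => ?_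
      rw [id, hpd]
      push_cast [Nat.add_sub_cancel]
      ring
    rw [resDiag_trPow, hlap, hgam, sum_pow_mul_pderiv_vdm, lap_trPow_succ]
    simp only [map_mul, map_add, map_sum, map_natCast, map_one, resDiag_trPow]
    have hswap : ∑ c ∈ Finset.range n, (∑ i, (X i : MvPolynomial (Fin N) ℂ) ^ c) *
        ∑ i, X i ^ (n - 1 - c) = ∑ i, ∑ j, ∑ c ∈ Finset.range n, X j ^ c * X i ^ (n - 1 - c) := by
      simp only [Finset.sum_mul_sum]
      rw [Finset.sum_comm]
      rw [Finset.sum_congr rfl fun i _ => Finset.sum_comm, Finset.sum_comm]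
    have hdiag : ∀ i, ∑ c ∈ Finset.range n, (X i : MvPolynomial (Fin N) ℂ) ^ c *
        X i ^ (n - 1 - c) = (n : MvPolynomial (Fin N) ℂ) * X i ^ (n - 1) := by
      intro i
      rw [Finset.sum_congr rfl (g := fun _ => (X i : MvPolynomial (Fin N) ℂ) ^ (n - 1))]
      · simp
      · intro c hc
        have := Finset.mem_range.mp hc
        rw [← pow_add]
        congr 1
        omega
    have hsymm : ∀ i j, ∑ c ∈ Finset.range n, (X i : MvPolynomial (Fin N) ℂ) ^ c *
        X j ^ (n - 1 - c) = ∑ c ∈ Finset.range n, X j ^ c * X i ^ (n - 1 - c) := by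
      intro i j
      rw [← Finset.sum_range_reflect]
      refine Finset.sum_congr rfl fun c hc => ?_
      have := Finset.mem_range.mp hc
      rw [mul_comm, show n - 1 - (n - 1 - c) = c by omega]
    rw [hswap, sum_sum_eq_diag_add]
    simp only [hdiag]
    have : ∀ i, ∑ j ∈ Finset.Ioi i, (∑ c ∈ Finset.range n, (X j : MvPolynomial (Fin N) ℂ) ^ c *
        X i ^ (n - 1 - c) + ∑ c ∈ Finset.range n, X i ^ c * X j ^ (n - 1 - c)) =
        2 * ∑ j ∈ Finset.Ioi i, ∑ c ∈ Finset.range n, (X j : MvPolynomial (Fin N) ℂ) ^ c *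
        X i ^ (n - 1 - c) := by
      intro i
      rw [Finset.mul_sum]
      refine Finset.sum_congr rfl fun j _ => ?_
      rw [hsymm i j]
      ring
    rw [Finset.sum_congr rfl fun i _ => this i, ← Finset.mul_sum _ _ (2 : MvPolynomial (Fin N) ℂ)]
    ring

theorem lap_mem_and_radial {f : MvPolynomial (Fin N × Fin N) ℂ} (hf : f ∈ invAlg N) :
    lap Prod.swap f ∈ invAlg N ∧ vdm N * resDiag N (lap Prod.swap f) =
      vdm N * lap id (resDiag N f) + 2 * gam id (vdm N) (resDiag N f) := by
  induction hf using Algebra.adjoin_induction with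
  | mem f hf =>
    obtain ⟨k, rfl⟩ := hf
    refine ⟨?_, vdm_mul_resDiag_lap_trPow k⟩
    cases k with
    | zero =>
      have h2 : trPow N 0 = C (N : ℂ) := by simp [trPow]
      rw [h2]
      simp [lap_apply]
    | succ n =>
      rw [lap_trPow_succ]
      exact mul_mem (add_mem (natCast_mem _ _) (one_mem _))
        (sum_mem fun c _ => mul_mem (trPow_mem _) (trPow_mem _))
  | algebraMap r =>
    rw [algebraMap_eq, algHom_C, algebraMap_eq, gam_C_right]
    simp [lap_apply]
  | add x y hx hy h1 h2 =>
    rw [map_add, map_add, mul_add, h1.2, h2.2, map_add, map_add, gam_add_right]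
    exact ⟨add_mem h1.1 h2.1, by ring⟩
  | mul x y hx hy h1 h2 =>
    obtain ⟨hg, hg'⟩ := gam_mem_and_resDiag_gam hx hy
    rw [lap_mul Prod.swap_swap]
    refine ⟨add_mem (add_mem (mul_mem hx h2.1) (mul_mem h1.1 hy))
      (mul_mem (natCast_mem _ 2) hg), ?_⟩
    have h2' : resDiag N 2 = 2 := map_ofNat _ 2
    rw [map_add, map_add, map_mul, map_mul, map_mul, map_mul, hg', gam_mul_right,
      lap_mul (fun _ => rfl), h2']
    linear_combination resDiag N x * h2.2 + resDiag N y * h1.2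

theorem lap_vdm_mul {f : MvPolynomial (Fin N × Fin N) ℂ} (hf : f ∈ invAlg N) :
    lap id (vdm N * resDiag N f) = vdm N * resDiag N (lap Prod.swap f) := by
  rw [(lap_mem_and_radial hf).2, lap_mul (fun _ => rfl), lap_vdm]
  ring

theorem adLap_iterate_radial {p : MvPolynomial (Fin N × Fin N) ℂ} (hp : p ∈ invAlg N) (k : ℕ) :
    ∀ f ∈ invAlg N, ((adLap Prod.swap)^[k] (LinearMap.mulLeft ℂ p)) f ∈ invAlg N ∧
      ((adLap id)^[k] (LinearMap.mulLeft ℂ (resDiag N p))) (vdm N * resDiag N f) =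
        vdm N * resDiag N (((adLap Prod.swap)^[k] (LinearMap.mulLeft ℂ p)) f) := by
  induction k with
  | zero =>
    intro f hf
    refine ⟨mul_mem hp hf, ?_⟩
    simp only [Function.iterate_zero, id, LinearMap.mulLeft_apply, map_mul]
    ring
  | succ k ih =>
    intro f hf
    rw [Function.iterate_succ_apply', Function.iterate_succ_apply']
    set T := (adLap Prod.swap)^[k] (LinearMap.mulLeft ℂ p)
    set T0 := (adLap id)^[k] (LinearMap.mulLeft ℂ (resDiag N p))
    have hl := (lap_mem_and_radial hf).1
    simp only [adLap, LinearMap.sub_apply, Module.End.mul_apply]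
    refine ⟨sub_mem (lap_mem_and_radial (ih f hf).1).1 (ih _ hl).1, ?_⟩
    rw [(ih f hf).2, lap_vdm_mul (ih f hf).1, lap_vdm_mul hf, (ih _ hl).2, map_sub, mul_sub]

theorem diffOp_radial {p f : MvPolynomial (Fin N × Fin N) ℂ} (hp : p ∈ invAlg N) {k : ℕ}
    (hk : p.IsHomogeneous k) (hk' : (resDiag N p).IsHomogeneous k) (hf : f ∈ invAlg N) :
    diffOp id (resDiag N p) (vdm N * resDiag N f) =
      vdm N * resDiag N (diffOp Prod.swap p f) := by
  have h := (adLap_iterate_radial hp k f hf).2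
  rw [adLap_iterate_of_isHomogeneous (fun _ => rfl) hk',
    adLap_iterate_of_isHomogeneous Prod.swap_swap hk, LinearMap.smul_apply, LinearMap.smul_apply,
    map_smul, mul_smul_comm] at h
  exact smul_right_injective _ (mul_ne_zero (pow_ne_zero _ two_ne_zero)
    (Nat.cast_ne_zero.mpr (Nat.factorial_ne_zero k)) : (2 ^ k * k.factorial : ℂ) ≠ 0) h

end RadialPart

section Orthogonality

open MvPolynomial

variable {N : ℕ}

/-- The Schur function of the generic matrix. -/
def schurPoly (N : ℕ) (l : Fin N → ℕ) : MvPolynomial (Fin N × Fin N) ℂ := jacobiTrudi (trPow N) l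

theorem isHomogeneous_genMat_pow (m : ℕ) (a b : Fin N) : ((genMat N ^ m) a b).IsHomogeneous m := by
  induction m generalizing b with
  | zero =>
    rw [pow_zero, Matrix.one_apply]
    split_ifs
    · exact isHomogeneous_one _ _
    · exact isHomogeneous_zero _ _ _
  | succ m ih =>
    rw [pow_succ, Matrix.mul_apply]
    exact IsHomogeneous.sum _ _ _ fun i _ => (ih i).mul (isHomogeneous_X _ _)

theorem isHomogeneous_trPow (m : ℕ) : (trPow N m).IsHomogeneous m :=
  IsHomogeneous.sum _ _ _ fun i _ => isHomogeneous_genMat_pow m i i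

theorem isHomogeneous_schurPoly (l : Fin N → ℕ) : (schurPoly N l).IsHomogeneous (∑ i, l i) :=
  isHomogeneous_jacobiTrudi isHomogeneous_trPow l

theorem schurPoly_mem (l : Fin N → ℕ) : schurPoly N l ∈ invAlg N :=
  jacobiTrudi_mem trPow_mem l

/-- Evaluation of a polynomial at the entries of a matrix. -/
def evalMat (A : Matrix (Fin N) (Fin N) ℂ) : MvPolynomial (Fin N × Fin N) ℂ →ₐ[ℂ] ℂ :=
  aeval fun s => A s.1 s.2

theorem evalMat_trPow (A : Matrix (Fin N) (Fin N) ℂ) (m : ℕ) :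
    evalMat A (trPow N m) = (A ^ m).trace := by
  have h : (evalMat A).mapMatrix (genMat N) = A := by
    ext1 i j
    simp [evalMat, Matrix.mvPolynomialX]
  have : evalMat A (trPow N m) = ((evalMat A).mapMatrix (genMat N ^ m)).trace := by
    simp [trPow, Matrix.trace]
  rw [this, map_pow, h]

theorem evalMat_schurPoly (A : Matrix (Fin N) (Fin N) ℂ) (l : Fin N → ℕ) :
    evalMat A (schurPoly N l) = schur l A := by
  rw [schurPoly, map_jacobiTrudi, schur_eq_jacobiTrudi]
  simp only [evalMat_trPow]

theorem resDiag_schurPoly (l : Fin N → ℕ) :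
    resDiag N (schurPoly N l) = jacobiTrudi (fun m => ∑ i, (X i) ^ m) l := by
  rw [schurPoly, map_jacobiTrudi]
  simp only [resDiag_trPow]

theorem isHomogeneous_resDiag_schurPoly (l : Fin N → ℕ) :
    (resDiag N (schurPoly N l)).IsHomogeneous (∑ i, l i) := by
  rw [resDiag_schurPoly]
  refine isHomogeneous_jacobiTrudi (fun m => IsHomogeneous.sum _ _ _ fun i _ => ?_) l
  simpa using (isHomogeneous_X ℂ i).pow m

theorem vdm_mul_resDiag_schurPoly (l : Fin N → ℕ) :
    vdm N * resDiag N (schurPoly N l) = alternant X (addStair l) := by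
  rw [resDiag_schurPoly, alternant_eq_jacobiTrudi_mul, mul_comm, vdm]

theorem addStair_strictAnti {l : Fin N → ℕ} (hl : Antitone l) : StrictAnti (addStair l) := by
  intro i j hij
  have h1 := hl hij.le
  have h2 : (i : ℕ) < j := hij
  have h3 := j.2
  simp only [addStair]
  omega

theorem addStair_injective : Function.Injective (addStair : (Fin N → ℕ) → Fin N → ℕ) := by
  intro l m h
  funext i
  have := congrFun h i
  simpa [addStair] using this

theorem comp_perm_eq_iff {l m : Fin N → ℕ} (hl : StrictAnti l) (hm : StrictAnti m)
    (σ τ : Equiv.Perm (Fin N)) : (l ∘ σ = m ∘ τ) ↔ l = m ∧ σ = τ := by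
  refine ⟨fun h => ?_, fun h => by rw [h.1, h.2]⟩
  have hr : Set.range l = Set.range m := by
    have := congrArg Set.range h
    rwa [σ.surjective.range_comp, τ.surjective.range_comp] at this
  have hlm : l = m := by
    have hl' : StrictMono (OrderDual.toDual ∘ l) := fun i j hij => hl hij
    have hm' : StrictMono (OrderDual.toDual ∘ m) := fun i j hij => hm hij
    have := (StrictMono.range_inj hl' hm').mp (by rw [Set.range_comp, Set.range_comp, hr])
    funext i
    exact congrFun this i
  refine ⟨hlm, Equiv.ext fun i => ?_⟩
  subst hlm
  exact hl.injective (congrFun h i)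

theorem coeff_alternant {l m : Fin N → ℕ} (hl : StrictAnti l) (hm : StrictAnti m)
    (σ : Equiv.Perm (Fin N)) :
    coeff (Finsupp.equivFunOnFinite.symm (l ∘ σ)) (alternant (X : Fin N → MvPolynomial (Fin N) ℂ) m)
      = if l = m then ((Equiv.Perm.sign σ : ℤ) : ℂ) else 0 := by
  have : ∀ τ : Equiv.Perm (Fin N), coeff (Finsupp.equivFunOnFinite.symm (l ∘ σ))
      (Equiv.Perm.sign τ • ∏ i, (X i : MvPolynomial (Fin N) ℂ) ^ m (τ i)) =
        if l = m ∧ σ = τ then ((Equiv.Perm.sign τ : ℤ) : ℂ) else 0 := by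
    intro τ
    rw [prod_X_pow_eq_monomial' (fun i => m (τ i)), Units.smul_def, ← Int.cast_smul_eq_zsmul ℂ,
      coeff_smul, coeff_monomial]
    have h : (Finsupp.equivFunOnFinite.symm (fun i => m (τ i)) =
        Finsupp.equivFunOnFinite.symm (l ∘ σ)) ↔ (l = m ∧ σ = τ) := by
      rw [Equiv.apply_eq_iff_eq, ← comp_perm_eq_iff hl hm]
      exact ⟨fun h => h.symm, fun h => h.symm⟩
    simp only [h]
    split_ifs <;> simp
  rw [alternant_X_eq_sum, coeff_sum, Finset.sum_congr rfl fun τ _ => this τ]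
  by_cases h : l = m <;> simp [h]

theorem constantCoeff_diffOp_alternant {l m : Fin N → ℕ} (hl : StrictAnti l) (hm : StrictAnti m) :
    constantCoeff (diffOp id (alternant (X : Fin N → MvPolynomial (Fin N) ℂ) l) (alternant X m)) =
      if l = m then (N.factorial : ℂ) * ∏ i, ((l i).factorial : ℂ) else 0 := by
  have hσ : ∀ σ : Equiv.Perm (Fin N), constantCoeff (diffOp id
      (Equiv.Perm.sign σ • ∏ i, (X i : MvPolynomial (Fin N) ℂ) ^ l (σ i)) (alternant X m)) =
        if l = m then ∏ i, ((l i).factorial : ℂ) else 0 := by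
    intro σ
    rw [Units.smul_def, map_zsmul, LinearMap.smul_apply, map_zsmul,
      prod_X_pow_eq_monomial' (fun i => l (σ i)), constantCoeff_diffOp_monomial,
      Finsupp.prod_fintype _ _ (by simp)]
    have := coeff_alternant hl hm σ
    simp only [Function.comp_def] at this
    rw [this]
    simp only [Finsupp.equivFunOnFinite_symm_apply_apply]
    rw [Equiv.prod_comp σ fun i => ((l i).factorial : ℂ)]
    split_ifs
    · rcases Int.units_eq_one_or (Equiv.Perm.sign σ) with h | h <;> simp [h]
    · simp
  rw [alternant_X_eq_sum l, map_sum, LinearMap.sum_apply, map_sum,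
    Finset.sum_congr rfl fun σ _ => hσ σ]
  simp [Fintype.card_perm]

theorem poch_mul_prod_factorial (l : Fin N → ℕ) :
    poch N l * ∏ i, ((addStair (0 : Fin N → ℕ) i).factorial : ℂ) =
      ∏ i, ((addStair l i).factorial : ℂ) := by
  rw [poch, ← Finset.prod_mul_distrib]
  refine Finset.prod_congr rfl fun i _ => ?_
  simp only [addStair, Pi.zero_apply, zero_add]
  generalize l i = k
  have hi := i.2
  induction k with
  | zero => simp
  | succ k ih =>
    rw [Finset.prod_range_succ, mul_right_comm, ih,
      show k + 1 + (N - 1 - i) = (k + (N - 1 - i)) + 1 by omega, Nat.factorial_succ, mul_comm]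
    push_cast
    congr 1
    have : (N : ℂ) = ((N - 1 - i : ℕ) : ℂ) + 1 + i := by
      norm_cast
      omega
    rw [this]
    ring

theorem prod_factorial_le_norm_poch (l : Fin N → ℕ) :
    ∏ i, ((l i).factorial : ℝ) ≤ ‖poch N l‖ := by
  have h := congrArg norm (poch_mul_prod_factorial l)
  simp only [norm_mul, norm_prod, Complex.norm_natCast] at h
  have hpos : 0 < ∏ i, ((addStair (0 : Fin N → ℕ) i).factorial : ℝ) :=
    Finset.prod_pos fun i _ => by positivity
  refine le_of_mul_le_mul_right ?_ hpos
  rw [h, ← Finset.prod_mul_distrib]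
  refine Finset.prod_le_prod (fun i _ => by positivity) fun i _ => ?_
  norm_cast
  refine Nat.le_of_dvd (Nat.factorial_pos _) ?_
  simpa [addStair] using Nat.factorial_mul_factorial_dvd_factorial_add (l i) (N - 1 - i)

theorem poch_ne_zero (l : Fin N → ℕ) : poch N l ≠ 0 := by
  have : 0 < ∏ i, ((l i).factorial : ℝ) := Finset.prod_pos fun i _ => by positivity
  exact norm_pos_iff.mp (this.trans_le (prod_factorial_le_norm_poch l))

/-- Schur functions are orthogonal for the differentiation pairing. -/
theorem constantCoeff_diffOp_schurPoly {l m : Fin N → ℕ} (hl : Antitone l) (hm : Antitone m)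
    (hlm : ∑ i, l i = ∑ i, m i) :
    constantCoeff (diffOp Prod.swap (schurPoly N m) (schurPoly N l)) =
      if m = l then poch N l else 0 := by
  have hC := eq_C_of_isHomogeneous_zero (p := diffOp Prod.swap (schurPoly N m) (schurPoly N l)) (by
    simpa [hlm] using
      isHomogeneous_diffOp Prod.swap (isHomogeneous_schurPoly m) (isHomogeneous_schurPoly l))
  set c := constantCoeff (diffOp Prod.swap (schurPoly N m) (schurPoly N l))
  have hr := diffOp_radial (schurPoly_mem m) (isHomogeneous_schurPoly m)
    (isHomogeneous_resDiag_schurPoly m) (schurPoly_mem l)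
  rw [vdm_mul_resDiag_schurPoly, hC, algHom_C, algebraMap_eq] at hr
  have h := congrArg (fun p => constantCoeff (diffOp id (vdm N) p)) hr
  simp only [← diffOp_mul_apply] at h
  rw [vdm_mul_resDiag_schurPoly, mul_comm (vdm N) (C c), ← smul_eq_C_mul, map_smul,
    constantCoeff_smul, vdm,
    constantCoeff_diffOp_alternant (addStair_strictAnti hm) (addStair_strictAnti hl),
    constantCoeff_diffOp_alternant (addStair_strictAnti fun _ _ _ => le_rfl)
      (addStair_strictAnti fun _ _ _ => le_rfl), if_pos rfl] at h
  simp only [addStair_injective.eq_iff] at h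
  have hN : (N.factorial : ℂ) ≠ 0 := Nat.cast_ne_zero.mpr (Nat.factorial_ne_zero N)
  have hP : ∏ i, ((addStair (0 : Fin N → ℕ) i).factorial : ℂ) ≠ 0 :=
    Finset.prod_ne_zero_iff.mpr fun i _ => Nat.cast_ne_zero.mpr (Nat.factorial_ne_zero _)
  refine mul_right_cancel₀ (mul_ne_zero hN hP) ?_
  rw [← smul_eq_mul, ← h]
  split_ifs with hml
  · rw [hml, ← poch_mul_prod_factorial]
    ring
  · simp

end Orthogonality

section Averaging

open MvPolynomial

variable {N : ℕ}

instance (N : ℕ) : BorelSpace (UN N) := ⟨rfl⟩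

instance (N : ℕ) : CompactSpace (UN N) := by
  have hK : IsCompact (Set.univ.pi fun _ : Fin N => Set.univ.pi fun _ : Fin N =>
      Metric.closedBall (0 : ℂ) 1) :=
    isCompact_univ_pi fun _ => isCompact_univ_pi fun _ => isCompact_closedBall _ _
  have hc : IsClosed (UN N : Set (Matrix (Fin N) (Fin N) ℂ)) :=
    isClosed_unitary (R := Matrix (Fin N) (Fin N) ℂ)
  refine (isCompact_iff_compactSpace (s := (UN N : Set (Matrix (Fin N) (Fin N) ℂ)))).mp
    (hK.of_isClosed_subset hc fun U hU i _ j _ => ?_)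
  rw [mem_closedBall_zero_iff]
  exact entry_norm_bound_of_unitary hU i j

/-- The conjugate `X A X†` of a matrix by a unitary matrix. -/
def conjMat (A : Matrix (Fin N) (Fin N) ℂ) (X : UN N) : Matrix (Fin N) (Fin N) ℂ :=
  (X : Matrix (Fin N) (Fin N) ℂ) * A * star (X : Matrix (Fin N) (Fin N) ℂ)

theorem continuous_conjMat (A : Matrix (Fin N) (Fin N) ℂ) : Continuous (conjMat A) :=
  (continuous_subtype_val.mul continuous_const).mul continuous_subtype_val.star

theorem continuous_conjMat_apply (A : Matrix (Fin N) (Fin N) ℂ) (s : Fin N × Fin N) :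
    Continuous fun X => conjMat A X s.1 s.2 :=
  (continuous_conjMat A).matrix_elem _ _

theorem star_mul_self_unitary (X : UN N) :
    star (X : Matrix (Fin N) (Fin N) ℂ) * (X : Matrix (Fin N) (Fin N) ℂ) = 1 :=
  Matrix.mem_unitaryGroup_iff'.mp X.2

theorem conjMat_pow (A : Matrix (Fin N) (Fin N) ℂ) (X : UN N) (m : ℕ) :
    conjMat A X ^ m = conjMat (A ^ m) X := by
  have h := star_mul_self_unitary X
  induction m with
  | zero => simp [conjMat, Matrix.mem_unitaryGroup_iff.mp X.2]
  | succ m ih =>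
    rw [pow_succ, ih, pow_succ]
    simp only [conjMat, Matrix.mul_assoc]
    rw [← Matrix.mul_assoc (star (X : Matrix (Fin N) (Fin N) ℂ)) (X : Matrix (Fin N) (Fin N) ℂ), h,
      Matrix.one_mul]

theorem trace_conjMat (A : Matrix (Fin N) (Fin N) ℂ) (X : UN N) :
    (conjMat A X).trace = A.trace := by
  rw [conjMat, Matrix.trace_mul_comm, ← Matrix.mul_assoc, star_mul_self_unitary, Matrix.one_mul]

theorem evalMat_conjMat {q : MvPolynomial (Fin N × Fin N) ℂ} (hq : q ∈ invAlg N)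
    (A : Matrix (Fin N) (Fin N) ℂ) (X : UN N) : evalMat (conjMat A X) q = evalMat A q := by
  induction hq using Algebra.adjoin_induction with
  | mem f hf =>
    obtain ⟨m, rfl⟩ := hf
    rw [evalMat_trPow, evalMat_trPow, conjMat_pow, trace_conjMat]
  | algebraMap r => rw [AlgHom.commutes, AlgHom.commutes]
  | add x y _ _ h1 h2 => rw [map_add, map_add, h1, h2]
  | mul x y _ _ h1 h2 => rw [map_mul, map_mul, h1, h2]

/-- The linear form `Z ↦ Tr(M Z)`. -/
def trForm (M : Matrix (Fin N) (Fin N) ℂ) : MvPolynomial (Fin N × Fin N) ℂ :=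
  ∑ s : Fin N × Fin N, C (M s.1 s.2) * X s.swap

theorem evalMat_trForm (M B : Matrix (Fin N) (Fin N) ℂ) :
    evalMat B (trForm M) = (M * B).trace := by
  simp [trForm, evalMat, Matrix.trace, Matrix.mul_apply, Fintype.sum_prod_type]

theorem pderiv_trForm (M : Matrix (Fin N) (Fin N) ℂ) (s : Fin N × Fin N) :
    pderiv s.swap (trForm M) = C (M s.1 s.2) := by
  rw [trForm, map_sum, Finset.sum_eq_single s]
  · simp
  · intro t _ ht
    have : t.swap ≠ s.swap := fun h => ht (Prod.swap_injective h)
    simp [pderiv_X_of_ne this]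
  · simp

theorem diffOp_monomial_trForm_pow (M : Matrix (Fin N) (Fin N) ℂ) (n : ℕ) :
    ∀ d : Fin N × Fin N →₀ ℕ, d.degree = n →
      diffOp Prod.swap (monomial d 1) (trForm M ^ n) =
        C ((n.factorial : ℂ) * evalMat M (monomial d 1)) := by
  induction n with
  | zero =>
    intro d hd
    rw [Finsupp.degree_eq_zero_iff] at hd
    subst hd
    have h1 : (monomial 0 1 : MvPolynomial (Fin N × Fin N) ℂ) = 1 := rfl
    rw [h1, map_one, map_one]
    simp
  | succ n ih =>
    intro d hd
    have hd0 : d ≠ 0 := by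
      rintro rfl
      simp at hd
    obtain ⟨s, hs⟩ := Finsupp.support_nonempty_iff.mpr hd0
    have hs' : Finsupp.single s 1 ≤ d := by
      rw [Finsupp.single_le_iff]
      exact Nat.one_le_iff_ne_zero.mpr (Finsupp.mem_support_iff.mp hs)
    obtain ⟨e, rfl⟩ := exists_add_of_le hs'
    have he : e.degree = n := by
      rw [map_add, Finsupp.degree_single] at hd
      omega
    have hm : (monomial (Finsupp.single s 1 + e) 1 : MvPolynomial (Fin N × Fin N) ℂ) =
        monomial e 1 * X s := by
      rw [X, monomial_mul, add_comm, one_mul]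
    rw [hm, diffOp_mul_apply, diffOp_X, pd_apply, pderiv_pow, pderiv_trForm,
      Nat.add_sub_cancel, ← map_natCast C, mul_right_comm, ← C_mul, ← smul_eq_C_mul, map_smul,
      ih e he, smul_eq_C_mul, ← C_mul, Nat.factorial_succ]
    congr 1
    simp only [evalMat, map_mul, aeval_X]
    push_cast
    ring

theorem diffOp_trForm_pow (M : Matrix (Fin N) (Fin N) ℂ) {n : ℕ}
    {q : MvPolynomial (Fin N × Fin N) ℂ} (hq : q.IsHomogeneous n) :
    diffOp Prod.swap q (trForm M ^ n) = C ((n.factorial : ℂ) * evalMat M q) := by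
  rw [q.as_sum, map_sum, LinearMap.sum_apply, map_sum, Finset.mul_sum, map_sum]
  refine Finset.sum_congr rfl fun d hd => ?_
  have hdeg : d.degree = n := by
    by_contra h
    exact mem_support_iff.mp hd (hq.coeff_eq_zero h)
  have hm : (monomial d (coeff d q) : MvPolynomial (Fin N × Fin N) ℂ) =
      coeff d q • monomial d 1 := by rw [smul_monomial, smul_eq_mul, mul_one]
  rw [hm, map_smul, map_smul, LinearMap.smul_apply, diffOp_monomial_trForm_pow M n d hdeg,
    smul_eq_C_mul, ← C_mul, smul_eq_mul, mul_left_comm]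

/-- The polynomial `B ↦ ∫ Tr(X A X† B)^n`. -/
def avgPoly (μ : Measure (UN N)) (A : Matrix (Fin N) (Fin N) ℂ) (n : ℕ) :
    MvPolynomial (Fin N × Fin N) ℂ :=
  ∑ f : Fin n → Fin N × Fin N,
    C (∫ X, ∏ k, conjMat A X (f k).1 (f k).2 ∂μ) * ∏ k, X (f k).swap

theorem isHomogeneous_avgPoly (μ : Measure (UN N)) (A : Matrix (Fin N) (Fin N) ℂ) (n : ℕ) :
    (avgPoly μ A n).IsHomogeneous n := by
  refine IsHomogeneous.sum _ _ _ fun f _ => ?_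
  have h := (isHomogeneous_C (Fin N × Fin N)
    (∫ X, ∏ k, conjMat A X (f k).1 (f k).2 ∂μ)).mul (IsHomogeneous.prod Finset.univ
      (fun k => X (f k).swap) (fun _ => 1) fun k _ => isHomogeneous_X ℂ (f k).swap)
  simpa using h

theorem integrable_of_continuous (μ : Measure (UN N)) [IsFiniteMeasure μ] {f : UN N → ℂ}
    (hf : Continuous f) : Integrable f μ :=
  hf.integrable_of_hasCompactSupport (HasCompactSupport.of_compactSpace f)

theorem map_avgPoly (μ : Measure (UN N)) [IsFiniteMeasure μ] (A : Matrix (Fin N) (Fin N) ℂ) (n : ℕ)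
    (L : MvPolynomial (Fin N × Fin N) ℂ →ₗ[ℂ] ℂ) :
    L (avgPoly μ A n) = ∫ X, L (trForm (conjMat A X) ^ n) ∂μ := by
  have h : ∀ X, L (trForm (conjMat A X) ^ n) = ∑ f : Fin n → Fin N × Fin N,
      (∏ k, conjMat A X (f k).1 (f k).2) * L (∏ k, MvPolynomial.X (f k).swap) := by
    intro X
    rw [trForm, Fintype.sum_pow, map_sum]
    refine Finset.sum_congr rfl fun f _ => ?_
    rw [Finset.prod_mul_distrib, ← map_prod, ← smul_eq_C_mul, map_smul, smul_eq_mul]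
  simp only [h]
  rw [integral_finsetSum]
  · rw [avgPoly, map_sum]
    refine Finset.sum_congr rfl fun f _ => ?_
    rw [integral_mul_const, ← smul_eq_C_mul, map_smul, smul_eq_mul]
  · intro f _
    refine (integrable_of_continuous μ ?_).mul_const _
    exact continuous_finsetProd _ fun k _ => continuous_conjMat_apply A (f k)

theorem evalMat_avgPoly (μ : Measure (UN N)) [IsFiniteMeasure μ] (A B : Matrix (Fin N) (Fin N) ℂ)
    (n : ℕ) : evalMat B (avgPoly μ A n) = ∫ X, (conjMat A X * B).trace ^ n ∂μ := by
  have := map_avgPoly μ A n (evalMat B).toLinearMap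
  simpa only [AlgHom.toLinearMap_apply, map_pow, evalMat_trForm] using this

theorem evalMat_conjMat_avgPoly (μ : Measure (UN N)) [IsFiniteMeasure μ] [μ.IsMulLeftInvariant]
    (A B : Matrix (Fin N) (Fin N) ℂ) (n : ℕ) (U : UN N) :
    evalMat (conjMat B U) (avgPoly μ A n) = evalMat B (avgPoly μ A n) := by
  rw [evalMat_avgPoly, evalMat_avgPoly,
    ← integral_mul_left_eq_self (fun X => (conjMat A X * B).trace ^ n) U⁻¹]
  refine integral_congr_ae (ae_of_all _ fun X => ?_)
  dsimp only
  congr 1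
  have hU : ((U⁻¹ : UN N) : Matrix (Fin N) (Fin N) ℂ) = star (U : Matrix (Fin N) (Fin N) ℂ) := rfl
  simp only [conjMat, Submonoid.coe_mul, hU, star_mul, star_star]
  simp only [← Matrix.mul_assoc]
  rw [Matrix.trace_mul_comm]
  simp only [Matrix.mul_assoc]

theorem constantCoeff_diffOp_avgPoly (μ : Measure (UN N)) [IsProbabilityMeasure μ]
    (A : Matrix (Fin N) (Fin N) ℂ) {n : ℕ} {q : MvPolynomial (Fin N × Fin N) ℂ}
    (hq : q ∈ invAlg N) (hn : q.IsHomogeneous n) :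
    constantCoeff (diffOp Prod.swap q (avgPoly μ A n)) = n.factorial * evalMat A q := by
  have := map_avgPoly μ A n ((aeval (0 : Fin N × Fin N → ℂ)).toLinearMap.comp (diffOp Prod.swap q))
  have h0 : ∀ p : MvPolynomial (Fin N × Fin N) ℂ,
      aeval (0 : Fin N × Fin N → ℂ) p = constantCoeff p := fun p => by
    rw [aeval_zero, Algebra.algebraMap_self, RingHom.id_apply]
  simp only [LinearMap.comp_apply, AlgHom.toLinearMap_apply, h0, diffOp_trForm_pow _ hn,
    constantCoeff_C, evalMat_conjMat hq] at this
  rw [this]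
  simp

end Averaging

section SymmetricExpansion

open MvPolynomial

variable {N : ℕ}

theorem alternant_comp_perm {R : Type*} [CommRing R] (x : Fin N → R) (d : Fin N → ℕ)
    (σ : Equiv.Perm (Fin N)) :
    alternant x (d ∘ σ) = Equiv.Perm.sign σ * alternant x d :=
  Matrix.det_permute σ (Matrix.of fun i k => x k ^ d i)

theorem alternant_perm_comp {R : Type*} [CommRing R] (x : Fin N → R) (d : Fin N → ℕ)
    (σ : Equiv.Perm (Fin N)) :
    alternant (x ∘ σ) d = Equiv.Perm.sign σ * alternant x d :=
  Matrix.det_permute' σ (Matrix.of fun i k => x k ^ d i)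

theorem isHomogeneous_alternant (d : Fin N → ℕ) :
    (alternant (X : Fin N → MvPolynomial (Fin N) ℂ) d).IsHomogeneous (∑ i, d i) := by
  rw [alternant_X_eq_sum]
  refine IsHomogeneous.sum _ _ _ fun σ _ => ?_
  have h : (∏ i, (X i : MvPolynomial (Fin N) ℂ) ^ d (σ i)).IsHomogeneous (∑ i, d i) := by
    rw [← Equiv.sum_comp σ d]
    exact IsHomogeneous.prod _ _ _ fun i _ => isHomogeneous_X_pow i _
  rcases Int.units_eq_one_or (Equiv.Perm.sign σ) with hs | hs
  · rwa [hs, one_smul]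
  · rw [hs, Units.neg_smul, one_smul]
    exact h.neg

theorem vdm_ne_zero (N : ℕ) : vdm N ≠ 0 := by
  intro h
  have hs : StrictAnti (addStair (0 : Fin N → ℕ)) := addStair_strictAnti fun _ _ _ => le_rfl
  have := coeff_alternant hs hs 1
  rw [← vdm, h] at this
  simp at this

/-- The partitions of `n` with at most `N` parts. -/
def partsOf (N n : ℕ) : Finset (Fin N → ℕ) := (Finset.univ.piAntidiag n).filter Antitone

theorem mem_partsOf {n : ℕ} {l : Fin N → ℕ} : l ∈ partsOf N n ↔ ∑ i, l i = n ∧ Antitone l := by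
  simp [partsOf]

theorem strictAnti_add_le {e : Fin N → ℕ} (he : StrictAnti e) (k : ℕ) (i j : Fin N)
    (h : (j : ℕ) = i + k) : e j + k ≤ e i := by
  induction k generalizing j with
  | zero =>
    have : j = i := Fin.ext h
    rw [this, add_zero]
  | succ k ih =>
    have hj := j.2
    have h1 := ih ⟨i + k, by omega⟩ rfl
    have h2 : e j < e ⟨i + k, by omega⟩ := he (by rw [Fin.lt_def]; simp only; omega)
    omega

theorem exists_antitone_addStair {e : Fin N → ℕ} (he : StrictAnti e) :
    ∃ l : Fin N → ℕ, Antitone l ∧ addStair l = e := by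
  have h1 : ∀ i : Fin N, N - 1 - i ≤ e i := by
    intro i
    have hi := i.2
    have := strictAnti_add_le he (N - 1 - i) i ⟨N - 1, by omega⟩ (by simp only; omega)
    omega
  refine ⟨fun i => e i - (N - 1 - i), fun i j hij => ?_, funext fun i => ?_⟩
  · have hij' : (i : ℕ) ≤ j := hij
    have hj := j.2
    have := strictAnti_add_le he (j - i) i j (by omega)
    have := h1 j
    simp only
    omega
  · have := h1 i
    simp only [addStair]
    omega

theorem alternant_mem_span {n : ℕ} {d : Fin N → ℕ}
    (hd : ∑ i, d i = ∑ i, addStair (0 : Fin N → ℕ) i + n) :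
    alternant (X : Fin N → MvPolynomial (Fin N) ℂ) d ∈
      Submodule.span ℂ
        ((fun l => alternant X (addStair l)) '' (partsOf N n : Set (Fin N → ℕ))) := by
  by_cases hinj : Function.Injective d
  · set σ : Equiv.Perm (Fin N) := Fin.revPerm.trans (Tuple.sort d)
    have hmono : StrictMono (d ∘ Tuple.sort d) :=
      (Tuple.monotone_sort d).strictMono_of_injective (hinj.comp (Tuple.sort d).injective)
    have hanti : StrictAnti (d ∘ σ) := fun i j hij => hmono (Fin.rev_lt_rev.mpr hij)
    obtain ⟨l, hl, hle⟩ := exists_antitone_addStair hanti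
    have hsum : ∑ i, addStair l i = ∑ i, d i := by
      rw [hle]
      exact Equiv.sum_comp σ d
    have hmem : l ∈ partsOf N n := by
      refine mem_partsOf.mpr ⟨?_, hl⟩
      rw [hd] at hsum
      simp only [addStair, Finset.sum_add_distrib, Pi.zero_apply, zero_add] at hsum
      omega
    have hspan := Submodule.subset_span (R := ℂ) (Set.mem_image_of_mem
      (fun l => alternant (X : Fin N → MvPolynomial (Fin N) ℂ) (addStair l))
      (Finset.mem_coe.mpr hmem))
    rw [hle, alternant_comp_perm] at hspan
    rcases Int.units_eq_one_or (Equiv.Perm.sign σ) with hs | hs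
    · rw [hs] at hspan
      simpa using hspan
    · rw [hs] at hspan
      simpa using hspan
  · simp only [Function.Injective, not_forall] at hinj
    obtain ⟨i, j, h, hij⟩ := hinj
    rw [alternant_eq_zero X hij h]
    exact zero_mem _

theorem sum_sign_smul_rename_mem {n : ℕ} {h : MvPolynomial (Fin N) ℂ}
    (hh : h.IsHomogeneous (∑ i, addStair (0 : Fin N → ℕ) i + n)) :
    ∑ σ : Equiv.Perm (Fin N), Equiv.Perm.sign σ • rename σ h ∈
      Submodule.span ℂ
        ((fun l => alternant X (addStair l)) '' (partsOf N n : Set (Fin N → ℕ))) := by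
  have h1 : ∀ d : Fin N →₀ ℕ, ∑ σ : Equiv.Perm (Fin N), Equiv.Perm.sign σ •
      rename σ (monomial d (1 : ℂ)) = alternant X d := by
    intro d
    rw [alternant_X_eq_sum, ← Equiv.sum_comp (Equiv.inv (Equiv.Perm (Fin N)))]
    refine Finset.sum_congr rfl fun σ _ => ?_
    rw [Equiv.inv_apply, Equiv.Perm.sign_inv]
    congr 1
    have : (monomial d 1 : MvPolynomial (Fin N) ℂ) = ∏ i, X i ^ d i := by
      rw [prod_X_pow_eq_monomial']
      simp
    rw [this, map_prod, ← Equiv.prod_comp σ]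
    simp
  have h2 : ∑ σ : Equiv.Perm (Fin N), Equiv.Perm.sign σ • rename σ h =
      ∑ d ∈ h.support, coeff d h • alternant X d := by
    simp only [← h1, Finset.smul_sum]
    rw [Finset.sum_comm]
    refine Finset.sum_congr rfl fun σ _ => ?_
    conv_lhs => rw [h.as_sum, map_sum, Finset.smul_sum]
    refine Finset.sum_congr rfl fun d _ => ?_
    have hm : (monomial d (coeff d h) : MvPolynomial (Fin N) ℂ) = coeff d h • monomial d 1 := by
      rw [smul_monomial, smul_eq_mul, mul_one]
    rw [hm, map_smul, smul_comm]
  rw [h2]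
  refine sum_mem fun d hd => Submodule.smul_mem _ _ (alternant_mem_span ?_)
  rw [← Finsupp.degree_eq_sum]
  by_contra hne
  exact mem_support_iff.mp hd (hh.coeff_eq_zero hne)

/-- A symmetric polynomial is a combination of Schur polynomials. -/
theorem exists_resDiag_eq_of_isSymmetric {n : ℕ} {g : MvPolynomial (Fin N) ℂ}
    (hg : g.IsHomogeneous n) (hsymm : g.IsSymmetric) :
    ∃ w ∈ Submodule.span ℂ (schurPoly N '' (partsOf N n : Set (Fin N → ℕ))), resDiag N w = g := by
  have hsg : ∀ σ : Equiv.Perm (Fin N),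
      Equiv.Perm.sign σ • rename σ (vdm N * g) = vdm N * g := by
    intro σ
    have h1 : rename σ (vdm N) = Equiv.Perm.sign σ * vdm N := by
      rw [vdm, ← alternant_perm_comp]
      have := RingHom.map_det (rename σ : MvPolynomial (Fin N) ℂ →ₐ[ℂ] _).toRingHom
        (Matrix.of fun i k : Fin N => (X k : MvPolynomial (Fin N) ℂ) ^ addStair 0 i)
      refine this.trans (congrArg Matrix.det ?_)
      ext1 i k
      simp
    rw [map_mul, hsymm σ, h1]
    rcases Int.units_eq_one_or (Equiv.Perm.sign σ) with hs | hs <;> simp [hs]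
  have hmem := sum_sign_smul_rename_mem (n := n) (h := vdm N * g)
    ((isHomogeneous_alternant _).mul hg)
  rw [Finset.sum_congr rfl fun σ _ => hsg σ, Finset.sum_const, ← Nat.cast_smul_eq_nsmul ℂ] at hmem
  have hN : ((Finset.univ : Finset (Equiv.Perm (Fin N))).card : ℂ) ≠ 0 := by
    rw [Nat.cast_ne_zero, Finset.card_univ, Fintype.card_perm]
    exact Nat.factorial_ne_zero _
  rw [Submodule.smul_mem_iff _ hN] at hmem
  have himg : (fun l => alternant (X : Fin N → MvPolynomial (Fin N) ℂ) (addStair l)) =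
      ((LinearMap.mulLeft ℂ (vdm N)).comp (resDiag N).toLinearMap) ∘ schurPoly N := by
    funext l
    exact (vdm_mul_resDiag_schurPoly l).symm
  rw [himg, Set.image_comp, ← Submodule.map_span] at hmem
  obtain ⟨w, hw, hw'⟩ := hmem
  exact ⟨w, hw, mul_left_cancel₀ (vdm_ne_zero N) hw'⟩

end SymmetricExpansion

section SchurExpansion

open MvPolynomial

variable {N : ℕ}

theorem eval_resDiag (x : Fin N → ℂ) (p : MvPolynomial (Fin N × Fin N) ℂ) :
    aeval x (resDiag N p) = evalMat (Matrix.diagonal x) p := by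
  rw [← AlgHom.comp_apply]
  congr 1
  refine algHom_ext fun s => ?_
  by_cases h : s.1 = s.2 <;> simp [resDiag, evalMat, h]

theorem isHomogeneous_resDiag {n : ℕ} {p : MvPolynomial (Fin N × Fin N) ℂ}
    (hp : p.IsHomogeneous n) : (resDiag N p).IsHomogeneous n := by
  have := hp.aeval (fun s : Fin N × Fin N => if s.1 = s.2 then (X s.1 : MvPolynomial (Fin N) ℂ)
    else 0) (n := 1) fun s => by
      split_ifs
      · exact isHomogeneous_X _ _
      · exact isHomogeneous_zero _ _ _
  rwa [one_mul] at this

/-- The permutation matrix of `σ` as a unitary matrix. -/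
def permUnitary (σ : Equiv.Perm (Fin N)) : UN N :=
  ⟨(1 : Matrix (Fin N) (Fin N) ℂ).submatrix σ id, by
    rw [Matrix.mem_unitaryGroup_iff, Matrix.star_eq_conjTranspose, Matrix.conjTranspose_submatrix,
      Matrix.conjTranspose_one]
    have := Matrix.submatrix_mul_equiv (1 : Matrix (Fin N) (Fin N) ℂ) 1 σ (Equiv.refl _) σ
    simpa using this⟩

theorem conjMat_permUnitary (M : Matrix (Fin N) (Fin N) ℂ) (σ : Equiv.Perm (Fin N)) :
    conjMat M (permUnitary σ) = M.submatrix σ σ := by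
  have h1 := Matrix.submatrix_mul_equiv (1 : Matrix (Fin N) (Fin N) ℂ) M σ (Equiv.refl _) id
  have h2 := Matrix.submatrix_mul_equiv M (1 : Matrix (Fin N) (Fin N) ℂ) σ (Equiv.refl _) σ
  simp only [Equiv.coe_refl, Matrix.submatrix_id_id, one_mul, mul_one] at h1 h2
  rw [conjMat, Matrix.star_eq_conjTranspose, permUnitary, Matrix.conjTranspose_submatrix,
    Matrix.conjTranspose_one, h1, h2]

/-- Invariance of a polynomial function under unitary conjugation. -/
def IsConjInvariant (p : MvPolynomial (Fin N × Fin N) ℂ) : Prop :=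
  ∀ (B : Matrix (Fin N) (Fin N) ℂ) (U : UN N), evalMat (conjMat B U) p = evalMat B p

theorem IsConjInvariant.isSymmetric_resDiag {p : MvPolynomial (Fin N × Fin N) ℂ}
    (hp : IsConjInvariant p) : (resDiag N p).IsSymmetric := by
  intro σ
  refine MvPolynomial.funext fun x => ?_
  rw [eval_rename, ← coe_aeval_eq_eval, ← coe_aeval_eq_eval]
  simp only [RingHom.coe_coe]
  rw [eval_resDiag, eval_resDiag, ← hp (Matrix.diagonal x) (permUnitary σ), conjMat_permUnitary,
    Matrix.submatrix_diagonal_equiv]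

theorem eq_zero_of_evalMat_isHermitian {p : MvPolynomial (Fin N × Fin N) ℂ}
    (hp : ∀ H : Matrix (Fin N) (Fin N) ℂ, H.IsHermitian → evalMat H p = 0) : p = 0 := by
  refine MvPolynomial.funext fun x => ?_
  set M : Matrix (Fin N) (Fin N) ℂ := Matrix.of fun i j => x (i, j)
  set H : Matrix (Fin N) (Fin N) ℂ := (1 / 2 : ℂ) • (M + Mᴴ)
  set K : Matrix (Fin N) (Fin N) ℂ := (-Complex.I / 2) • (M - Mᴴ)
  have hH : H.IsHermitian := by
    simp only [H, Matrix.IsHermitian, Matrix.conjTranspose_smul, Matrix.conjTranspose_add,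
      Matrix.conjTranspose_conjTranspose, add_comm]
    simp
  have hK : K.IsHermitian := by
    simp only [K, Matrix.IsHermitian, Matrix.conjTranspose_smul, Matrix.conjTranspose_sub,
      Matrix.conjTranspose_conjTranspose]
    rw [← neg_sub M, smul_neg, ← neg_smul]
    congr 1
    simp [neg_div]
  let Q : Polynomial ℂ := aeval (fun s : Fin N × Fin N =>
    Polynomial.C (H s.1 s.2) + Polynomial.X * Polynomial.C (K s.1 s.2)) p
  have hQ : ∀ t, Q.eval t = evalMat (H + t • K) p := by
    intro t
    rw [← Polynomial.coe_aeval_eq_eval]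
    change (((Polynomial.aeval t : Polynomial ℂ →ₐ[ℂ] ℂ).comp (aeval _)) p) = _
    congr 1
    refine algHom_ext fun s => ?_
    simp only [evalMat, aeval_X, AlgHom.comp_apply, map_add, map_mul, Polynomial.aeval_C,
      Polynomial.aeval_X, Matrix.add_apply, Matrix.smul_apply, smul_eq_mul,
      Algebra.algebraMap_self, RingHom.id_apply]
  have hQ0 : Q = 0 := by
    refine Polynomial.eq_zero_of_infinite_isRoot Q ?_
    refine (Set.infinite_range_of_injective Complex.ofReal_injective).mono ?_
    rintro _ ⟨t, rfl⟩
    rw [Set.mem_ofPred_eq, Polynomial.IsRoot.def, hQ]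
    refine hp _ (hH.add ?_)
    rw [Matrix.IsHermitian, Matrix.conjTranspose_smul, hK.eq]
    simp
  have hM : H + Complex.I • K = M := by
    ext i j
    simp only [H, K, Matrix.add_apply, Matrix.smul_apply, Matrix.sub_apply, smul_eq_mul]
    linear_combination (-(M i j - Mᴴ i j) / 2) * Complex.I_mul_I
  have := hQ Complex.I
  rw [hQ0, Polynomial.eval_zero, hM] at this
  rw [map_zero, this, ← coe_aeval_eq_eval]
  rfl

theorem IsConjInvariant.eq_of_resDiag_eq {p q : MvPolynomial (Fin N × Fin N) ℂ}
    (hp : IsConjInvariant p) (hq : IsConjInvariant q) (h : resDiag N p = resDiag N q) : p = q := by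
  refine sub_eq_zero.mp (eq_zero_of_evalMat_isHermitian fun H hH => ?_)
  have hs := hH.spectral_theorem
  rw [Unitary.conjStarAlgAut_apply] at hs
  have hs' : H = conjMat (Matrix.diagonal (RCLike.ofReal ∘ hH.eigenvalues)) hH.eigenvectorUnitary :=
    hs
  rw [hs', map_sub, hp, hq, ← eval_resDiag, ← eval_resDiag, h, sub_self]

theorem evalMat_avgPoly_eq_sum (μ : Measure (UN N)) [IsProbabilityMeasure μ]
    [μ.IsMulLeftInvariant] (A B : Matrix (Fin N) (Fin N) ℂ) (n : ℕ) :
    evalMat B (avgPoly μ A n) =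
      ∑ l ∈ partsOf N n, n.factorial * (schur l A * schur l B / poch N l) := by
  have hP : IsConjInvariant (avgPoly μ A n) := fun B U => evalMat_conjMat_avgPoly μ A B n U
  obtain ⟨w, hw, hres⟩ := exists_resDiag_eq_of_isSymmetric
    (isHomogeneous_resDiag (isHomogeneous_avgPoly μ A n)) hP.isSymmetric_resDiag
  obtain ⟨c, rfl⟩ := (Submodule.mem_span_image_finset_iff_exists_fun' ℂ).mp hw
  have hwinv : IsConjInvariant (∑ l ∈ partsOf N n, c l • schurPoly N l) := fun B U =>
    evalMat_conjMat (sum_mem fun l _ => Subalgebra.smul_mem _ (schurPoly_mem l) _) B U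
  have hexp := hwinv.eq_of_resDiag_eq hP hres
  have hc : ∀ m ∈ partsOf N n, c m * poch N m = n.factorial * schur m A := by
    intro m hm
    obtain ⟨hmn, hma⟩ := mem_partsOf.mp hm
    have hom := isHomogeneous_schurPoly m
    rw [hmn] at hom
    have h := constantCoeff_diffOp_avgPoly μ A (schurPoly_mem m) hom
    rw [evalMat_schurPoly, ← hexp, map_sum, map_sum, Finset.sum_eq_single m] at h
    · rw [← h, map_smul, constantCoeff_smul, constantCoeff_diffOp_schurPoly hma hma rfl,
        if_pos rfl, smul_eq_mul]
    · intro l hl hlm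
      obtain ⟨hln, hla⟩ := mem_partsOf.mp hl
      rw [map_smul, constantCoeff_smul, constantCoeff_diffOp_schurPoly hla hma (hln.trans hmn.symm),
        if_neg (Ne.symm hlm), smul_zero]
    · exact fun h => absurd hm h
  rw [← hexp, map_sum]
  refine Finset.sum_congr rfl fun l hl => ?_
  rw [map_smul, evalMat_schurPoly, smul_eq_mul, ← mul_div_assoc, eq_div_iff (poch_ne_zero l)]
  linear_combination schur l B * hc l hl

end SchurExpansion

section Summation

variable {N : ℕ}

theorem norm_pow_apply_le (X : Matrix (Fin N) (Fin N) ℂ) {c : ℝ} (hc : ∀ i j, ‖X i j‖ ≤ c)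
    (m : ℕ) (i j : Fin N) : ‖(X ^ m) i j‖ ≤ (N * c) ^ m := by
  have hc0 : 0 ≤ c := (norm_nonneg _).trans (hc i j)
  induction m generalizing j with
  | zero =>
    rw [pow_zero, pow_zero, Matrix.one_apply]
    split_ifs <;> simp
  | succ m ih =>
    rw [pow_succ, Matrix.mul_apply]
    calc ‖∑ k, (X ^ m) i k * X k j‖ ≤ ∑ _k : Fin N, (N * c) ^ m * c := by
          refine norm_sum_le_of_le _ fun k _ => ?_
          rw [norm_mul]
          exact mul_le_mul (ih k) (hc k j) (norm_nonneg _) (by positivity)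
      _ = (N * c) ^ (m + 1) := by
          rw [Finset.sum_const, Finset.card_univ, Fintype.card_fin, nsmul_eq_mul]
          ring

theorem exists_norm_trace_pow_le (X : Matrix (Fin N) (Fin N) ℂ) :
    ∃ R : ℝ, 1 ≤ R ∧ ∀ m : ℕ, ‖(X ^ (m + 1)).trace‖ ≤ R ^ (m + 1) := by
  set c : ℝ := ∑ i, ∑ j, ‖X i j‖
  have hc0 : 0 ≤ c := by positivity
  have hc : ∀ i j, ‖X i j‖ ≤ c := fun i j =>
    (Finset.single_le_sum (f := fun j => ‖X i j‖) (fun _ _ => norm_nonneg _)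
      (Finset.mem_univ j)).trans
    (Finset.single_le_sum (f := fun i => ∑ j, ‖X i j‖)
      (fun _ _ => Finset.sum_nonneg fun _ _ => norm_nonneg _) (Finset.mem_univ i))
  have hN : (0 : ℝ) ≤ N := Nat.cast_nonneg N
  have hNc : 0 ≤ N * c := by positivity
  refine ⟨(N + 1) * (N * c + 1), by nlinarith, fun m => ?_⟩
  calc ‖(X ^ (m + 1)).trace‖ ≤ ∑ _i : Fin N, (N * c) ^ (m + 1) :=
        norm_sum_le_of_le _ fun i _ => norm_pow_apply_le X hc _ i i
    _ = N * (N * c) ^ (m + 1) := by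
        rw [Finset.sum_const, Finset.card_univ, Fintype.card_fin, nsmul_eq_mul]
    _ ≤ (N + 1) ^ (m + 1) * (N * c + 1) ^ (m + 1) := by
        refine mul_le_mul ?_ (pow_le_pow_left₀ hNc (by linarith) _) (by positivity) (by positivity)
        exact (by linarith : (N : ℝ) ≤ N + 1).trans (le_self_pow₀ (by linarith) (by omega))
    _ = _ := (mul_pow _ _ _).symm

theorem norm_hMat_le {X : Matrix (Fin N) (Fin N) ℂ} {R : ℝ} (hR : 1 ≤ R)
    (hX : ∀ m : ℕ, ‖(X ^ (m + 1)).trace‖ ≤ R ^ (m + 1)) (k : ℕ) : ‖hMat X k‖ ≤ R ^ k := by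
  induction k using Nat.strong_induction_on with
  | _ k ih =>
    cases k with
    | zero => rw [hMat]; simp
    | succ k =>
      have hk : ‖((k : ℂ) + 1)⁻¹‖ = ((k : ℝ) + 1)⁻¹ := by
        rw [norm_inv, ← Nat.cast_succ, Complex.norm_natCast, Nat.cast_succ]
      rw [hMat, norm_mul, hk]
      have hs : ‖∑ m ∈ Finset.range (k + 1), (X ^ (m + 1)).trace * hMat X (k - m)‖ ≤
          ∑ _m ∈ Finset.range (k + 1), R ^ (k + 1) := by
        refine norm_sum_le_of_le _ fun m hm => ?_
        have hm' := Finset.mem_range.mp hm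
        rw [norm_mul]
        calc _ ≤ R ^ (m + 1) * R ^ (k - m) :=
              mul_le_mul (hX m) (ih _ (by omega)) (norm_nonneg _) (by positivity)
          _ = R ^ (k + 1) := by
              rw [← pow_add]
              congr 1
              omega
      rw [Finset.sum_const, Finset.card_range, nsmul_eq_mul] at hs
      calc _ ≤ ((k : ℝ) + 1)⁻¹ * (((k + 1 : ℕ) : ℝ) * R ^ (k + 1)) :=
            mul_le_mul_of_nonneg_left hs (by positivity)
        _ = R ^ (k + 1) := by
            push_cast
            field_simp

theorem exists_norm_schur_le (X : Matrix (Fin N) (Fin N) ℂ) :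
    ∃ C R : ℝ, 0 ≤ C ∧ 1 ≤ R ∧ ∀ l : Fin N → ℕ, ‖schur l X‖ ≤ C * ∏ i, R ^ l i := by
  obtain ⟨R, hR, hX⟩ := exists_norm_trace_pow_le X
  have hR0 : 0 ≤ R := zero_le_one.trans hR
  have hz : ∀ (l : Fin N → ℕ) (i j : Fin N),
      ‖hMatZ X ((l i : ℤ) - (i : ℤ) + (j : ℤ))‖ ≤ R ^ N * R ^ l i := by
    intro l i j
    rw [hMatZ, ← pow_add]
    split_ifs with h
    · rw [norm_zero]
      positivity
    · refine (norm_hMat_le hR hX _).trans (pow_le_pow_right₀ hR ?_)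
      have := j.2
      omega
  refine ⟨N.factorial * (R ^ N) ^ N, R, by positivity, hR, fun l => ?_⟩
  rw [schur, Matrix.det_apply]
  calc _ ≤ ∑ _σ : Equiv.Perm (Fin N), (R ^ N) ^ N * ∏ i, R ^ l i := by
        refine norm_sum_le_of_le _ fun σ _ => ?_
        have h1 : ‖Equiv.Perm.sign σ • ∏ i, (Matrix.of fun i j : Fin N =>
            hMatZ X ((l i : ℤ) - (i : ℤ) + (j : ℤ))) (σ i) i‖ =
            ‖∏ i, hMatZ X ((l (σ i) : ℤ) - (σ i : ℤ) + (i : ℤ))‖ := by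
          rcases Int.units_eq_one_or (Equiv.Perm.sign σ) with hs | hs <;> simp [hs]
        rw [h1, norm_prod]
        calc _ ≤ ∏ i, (R ^ N * R ^ l (σ i)) :=
              Finset.prod_le_prod (fun _ _ => norm_nonneg _) fun i _ => hz l (σ i) i
          _ = _ := by
              rw [Finset.prod_mul_distrib, Equiv.prod_comp σ fun i => R ^ l i, Finset.prod_const,
                Finset.card_univ, Fintype.card_fin]
    _ = _ := by
        rw [Finset.sum_const, Finset.card_univ, Fintype.card_perm, Fintype.card_fin, nsmul_eq_mul,
          mul_assoc]

theorem summable_prod_apply {f : ℕ → ℝ} (hf0 : ∀ n, 0 ≤ f n) (hf : Summable f) :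
    Summable fun l : Fin N → ℕ => ∏ i, f (l i) := by
  refine summable_of_sum_le (c := (∑' n, f n) ^ N)
    (fun l => Finset.prod_nonneg fun i _ => hf0 _) fun u => ?_
  let t : Fin N → Finset ℕ := fun i => u.image fun l => l i
  calc _ ≤ ∑ l ∈ Fintype.piFinset t, ∏ i, f (l i) :=
        Finset.sum_le_sum_of_subset_of_nonneg
          (fun l hl => Fintype.mem_piFinset.mpr fun i => Finset.mem_image_of_mem _ hl)
          fun l _ _ => Finset.prod_nonneg fun i _ => hf0 _
    _ = ∏ i, ∑ n ∈ t i, f n := by rw [Finset.prod_univ_sum]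
    _ ≤ ∏ _i : Fin N, ∑' n, f n :=
        Finset.prod_le_prod (fun i _ => Finset.sum_nonneg fun n _ => hf0 n)
          fun i _ => hf.sum_le_tsum _ fun n _ => hf0 n
    _ = _ := by rw [Finset.prod_const, Finset.card_univ, Fintype.card_fin]

theorem summable_schur_mul_schur_div_poch (A B : Matrix (Fin N) (Fin N) ℂ) :
    Summable fun l : Fin N → ℕ => schur l A * schur l B / poch N l := by
  obtain ⟨C, R, hC, hR, hA⟩ := exists_norm_schur_le A
  obtain ⟨D, S, hD, hS, hB⟩ := exists_norm_schur_le B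
  have hR0 : 0 ≤ R := zero_le_one.trans hR
  have hS0 : 0 ≤ S := zero_le_one.trans hS
  refine Summable.of_norm_bounded (g := fun l => C * D * ∏ i, ((R * S) ^ l i / (l i).factorial))
    ((summable_prod_apply (fun n => by positivity)
      (Real.summable_pow_div_factorial (R * S))).mul_left _) fun l => ?_
  rw [norm_div, norm_mul, Finset.prod_div_distrib, ← mul_div_assoc]
  refine div_le_div₀ (by positivity) ?_ (Finset.prod_pos fun i _ => by positivity)
    (prod_factorial_le_norm_poch l)
  calc _ ≤ (C * ∏ i, R ^ l i) * (D * ∏ i, S ^ l i) :=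
        mul_le_mul (hA l) (hB l) (norm_nonneg _) (by positivity)
    _ = _ := by
        simp only [mul_pow, Finset.prod_mul_distrib]
        ring

theorem hasSum_integral_exp_trace (μ : Measure (UN N)) [IsProbabilityMeasure μ]
    [μ.IsMulLeftInvariant] (A B : Matrix (Fin N) (Fin N) ℂ) :
    HasSum (fun n => ∑ l ∈ partsOf N n, schur l A * schur l B / poch N l)
      (∫ X, Complex.exp (conjMat A X * B).trace ∂μ) := by
  have hcont : Continuous fun X : UN N => (conjMat A X * B).trace :=
    ((continuous_conjMat A).mul continuous_const).matrix_trace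
  obtain ⟨M, hM⟩ := isCompact_univ.exists_bound_of_continuousOn hcont.continuousOn
  have key := hasSum_integral_of_dominated_convergence (μ := μ)
    (F := fun (n : ℕ) X => (conjMat A X * B).trace ^ n / (n.factorial : ℂ))
    (f := fun X => Complex.exp (conjMat A X * B).trace)
    (fun n _ => M ^ n / n.factorial)
    (fun n => (integrable_of_continuous μ ((hcont.pow n).div_const _)).aestronglyMeasurable)
    (fun n => ae_of_all _ fun X => ?_)
    (ae_of_all _ fun X => Real.summable_pow_div_factorial M) (integrable_const _)
    (ae_of_all _ fun X => ?_)
  · refine key.congr_fun fun n => ?_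
    rw [integral_div, ← evalMat_avgPoly, evalMat_avgPoly_eq_sum, ← Finset.mul_sum,
      mul_div_cancel_left₀ _ (Nat.cast_ne_zero.mpr n.factorial_ne_zero)]
  · rw [norm_div, norm_pow, Complex.norm_natCast]
    gcongr
    exact hM X (Set.mem_univ X)
  · rw [Complex.exp_eq_exp_ℂ]
    exact NormedSpace.expSeries_div_hasSum_exp _

theorem hasSum_partsOf {f : (Fin N → ℕ) → ℂ} (hf : Summable f) :
    HasSum (fun n => ∑ l ∈ partsOf N n, f l) (∑' l : PartitionN N, f l.1) := by
  have hs : Summable ({l : Fin N → ℕ | Antitone l}.indicator f) := hf.indicator _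
  have h := hs.hasSum.tsum_fiberwise fun l => ∑ i, l i
  have h1 : ∑' l, {l : Fin N → ℕ | Antitone l}.indicator f l = ∑' l : PartitionN N, f l.1 :=
    (tsum_subtype _ f).symm
  rw [h1] at h
  refine h.congr_fun fun n => ?_
  rw [tsum_subtype, tsum_eq_sum (s := partsOf N n)]
  · refine Finset.sum_congr rfl fun l hl => ?_
    obtain ⟨hn, ha⟩ := mem_partsOf.mp hl
    rw [Set.indicator_of_mem (by exact hn), Set.indicator_of_mem (by exact ha)]
  · intro l hl
    simp only [Set.indicator_apply_eq_zero]
    exact fun hn ha => absurd (mem_partsOf.mpr ⟨hn, ha⟩) hl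

end Summation

/-- The Harish-Chandra-Itzykson-Zuber-type integral over `U(N)`:
`∫_{U(N)} exp(Tr(XAX†B)) d_*X = Σ_{λ : ℓ(λ) ≤ N} s_λ(A)s_λ(B)/(N)_λ`,
the sum converging absolutely. -/
theorem statement15 {N : ℕ} (hN : 1 ≤ N)
    (A B : Matrix (Fin N) (Fin N) ℂ)
    (μ : Measure (UN N)) [μ.IsHaarMeasure] [IsProbabilityMeasure μ] :
    Summable (fun l : PartitionN N => schur l.1 A * schur l.1 B / poch N l.1) ∧
    (∫ X : UN N,
        Complex.exp (((X : Matrix (Fin N) (Fin N) ℂ) * A * star (X : Matrix (Fin N) (Fin N) ℂ) * B).trace) ∂μ) =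
      ∑' l : PartitionN N, schur l.1 A * schur l.1 B / poch N l.1 := by
  have hs := summable_schur_mul_schur_div_poch A B
  exact ⟨hs.subtype _, (hasSum_integral_exp_trace μ A B).unique (hasSum_partsOf hs)⟩

end
end

section
/- For any N×N complex matrices A and B, ∫_{SU(N)} exp(Tr(X A X† B)) dμ(X) = ∫_{U(N)} exp(Tr(X A X† B)) d_*X = Σ_{λ : ℓ(λ) ≤ N} s_λ(A) s_λ(B) / (N)_λ, the absolutely convergent sum over all partitions λ with at most N parts. -/
open scoped BigOperators Classical
open MeasureTheory Matrix

noncomputable section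

/-- The special unitary group `SU(N)`, as a subgroup of `U(N)`. -/
def SUN (N : ℕ) : Subgroup (UN N) where
  carrier := {U | (U : Matrix (Fin N) (Fin N) ℂ).det = 1}
  one_mem' := by simp
  mul_mem' := by
    intro a b ha hb
    simp only [Set.mem_setOf_eq, Submonoid.coe_mul, Matrix.det_mul] at *
    rw [ha, hb, mul_one]
  inv_mem' := by
    intro a ha
    simp only [Set.mem_setOf_eq] at *
    have h1 : ((a⁻¹ : UN N) : Matrix (Fin N) (Fin N) ℂ)
        = star (a : Matrix (Fin N) (Fin N) ℂ) := rfl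
    have h2 : (star (a : Matrix (Fin N) (Fin N) ℂ)).det
        = star ((a : Matrix (Fin N) (Fin N) ℂ)).det := by
      simp [Matrix.star_eq_conjTranspose, Matrix.det_conjTranspose]
    rw [h1, h2, ha, star_one]

instance (N : ℕ) : MeasurableSpace (SUN N) := borel _

namespace HCIZ

section SchurOver

variable {N : ℕ} {R S : Type*} [CommRing R] [Algebra ℂ R] [CommRing S] [Algebra ℂ S]

/-- Complete homogeneous symmetric functions of a matrix over a `ℂ`-algebra. -/
def hMatOver (X : Matrix (Fin N) (Fin N) R) : ℕ → R
  | 0 => 1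
  | (k+1) => algebraMap ℂ R ((k : ℂ) + 1)⁻¹ *
      ∑ m ∈ Finset.range (k+1), (X ^ (m+1)).trace * hMatOver X (k - m)
  termination_by k => k
  decreasing_by exact Nat.lt_succ_of_le (Nat.sub_le _ _)

/-- `hMatOver` extended by zero to negative indices. -/
def hMatZOver (X : Matrix (Fin N) (Fin N) R) (k : ℤ) : R :=
  if k < 0 then 0 else hMatOver X k.toNat

/-- The Jacobi-Trudi determinant over a `ℂ`-algebra. -/
def schurOver (l : Fin N → ℕ) (X : Matrix (Fin N) (Fin N) R) : R :=
  (Matrix.of fun i j : Fin N => hMatZOver X ((l i : ℤ) - (i : ℤ) + (j : ℤ))).det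

lemma hMatOver_zero (X : Matrix (Fin N) (Fin N) R) : hMatOver X 0 = 1 := by
  rw [hMatOver]

lemma hMatOver_succ (X : Matrix (Fin N) (Fin N) R) (k : ℕ) :
    hMatOver X (k + 1) = algebraMap ℂ R ((k : ℂ) + 1)⁻¹ *
      ∑ m ∈ Finset.range (k+1), (X ^ (m+1)).trace * hMatOver X (k - m) := by
  rw [hMatOver]

lemma newton_hMatOver (X : Matrix (Fin N) (Fin N) R) (k : ℕ) :
    ((k : R) + 1) * hMatOver X (k + 1) =
      ∑ m ∈ Finset.range (k+1), (X ^ (m+1)).trace * hMatOver X (k - m) := by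
  have h : (k : ℂ) + 1 ≠ 0 := Nat.cast_add_one_ne_zero k
  have h2 : ((k : R) + 1) = algebraMap ℂ R ((k : ℂ) + 1) := by simp
  rw [hMatOver_succ, ← mul_assoc, h2, ← map_mul, mul_inv_cancel₀ h, map_one, one_mul]

lemma hMatOver_eq_hMat (X : Matrix (Fin N) (Fin N) ℂ) (k : ℕ) : hMatOver X k = hMat X k := by
  induction k using Nat.strong_induction_on with
  | _ k ih =>
    cases k with
    | zero => rw [hMatOver, hMat]
    | succ k =>
      rw [hMatOver, hMat]
      congr 1
      exact Finset.sum_congr rfl fun m _ => by rw [ih (k - m) (by omega)]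

lemma schurOver_eq_schur (l : Fin N → ℕ) (X : Matrix (Fin N) (Fin N) ℂ) :
    schurOver l X = schur l X := by
  simp [schurOver, schur, hMatZOver, hMatZ, hMatOver_eq_hMat]

lemma hMatOver_map (f : R →ₐ[ℂ] S) (X : Matrix (Fin N) (Fin N) R) (k : ℕ) :
    f (hMatOver X k) = hMatOver (f.mapMatrix X) k := by
  induction k using Nat.strong_induction_on with
  | _ k ih =>
    cases k with
    | zero => simp [hMatOver_zero]
    | succ k =>
      rw [hMatOver_succ, hMatOver_succ, map_mul, map_sum, AlgHom.commutes]
      congr 1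
      refine Finset.sum_congr rfl fun m _ => ?_
      rw [map_mul, ih (k - m) (by omega), ← map_pow]
      congr 1
      exact AddMonoidHom.map_trace f (X ^ (m + 1))

lemma schurOver_map (f : R →ₐ[ℂ] S) (l : Fin N → ℕ) (X : Matrix (Fin N) (Fin N) R) :
    f (schurOver l X) = schurOver l (f.mapMatrix X) := by
  rw [schurOver, schurOver, AlgHom.map_det]
  congr 1
  ext i j
  simp only [AlgHom.mapMatrix_apply, Matrix.map_apply, Matrix.of_apply, hMatZOver]
  split_ifs
  · simp
  · exact hMatOver_map f X _

lemma hMatOver_mem (A : Subalgebra ℂ R) (X : Matrix (Fin N) (Fin N) R)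
    (h : ∀ m, (X ^ (m + 1)).trace ∈ A) (k : ℕ) : hMatOver X k ∈ A := by
  induction k using Nat.strong_induction_on with
  | _ k ih =>
    cases k with
    | zero => rw [hMatOver_zero]; exact A.one_mem
    | succ k =>
      rw [hMatOver_succ]
      exact A.mul_mem (A.algebraMap_mem _)
        (A.sum_mem fun m _ => A.mul_mem (h m) (ih _ (by omega)))

lemma schurOver_mem (A : Subalgebra ℂ R) (X : Matrix (Fin N) (Fin N) R)
    (h : ∀ m, (X ^ (m + 1)).trace ∈ A) (l : Fin N → ℕ) : schurOver l X ∈ A := by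
  rw [schurOver, Matrix.det_apply]
  refine A.sum_mem fun σ _ => ?_
  rw [Units.smul_def]
  refine A.zsmul_mem (A.prod_mem fun i _ => ?_) _
  simp only [Matrix.of_apply, hMatZOver]
  split_ifs
  · exact A.zero_mem
  · exact hMatOver_mem A X h _

lemma hMatOver_congr {X Y : Matrix (Fin N) (Fin N) R}
    (h : ∀ m, (X ^ (m + 1)).trace = (Y ^ (m + 1)).trace) (k : ℕ) :
    hMatOver X k = hMatOver Y k := by
  induction k using Nat.strong_induction_on with
  | _ k ih =>
    cases k with
    | zero => simp [hMatOver_zero]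
    | succ k =>
      rw [hMatOver_succ, hMatOver_succ]
      congr 1
      exact Finset.sum_congr rfl fun m _ => by rw [h, ih _ (by omega)]

lemma schurOver_congr {X Y : Matrix (Fin N) (Fin N) R}
    (h : ∀ m, (X ^ (m + 1)).trace = (Y ^ (m + 1)).trace) (l : Fin N → ℕ) :
    schurOver l X = schurOver l Y := by
  simp [schurOver, hMatZOver, hMatOver_congr h]

lemma schurOver_conj {U V : Matrix (Fin N) (Fin N) R} (h : V * U = 1)
    (X : Matrix (Fin N) (Fin N) R) (l : Fin N → ℕ) :
    schurOver l (U * X * V) = schurOver l X := by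
  refine schurOver_congr (fun m => ?_) l
  have : ∀ k : ℕ, (U * X * V) ^ (k + 1) = U * X ^ (k + 1) * V := by
    intro k
    induction k with
    | zero => simp
    | succ k ih =>
      rw [pow_succ, ih, pow_succ X (k + 1)]
      calc U * X ^ (k + 1) * V * (U * X * V) = U * X ^ (k + 1) * (V * U) * X * V := by
            simp only [Matrix.mul_assoc]
        _ = _ := by rw [h, Matrix.mul_one, Matrix.mul_assoc U]
  rw [this, Matrix.trace_mul_comm, ← Matrix.mul_assoc, h, Matrix.one_mul]

lemma schur_conjTranspose (l : Fin N → ℕ) (X : Matrix (Fin N) (Fin N) ℂ) :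
    schur l Xᴴ = star (schur l X) := by
  have hh : ∀ k, hMat Xᴴ k = star (hMat X k) := by
    intro k
    induction k using Nat.strong_induction_on with
    | _ k ih =>
      cases k with
      | zero => simp [hMat]
      | succ k =>
        rw [hMat, hMat, star_mul', star_sum]
        congr 1
        · simp
        · refine Finset.sum_congr rfl fun m _ => ?_
          rw [ih _ (by omega), star_mul', ← Matrix.conjTranspose_pow, Matrix.trace_conjTranspose]
  rw [schur, schur, ← Matrix.det_conjTranspose, ← Matrix.det_transpose]
  congr 1
  ext i j
  simp only [Matrix.transpose_apply, Matrix.conjTranspose_apply, Matrix.of_apply, hMatZ]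
  split_ifs
  · simp
  · exact hh _

end SchurOver

section Bialternant

variable {N : ℕ} {R : Type*} [CommRing R]

/-- The alternant `det (y_i ^ l_j)`. -/
def alternant (l : Fin N → ℕ) (y : Fin N → R) : R :=
  (Matrix.of fun i j : Fin N => y i ^ l j).det

/-- The staircase `(N - 1, N - 2, …, 0)`. -/
def staircase (N : ℕ) (i : Fin N) : ℕ := N - 1 - i

open PowerSeries in
/-- The generating series `∏_{i ∈ s} (1 - y_i t)`. -/
def eSeries {ι : Type*} (s : Finset ι) (y : ι → R) : R⟦X⟧ := ∏ i ∈ s, (1 - C (y i) * X)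

open PowerSeries in
lemma coeff_eSeries_of_lt {ι : Type*} (s : Finset ι) (y : ι → R) :
    ∀ k, s.card < k → coeff k (eSeries s y) = 0 := by
  induction s using Finset.induction_on with
  | empty =>
    intro k hk
    simp only [Finset.card_empty] at hk
    simp [eSeries, coeff_one, hk.ne']
  | insert a s ha ih =>
    intro k hk
    rw [Finset.card_insert_of_notMem ha] at hk
    obtain ⟨k, rfl⟩ : ∃ m, k = m + 1 := ⟨k - 1, by omega⟩
    rw [eSeries, Finset.prod_insert ha, ← eSeries, sub_mul, one_mul, map_sub, mul_assoc,
      coeff_C_mul, coeff_succ_X_mul, ih _ (by omega), ih _ (by omega)]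
    simp

open PowerSeries in
lemma mk_pow_mul (y : R) : (mk fun m => y ^ m) * (1 - C y * X) = 1 := by
  ext k
  rw [mul_sub, mul_one, map_sub, coeff_mk]
  cases k with
  | zero => simp
  | succ k =>
    rw [mul_comm (C y), ← mul_assoc, coeff_mul_C, coeff_succ_mul_X, coeff_mk, pow_succ]
    simp [coeff_one]

open PowerSeries in
lemma derivative_eSeries {ι : Type*} (s : Finset ι) (y : ι → R) :
    d⁄dX R (eSeries s y) =
      -((∑ i ∈ s, C (y i) * mk fun m => y i ^ m) * eSeries s y) := by
  induction s using Finset.induction_on with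
  | empty => simp [eSeries]
  | insert a s ha ih =>
    have h := mk_pow_mul (y a)
    rw [eSeries, Finset.prod_insert ha, ← eSeries, Finset.sum_insert ha]
    have hd : d⁄dX R (1 - C (y a) * X : R⟦X⟧) = - C (y a) := by
      simp
    rw [Derivation.leibniz, hd, ih]
    simp only [smul_eq_mul]
    linear_combination (C (y a) * eSeries s y) * h

variable [Algebra ℂ R]

lemma isAddTorsionFree_of_complex : IsAddTorsionFree R where
  nsmul_right_injective n hn a b h := by
    have h1 : algebraMap ℂ R (n : ℂ) * a = algebraMap ℂ R (n : ℂ) * b := by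
      simpa [nsmul_eq_mul] using h
    have h2 : algebraMap ℂ R (n : ℂ)⁻¹ * algebraMap ℂ R (n : ℂ) = 1 := by
      rw [← map_mul, inv_mul_cancel₀ (by exact_mod_cast hn), map_one]
    calc a = algebraMap ℂ R (n : ℂ)⁻¹ * algebraMap ℂ R (n : ℂ) * a := by rw [h2, one_mul]
      _ = b := by rw [mul_assoc, h1, ← mul_assoc, h2, one_mul]

open PowerSeries in
lemma mk_hMatOver_mul_eSeries (y : Fin N → R) :
    (mk fun k => hMatOver (Matrix.diagonal y) k) * eSeries Finset.univ y = 1 := by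
  have : IsAddTorsionFree R := isAddTorsionFree_of_complex
  have hH : d⁄dX R (mk fun k => hMatOver (Matrix.diagonal y) k) =
      (∑ i, C (y i) * mk fun m => y i ^ m) * mk fun k => hMatOver (Matrix.diagonal y) k := by
    ext k
    rw [coeff_derivative, coeff_mk, mul_comm (hMatOver _ _), newton_hMatOver, coeff_mul,
      Finset.Nat.sum_antidiagonal_eq_sum_range_succ_mk]
    refine Finset.sum_congr rfl fun m _ => ?_
    simp [Matrix.diagonal_pow, Matrix.trace_diagonal, pow_succ']
  apply derivative.ext
  · rw [Derivation.leibniz, hH, derivative_eSeries, derivative_one]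
    simp only [smul_eq_mul]
    ring
  · simp [eSeries, map_prod, hMatOver_zero]

open PowerSeries in
lemma sum_eSeries_mul_hMatZOver (y : Fin N → R) (i : Fin N) (a : ℕ) :
    ∑ j : Fin N, hMatZOver (Matrix.diagonal y) ((a : ℤ) - (N - 1 : ℕ) + j) *
      coeff (N - 1 - j) (eSeries (Finset.univ.erase i) y) = y i ^ a := by
  have h1 : (mk fun k => hMatOver (Matrix.diagonal y) k) * eSeries (Finset.univ.erase i) y =
      mk fun m => y i ^ m := by
    have h := mk_hMatOver_mul_eSeries y
    rw [eSeries, ← Finset.mul_prod_erase _ _ (Finset.mem_univ i), ← eSeries] at h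
    have h' := mk_pow_mul (y i)
    linear_combination (mk fun m => y i ^ m) * h -
      ((mk fun k => hMatOver (Matrix.diagonal y) k) * eSeries (Finset.univ.erase i) y) * h'
  have h2 := congrArg (coeff a) h1
  rw [coeff_mk, mul_comm, coeff_mul, Finset.Nat.sum_antidiagonal_eq_sum_range_succ_mk] at h2
  have hN : 0 < N := i.pos
  have hcard : (Finset.univ.erase i).card = N - 1 := by
    simp [Finset.card_erase_of_mem]
  rw [← h2, Fin.sum_univ_eq_sum_range (fun j => hMatZOver (Matrix.diagonal y)
    ((a : ℤ) - (N - 1 : ℕ) + j) * coeff (N - 1 - j) (eSeries (Finset.univ.erase i) y)) N,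
    ← Finset.sum_range_reflect]
  have h3 : ∀ k ∈ Finset.range N, hMatZOver (Matrix.diagonal y)
      ((a : ℤ) - (N - 1 : ℕ) + ((N - 1 - k : ℕ) : ℤ)) *
        coeff (N - 1 - (N - 1 - k)) (eSeries (Finset.univ.erase i) y) =
      if k < a + 1 then coeff k (eSeries (Finset.univ.erase i) y) *
        hMatOver (Matrix.diagonal y) (a - k) else 0 := by
    intro k hk
    rw [Finset.mem_range] at hk
    have e1 : (a : ℤ) - (N - 1 : ℕ) + ((N - 1 - k : ℕ) : ℤ) = (a : ℤ) - k := by omega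
    have e2 : N - 1 - (N - 1 - k) = k := by omega
    rw [e1, e2, hMatZOver]
    split_ifs with c1 c2 c2
    · omega
    · simp
    · rw [mul_comm]; congr 2; omega
    · omega
  rw [Finset.sum_congr rfl h3, ← Finset.sum_filter, ← Finset.sum_filter_add_sum_filter_not
    (Finset.range a.succ) (fun k => k < N)]
  rw [Finset.sum_eq_zero (s := Finset.filter (fun k => ¬ k < N) _), add_zero]
  · refine Finset.sum_congr ?_ fun k _ => by simp [coeff_mk]
    ext k; simp; omega
  · intro k hk
    simp only [Finset.mem_filter] at hk
    rw [coeff_eSeries_of_lt _ _ _ (by omega), zero_mul]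

open PowerSeries in
lemma alternant_eq_schurOver_mul_det (l : Fin N → ℕ) (y : Fin N → R) :
    alternant (fun j => l j + staircase N j) y = schurOver l (Matrix.diagonal y) *
      (Matrix.of fun j i : Fin N =>
        coeff (N - 1 - j) (eSeries (Finset.univ.erase i) y)).det := by
  rw [alternant, schurOver, ← Matrix.det_mul, ← Matrix.det_transpose]
  congr 1
  ext r i
  rw [Matrix.transpose_apply, Matrix.of_apply, Matrix.mul_apply,
    ← sum_eSeries_mul_hMatZOver y i (l r + staircase N r)]
  refine Finset.sum_congr rfl fun j _ => ?_
  simp only [Matrix.of_apply]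
  congr 2
  have := r.2
  rw [staircase]
  omega

lemma schurOver_zero (X : Matrix (Fin N) (Fin N) R) : schurOver (fun _ => 0) X = 1 := by
  rw [schurOver, Matrix.det_of_isUpperTriangular]
  · simp [hMatZOver, hMatOver_zero]
  · intro i j hij
    simp only [id] at hij
    have : (j : ℕ) < i := hij
    simp only [Matrix.of_apply, hMatZOver]
    rw [if_pos]
    omega

lemma alternant_mul_schurOver (l : Fin N → ℕ) (y : Fin N → R) :
    alternant (fun j => l j + staircase N j) y =
      alternant (staircase N) y * schurOver l (Matrix.diagonal y) := by
  have h0 := alternant_eq_schurOver_mul_det (fun _ => 0) y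
  rw [schurOver_zero, one_mul] at h0
  simp only [zero_add] at h0
  rw [alternant_eq_schurOver_mul_det, mul_comm]
  congr 1
  exact h0.symm

end Bialternant

section Commutator

variable {E : Type*} [AddCommGroup E] [Module ℂ E]

/-- The commutator `T ↦ LT - TL` with a fixed endomorphism `L`. -/
def commutator (L : Module.End ℂ E) : Module.End ℂ (Module.End ℂ E) :=
  LinearMap.mulLeft ℂ L - LinearMap.mulRight ℂ L

lemma commutator_apply (L T : Module.End ℂ E) : commutator L T = L * T - T * L := rfl

lemma commutator_mul (L S T : Module.End ℂ E) :
    commutator L (S * T) = commutator L S * T + S * commutator L T := by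
  simp only [commutator_apply]
  noncomm_ring

lemma commutator_pow_succ_mul (L S T : Module.End ℂ E) (h : commutator L (commutator L S) = 0)
    (n : ℕ) : (commutator L ^ (n + 1)) (S * T) = S * (commutator L ^ (n + 1)) T +
      ((n : ℂ) + 1) • (commutator L S * (commutator L ^ n) T) := by
  induction n with
  | zero => simp [commutator_mul, add_comm]
  | succ n ih =>
    rw [pow_succ' _ (n + 1), Module.End.mul_apply, ih, map_add, map_smul, commutator_mul,
      commutator_mul, h, zero_mul, zero_add, ← Module.End.mul_apply, ← Module.End.mul_apply,
      ← pow_succ', ← pow_succ']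
    push_cast
    module

end Commutator

section Fischer

open MvPolynomial

lemma pderiv_comm {σ : Type*} (i j : σ) (p : MvPolynomial σ ℂ) :
    pderiv i (pderiv j p) = pderiv j (pderiv i p) := by
  ext m
  simp only [coeff_pderiv]
  by_cases h : i = j
  · subst h; rfl
  · simp [h, Ne.symm h, add_right_comm]
    ring

variable {σ : Type*} [Fintype σ]

/-- The Fischer pairing `⟨x^α, x^β⟩ = α! δ_{τα,β}`, twisted by a permutation of the variables. -/
def fischer (τ : σ ≃ σ) : MvPolynomial σ ℂ →ₗ[ℂ] MvPolynomial σ ℂ →ₗ[ℂ] ℂ :=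
  (basisMonomials σ ℂ).constr ℂ fun α =>
    (∏ k, ((α k).factorial : ℂ)) • lcoeff ℂ (α.equivMapDomain τ)

lemma fischer_monomial (τ : σ ≃ σ) (α : σ →₀ ℕ) (c : ℂ) (q : MvPolynomial σ ℂ) :
    fischer τ (monomial α c) q =
      c * ((∏ k, ((α k).factorial : ℂ)) * coeff (α.equivMapDomain τ) q) := by
  have h : monomial α c = c • basisMonomials σ ℂ α := by
    simp [smul_monomial]
  rw [h, map_smul, fischer, Module.Basis.constr_basis]
  simp

lemma fischer_X_mul (τ : σ ≃ σ) (k : σ) (p q : MvPolynomial σ ℂ) :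
    fischer τ (X k * p) q = fischer τ p (pderiv (τ k) q) := by
  induction p using MvPolynomial.induction_on' with
  | add p₁ p₂ h₁ h₂ => simp [mul_add, h₁, h₂]
  | monomial α c =>
    rw [X, monomial_mul, one_mul, fischer_monomial, fischer_monomial, coeff_pderiv]
    have h1 : Finsupp.equivMapDomain τ (Finsupp.single k 1 + α) =
        Finsupp.equivMapDomain τ α + Finsupp.single (τ k) 1 := by
      ext j
      simp [Finsupp.equivMapDomain_apply, Finsupp.single_apply, Equiv.eq_symm_apply, add_comm]
    have h2 : (∏ j, (((Finsupp.single k 1 + α : σ →₀ ℕ) j).factorial : ℂ)) =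
        (α k + 1) * ∏ j, ((α j).factorial : ℂ) := by
      rw [← Finset.mul_prod_erase _ _ (Finset.mem_univ k),
        ← Finset.mul_prod_erase Finset.univ (fun j => ((α j).factorial : ℂ)) (Finset.mem_univ k),
        ← mul_assoc]
      congr 1
      · simp [add_comm 1 (α k), Nat.factorial_succ]
      · refine Finset.prod_congr rfl fun j hj => ?_
        simp [(Finset.ne_of_mem_erase hj).symm]
    rw [h1, h2]
    rw [Finsupp.equivMapDomain_apply, Equiv.symm_apply_apply]
    ring

/-- The second order operator `∑ ∂_k ∂_{τ k}`. -/
def laplace (τ : σ ≃ σ) : Module.End ℂ (MvPolynomial σ ℂ) :=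
  ∑ k, (pderiv k).toLinearMap * (pderiv (τ k)).toLinearMap

lemma laplace_apply (τ : σ ≃ σ) (p : MvPolynomial σ ℂ) :
    laplace τ p = ∑ k, pderiv k (pderiv (τ k) p) := by
  simp [laplace]

/-- Multiplication by a polynomial. -/
abbrev mulBy (p : MvPolynomial σ ℂ) : Module.End ℂ (MvPolynomial σ ℂ) := LinearMap.mulLeft ℂ p

lemma commutator_laplace_X {τ : σ ≃ σ} (hτ : ∀ k, τ (τ k) = k) (j : σ) :
    commutator (laplace τ) (mulBy (X j)) = (2 : ℂ) • (pderiv (τ j)).toLinearMap := by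
  refine LinearMap.ext fun p => ?_
  rw [commutator_apply]
  simp only [LinearMap.sub_apply, Module.End.mul_apply, LinearMap.mulLeft_apply,
    LinearMap.smul_apply, Derivation.coeFn_coe, laplace_apply, Finset.mul_sum,
    ← Finset.sum_sub_distrib]
  have h : ∀ k, pderiv k (pderiv (τ k) (X j * p)) - X j * pderiv k (pderiv (τ k) p) =
      (if k = τ j then pderiv (τ j) p else 0) + (if k = j then pderiv (τ j) p else 0) := by
    intro k
    have e : τ k = j ↔ k = τ j := ⟨fun h => by rw [← h, hτ], fun h => by rw [h, hτ]⟩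
    have e1 : pderiv (τ k) (X j : MvPolynomial σ ℂ) = if k = τ j then 1 else 0 := by
      simp [Pi.single_apply, eq_comm (a := j), e]
    have e2 : pderiv k (X j : MvPolynomial σ ℂ) = if k = j then 1 else 0 := by
      simp [Pi.single_apply, eq_comm (a := j)]
    have e3 : pderiv k (if k = τ j then 1 else 0 : MvPolynomial σ ℂ) = 0 := by
      split_ifs <;> simp
    have hA : (if k = τ j then pderiv (τ j) p else 0) =
        (if k = τ j then 1 else 0) * pderiv k p := by
      split_ifs with h1
      · rw [h1, one_mul]
      · rw [zero_mul]
    have hB : (if k = j then pderiv (τ j) p else 0) =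
        (if k = j then 1 else 0) * pderiv (τ k) p := by
      split_ifs with h1
      · rw [h1, one_mul]
      · rw [zero_mul]
    rw [hA, hB, pderiv_mul, map_add, pderiv_mul, pderiv_mul, e1, e2, e3]
    ring
  rw [Finset.sum_congr rfl fun k _ => h k, Finset.sum_add_distrib]
  simp [two_smul]

lemma commutator_laplace_pderiv (τ : σ ≃ σ) (j : σ) :
    commutator (laplace τ) (pderiv j).toLinearMap = 0 := by
  refine LinearMap.ext fun p => ?_
  simp only [commutator_apply, LinearMap.sub_apply, Module.End.mul_apply, Derivation.coeFn_coe,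
    laplace_apply, map_sum, LinearMap.zero_apply, ← Finset.sum_sub_distrib]
  refine Finset.sum_eq_zero fun k _ => ?_
  rw [pderiv_comm j k, pderiv_comm j (τ k), sub_self]

lemma commutator_pow_monomial {τ : σ ≃ σ} (hτ : ∀ k, τ (τ k) = k) :
    ∀ (n : ℕ) (α : σ →₀ ℕ), α.degree = n →
      (commutator (laplace τ) ^ (n + 1)) (mulBy (monomial α 1)) = 0 ∧
      ∀ u q, fischer τ u ((commutator (laplace τ) ^ n) (mulBy (monomial α 1)) q) =
        (2 ^ n * n.factorial : ℂ) * fischer τ (u * monomial α 1) q := by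
  intro n
  induction n with
  | zero =>
    intro α hα
    obtain rfl : α = 0 := (Finsupp.degree_eq_zero_iff α).1 hα
    constructor
    · refine LinearMap.ext fun p => ?_
      simp [commutator_apply]
    · intro u q
      simp
  | succ n ih =>
    intro α hα
    obtain ⟨k, hk⟩ : ∃ k, α k ≠ 0 := by
      by_contra! h
      obtain rfl : α = 0 := Finsupp.ext h
      simp at hα
    obtain ⟨β, rfl⟩ : ∃ β, α = Finsupp.single k 1 + β :=
      ⟨α - Finsupp.single k 1, by
        rw [add_tsub_cancel_of_le]
        simpa [Finsupp.single_le_iff] using Nat.one_le_iff_ne_zero.2 hk⟩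
    have hβ : β.degree = n := by
      rw [map_add, Finsupp.degree_single] at hα
      omega
    obtain ⟨h0, h1⟩ := ih β hβ
    have hm : monomial (Finsupp.single k 1 + β) (1 : ℂ) = X k * monomial β 1 := by
      rw [X, monomial_mul, one_mul]
    have hM : mulBy (monomial (Finsupp.single k 1 + β) (1 : ℂ)) =
        mulBy (X k) * mulBy (monomial β 1) := by
      rw [hm]
      exact LinearMap.mulLeft_mul ℂ (MvPolynomial σ ℂ) _ _
    have hX := commutator_laplace_X hτ k
    have hXX : commutator (laplace τ) (commutator (laplace τ) (mulBy (X k))) = 0 := by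
      rw [hX, map_smul, commutator_laplace_pderiv, smul_zero]
    have key := commutator_pow_succ_mul (laplace τ) (mulBy (X k)) (mulBy (monomial β 1)) hXX n
    rw [h0, mul_zero, zero_add, hX] at key
    constructor
    · rw [hM, pow_succ', Module.End.mul_apply, key, map_smul, commutator_mul, map_smul,
        commutator_laplace_pderiv, smul_zero, zero_mul, zero_add, ← Module.End.mul_apply,
        ← pow_succ', h0, mul_zero, smul_zero]
    · intro u q
      rw [hM, key]
      simp only [LinearMap.smul_apply, Module.End.mul_apply, map_smul, Derivation.coeFn_coe,
        smul_eq_mul]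
      rw [← fischer_X_mul, h1, hm, ← mul_assoc u, mul_comm u, pow_succ, Nat.factorial_succ]
      push_cast
      ring

/-- Iterated commutators of the Laplacian with multiplication by a homogeneous polynomial
realise the adjoint of multiplication in the Fischer pairing. -/
lemma fischer_commutator_pow {τ : σ ≃ σ} (hτ : ∀ k, τ (τ k) = k) {n : ℕ} {p : MvPolynomial σ ℂ}
    (hp : p.IsHomogeneous n) (u q : MvPolynomial σ ℂ) :
    fischer τ u ((commutator (laplace τ) ^ n) (mulBy p) q) =
      (2 ^ n * n.factorial : ℂ) * fischer τ (u * p) q := by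
  have hs : p = ∑ α ∈ p.support, coeff α p • monomial α (1 : ℂ) := by
    conv_lhs => rw [p.as_sum]
    simp [smul_monomial]
  have hM : mulBy p = ∑ α ∈ p.support, coeff α p • mulBy (monomial α (1 : ℂ)) := by
    refine LinearMap.ext fun r => ?_
    conv_lhs => rw [hs]
    simp [Finset.sum_mul, LinearMap.sum_apply]
  have hR : fischer τ (u * p) q =
      ∑ α ∈ p.support, coeff α p * fischer τ (u * monomial α 1) q := by
    conv_lhs => rw [hs]
    simp only [Finset.mul_sum, map_sum, LinearMap.sum_apply, mul_smul_comm, map_smul,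
      LinearMap.smul_apply, smul_eq_mul]
  rw [hM, hR, map_sum, LinearMap.sum_apply, map_sum, Finset.mul_sum]
  refine Finset.sum_congr rfl fun α hα => ?_
  rw [map_smul, LinearMap.smul_apply, map_smul, (commutator_pow_monomial hτ n α ?_).2]
  · simp only [smul_eq_mul]; ring
  · rw [Finsupp.degree_eq_weight_one (R := ℕ)]
    exact hp (mem_support_iff.1 hα)

lemma fischer_eq_zero_of_degree {τ : σ ≃ σ} {m n : ℕ} (hmn : m ≠ n) {p q : MvPolynomial σ ℂ}
    (hp : p.IsHomogeneous m) (hq : q.IsHomogeneous n) : fischer τ p q = 0 := by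
  rw [p.as_sum, map_sum, LinearMap.sum_apply]
  refine Finset.sum_eq_zero fun α hα => ?_
  rw [fischer_monomial, hq.coeff_eq_zero, mul_zero, mul_zero]
  have h : α.degree = m := by
    rw [Finsupp.degree_eq_weight_one (R := ℕ)]
    exact hp (mem_support_iff.1 hα)
  have : (Finsupp.equivMapDomain τ α).degree = α.degree := by
    rw [Finsupp.degree_eq_sum, Finsupp.degree_eq_sum]
    exact Fintype.sum_equiv τ.symm _ _ fun i => by simp [Finsupp.equivMapDomain_apply]
  omega

lemma eq_C_of_fischer {τ : σ ≃ σ} {q : MvPolynomial σ ℂ}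
    (h : ∀ α : σ →₀ ℕ, α ≠ 0 → fischer τ (monomial α 1) q = 0) : q = C (fischer τ 1 q) := by
  ext α
  have h0 : fischer τ 1 q = coeff 0 q := by
    have := fischer_monomial τ 0 1 q
    simpa using this
  rw [coeff_C, h0]
  split_ifs with hα
  · rw [← hα]
  · have h1 := h (α.equivMapDomain τ.symm) (fun h2 => hα (by
      ext j
      have := DFunLike.congr_fun h2 (τ.symm j)
      simp [Finsupp.equivMapDomain_apply] at this
      simp [this]))
    rw [fischer_monomial] at h1
    have h3 : Finsupp.equivMapDomain τ (Finsupp.equivMapDomain τ.symm α) = α := by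
      ext; simp [Finsupp.equivMapDomain_apply]
    rw [h3, one_mul] at h1
    exact (mul_eq_zero.1 h1).resolve_left
      (Finset.prod_ne_zero_iff.2 fun k _ => by exact_mod_cast Nat.factorial_ne_zero _)

end Fischer

section Radial

open MvPolynomial

variable {N : ℕ}

/-- Polynomial functions on `N × N` matrices. -/
abbrev MatPoly (N : ℕ) := MvPolynomial (Fin N × Fin N) ℂ

lemma derivation_sum_apply {ι R : Type*} [CommRing R] [Algebra ℂ R] (s : Finset ι)
    (D : ι → Derivation ℂ R R) (q : R) : (∑ i ∈ s, D i) q = ∑ i ∈ s, D i q := by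
  have h := congrFun (map_sum Derivation.coeFnAddMonoidHom D s) q
  rwa [Finset.sum_apply] at h

lemma pderiv_X_pair (a b c d : Fin N) :
    pderiv (a, b) (X (c, d) : MatPoly N) = if c = a then if d = b then 1 else 0 else 0 := by
  rw [pderiv_X, Pi.single_apply]
  by_cases h : c = a <;> by_cases h' : d = b <;> simp [h, h']

/-- The infinitesimal action of conjugation by `1 + tE_{ij}`. -/
def rot (i j : Fin N) : Derivation ℂ (MatPoly N) (MatPoly N) :=
  ∑ l, (X (j, l) : MatPoly N) • pderiv (i, l) - ∑ k, (X (k, i) : MatPoly N) • pderiv (k, j)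

lemma rot_apply (i j : Fin N) (q : MatPoly N) :
    rot i j q = ∑ l, X (j, l) * pderiv (i, l) q - ∑ k, X (k, i) * pderiv (k, j) q := by
  simp only [rot, Derivation.sub_apply, derivation_sum_apply, Derivation.smul_apply,
    smul_eq_mul]

/-- The polynomials annihilated by all infinitesimal conjugations. -/
def invariants (N : ℕ) : Subalgebra ℂ (MatPoly N) where
  carrier := {q | ∀ i j, rot i j q = 0}
  mul_mem' := fun ha hb i j => by
    rw [Derivation.leibniz, ha i j, hb i j, smul_zero, smul_zero, add_zero]
  add_mem' := fun ha hb i j => by rw [map_add, ha i j, hb i j, add_zero]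
  algebraMap_mem' := fun r i j => by simp

/-- The generic matrix. -/
abbrev genMat (N : ℕ) : Matrix (Fin N) (Fin N) (MatPoly N) := mvPolynomialX (Fin N) (Fin N) ℂ

lemma rot_X (i j a b : Fin N) : rot i j (X (a, b)) =
    (Matrix.single i j (1 : MatPoly N) * genMat N - genMat N * Matrix.single i j 1 :
      Matrix (Fin N) (Fin N) (MatPoly N)) a b := by
  rw [rot_apply, Matrix.sub_apply, Matrix.mul_apply, Matrix.mul_apply]
  simp only [pderiv_X_pair, mul_ite, mul_one, mul_zero, Matrix.single_apply, ite_and,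
    mvPolynomialX_apply, ite_mul, one_mul, zero_mul]
  simp [eq_comm (a := i), eq_comm (a := j)]

lemma derivation_pow_apply {R : Type*} [CommRing R] [Algebra ℂ R] (D : Derivation ℂ R R)
    {E M : Matrix (Fin N) (Fin N) R} (h : ∀ a b, D (M a b) = (E * M - M * E) a b) (k : ℕ) :
    ∀ a b, D ((M ^ k) a b) = (E * M ^ k - M ^ k * E) a b := by
  induction k with
  | zero =>
    intro a b
    rw [pow_zero, Matrix.one_apply]
    split_ifs <;> simp
  | succ k ih =>
    intro a b
    have e : E * M ^ (k + 1) - M ^ (k + 1) * E =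
        M ^ k * (E * M - M * E) + (E * M ^ k - M ^ k * E) * M := by
      rw [pow_succ]; noncomm_ring
    rw [e, pow_succ, Matrix.mul_apply, map_sum, Matrix.add_apply, Matrix.mul_apply,
      Matrix.mul_apply, ← Finset.sum_add_distrib]
    refine Finset.sum_congr rfl fun c _ => ?_
    rw [Derivation.leibniz, ih, h, smul_eq_mul, smul_eq_mul, mul_comm (M c b)]

lemma trace_genMat_pow_mem (m : ℕ) : (genMat N ^ m).trace ∈ invariants N := by
  intro i j
  rw [Matrix.trace, map_sum]
  simp only [Matrix.diag_apply]
  have h : ∀ a b, rot i j ((genMat N) a b) =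
      (Matrix.single i j (1 : MatPoly N) * genMat N - genMat N * Matrix.single i j 1 :
        Matrix (Fin N) (Fin N) (MatPoly N)) a b := fun a b => by
    exact rot_X i j a b
  rw [Finset.sum_congr rfl fun a _ => derivation_pow_apply (rot i j) h m a a]
  change Matrix.trace _ = 0
  rw [Matrix.trace_sub, Matrix.trace_mul_comm, sub_self]

lemma schurOver_genMat_mem (l : Fin N → ℕ) : schurOver l (genMat N) ∈ invariants N :=
  schurOver_mem _ _ (fun m => trace_genMat_pow_mem (m + 1)) l

lemma pderiv_rot (a b i j : Fin N) (q : MatPoly N) :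
    pderiv (a, b) (rot i j q) = rot i j (pderiv (a, b) q) +
      (if a = j then pderiv (i, b) q else 0) - (if b = i then pderiv (a, j) q else 0) := by
  have h1 : ∀ l, pderiv (a, b) (X (j, l) * pderiv (i, l) q) =
      X (j, l) * pderiv (i, l) (pderiv (a, b) q) +
        if l = b then (if a = j then pderiv (i, b) q else 0) else 0 := by
    intro l
    rw [pderiv_mul, pderiv_comm (a, b), add_comm]
    congr 1
    rw [pderiv_X_pair]
    by_cases h1 : l = b <;> by_cases h2 : a = j <;> simp [h1, h2, eq_comm (a := j)]
  have h2 : ∀ k, pderiv (a, b) (X (k, i) * pderiv (k, j) q) =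
      X (k, i) * pderiv (k, j) (pderiv (a, b) q) +
        if k = a then (if b = i then pderiv (a, j) q else 0) else 0 := by
    intro k
    rw [pderiv_mul, pderiv_comm (a, b), add_comm]
    congr 1
    rw [pderiv_X_pair]
    by_cases h1 : k = a <;> by_cases h2 : b = i <;> simp [h1, h2, eq_comm (a := i)]
  rw [rot_apply, rot_apply, map_sub, map_sum, map_sum, Finset.sum_congr rfl fun l _ => h1 l,
    Finset.sum_congr rfl fun l _ => h2 l, Finset.sum_add_distrib, Finset.sum_add_distrib,
    Finset.sum_ite_eq' , Finset.sum_ite_eq', if_pos (Finset.mem_univ _),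
    if_pos (Finset.mem_univ _)]
  ring

/-- Transposition of matrix coordinates. -/
abbrev transp (N : ℕ) : Fin N × Fin N ≃ Fin N × Fin N := Equiv.prodComm (Fin N) (Fin N)

lemma transp_transp (k : Fin N × Fin N) : transp N (transp N k) = k := rfl

lemma laplace_transp_apply (q : MatPoly N) :
    laplace (transp N) q = ∑ a, ∑ b, pderiv (a, b) (pderiv (b, a) q) := by
  rw [laplace_apply, Fintype.sum_prod_type]
  rfl

lemma laplace_mem_invariants {q : MatPoly N} (hq : q ∈ invariants N) :
    laplace (transp N) q ∈ invariants N := by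
  intro i j
  have h1 : ∀ a b, rot i j (pderiv (a, b) q) =
      (if b = i then pderiv (a, j) q else 0) - (if a = j then pderiv (i, b) q else 0) := by
    intro a b
    have := pderiv_rot a b i j q
    rw [hq i j, map_zero] at this
    linear_combination -this
  have h2 : ∀ a b, rot i j (pderiv (a, b) (pderiv (b, a) q)) =
      (if a = i then pderiv (i, b) (pderiv (b, j) q) else 0)
      - (if b = j then pderiv (a, j) (pderiv (i, a) q) else 0)
      - (if a = j then pderiv (i, b) (pderiv (b, j) q) else 0)
      + (if b = i then pderiv (a, j) (pderiv (i, a) q) else 0) := by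
    intro a b
    have := pderiv_rot a b i j (pderiv (b, a) q)
    rw [h1, map_sub, apply_ite (pderiv (a, b)), apply_ite (pderiv (a, b)), map_zero] at this
    have e1 : (if a = i then pderiv (a, b) (pderiv (b, j) q) else 0) =
      (if a = i then pderiv (i, b) (pderiv (b, j) q) else 0) := by
      split_ifs with h <;> simp [h]
    have e2 : (if b = j then pderiv (a, b) (pderiv (i, a) q) else 0) =
      (if b = j then pderiv (a, j) (pderiv (i, a) q) else 0) := by
      split_ifs with h <;> simp [h]
    have e3 : (if a = j then pderiv (i, b) (pderiv (b, a) q) else 0) =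
      (if a = j then pderiv (i, b) (pderiv (b, j) q) else 0) := by
      split_ifs with h <;> simp [h]
    have e4 : (if b = i then pderiv (a, j) (pderiv (b, a) q) else 0) =
      (if b = i then pderiv (a, j) (pderiv (i, a) q) else 0) := by
      split_ifs with h <;> simp [h]
    rw [e1, e2, e3, e4] at this
    linear_combination -this
  rw [laplace_transp_apply, map_sum, Finset.sum_congr rfl fun a _ => map_sum _ _ _]
  simp only [h2, Finset.sum_add_distrib, Finset.sum_sub_distrib]
  simp only [Finset.sum_ite_eq', Finset.mem_univ, if_true, Finset.sum_ite_irrel,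
    Finset.sum_const_zero]
  ring

/-- Restriction of polynomials to diagonal matrices. -/
def diagRestrict (N : ℕ) : MatPoly N →ₐ[ℂ] MvPolynomial (Fin N) ℂ :=
  aeval fun k => if k.1 = k.2 then X k.1 else 0

lemma diagRestrict_X (a b : Fin N) :
    diagRestrict N (X (a, b)) = if a = b then X a else 0 := by
  simp [diagRestrict]

lemma pderiv_diagRestrict (i : Fin N) (q : MatPoly N) :
    pderiv i (diagRestrict N q) = diagRestrict N (pderiv (i, i) q) := by
  induction q using MvPolynomial.induction_on with
  | C a => simp [diagRestrict]
  | add p q hp hq => simp [hp, hq]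
  | mul_X p k h =>
    obtain ⟨a, b⟩ := k
    rw [map_mul, pderiv_mul, pderiv_mul, map_add, map_mul, map_mul, h, diagRestrict_X]
    congr 2
    rw [pderiv_X_pair]
    by_cases h1 : a = b
    · subst h1
      rw [if_pos rfl, pderiv_X, Pi.single_apply]
      by_cases h2 : a = i <;> simp [h2]
    · rw [if_neg h1, map_zero, ← ite_and, if_neg, map_zero]
      rintro ⟨rfl, rfl⟩
      exact h1 rfl

lemma diagRestrict_offdiag {q : MatPoly N} (hq : q ∈ invariants N) (i j : Fin N) :
    (X i - X j) * diagRestrict N (pderiv (i, j) (pderiv (j, i) q)) =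
      pderiv i (diagRestrict N q) - pderiv j (diagRestrict N q) := by
  have h := pderiv_rot j i i j q
  rw [hq i j, map_zero, if_pos rfl, if_pos rfl] at h
  have h2 := congrArg (diagRestrict N) h
  rw [map_zero, map_sub, map_add, rot_apply, map_sub, map_sum, map_sum] at h2
  simp only [map_mul, diagRestrict_X, ite_mul, zero_mul] at h2
  rw [Finset.sum_ite_eq, Finset.sum_ite_eq', if_pos (Finset.mem_univ _),
    if_pos (Finset.mem_univ _), ← pderiv_diagRestrict, ← pderiv_diagRestrict] at h2
  linear_combination h2

end Radial

section Alternants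

open MvPolynomial

variable {N : ℕ}

/-- The alternant `a_l` as a polynomial. -/
def altPoly (l : Fin N → ℕ) : MvPolynomial (Fin N) ℂ := alternant l X

/-- The exponent vector `l ∘ σ⁻¹`. -/
def permExp (l : Fin N → ℕ) (σ : Equiv.Perm (Fin N)) : Fin N →₀ ℕ :=
  Finsupp.equivFunOnFinite.symm fun i => l (σ.symm i)

@[simp]
lemma permExp_apply (l : Fin N → ℕ) (σ : Equiv.Perm (Fin N)) (i : Fin N) :
    permExp l σ i = l (σ.symm i) := rfl

lemma altPoly_eq_sum (l : Fin N → ℕ) : altPoly l =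
    ∑ σ : Equiv.Perm (Fin N), monomial (permExp l σ) ((Equiv.Perm.sign σ : ℤ) : ℂ) := by
  rw [altPoly, alternant, Matrix.det_apply']
  refine Finset.sum_congr rfl fun σ _ => ?_
  have h : monomial (permExp l σ) (1 : ℂ) = ∏ i, (X (σ i) : MvPolynomial (Fin N) ℂ) ^ l i := by
    rw [monomial_eq, C_1, one_mul, Finsupp.prod_fintype _ _ (fun i => pow_zero _),
      ← Equiv.prod_comp σ]
    simp
  have h2 : monomial (permExp l σ) ((Equiv.Perm.sign σ : ℤ) : ℂ) =
      C ((Equiv.Perm.sign σ : ℤ) : ℂ) * monomial (permExp l σ) (1 : ℂ) := by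
    rw [C_mul_monomial, mul_one]
  rw [h2, h]
  simp

lemma altPoly_eq_zero {l : Fin N → ℕ} (h : ¬ Function.Injective l) : altPoly l = 0 := by
  simp only [Function.Injective, not_forall] at h
  obtain ⟨i, j, hij, hne⟩ := h
  exact Matrix.det_zero_of_column_eq hne fun k => by simp [hij]

lemma altPoly_comp_perm (l : Fin N → ℕ) (w : Equiv.Perm (Fin N)) :
    altPoly (l ∘ w) = ((Equiv.Perm.sign w : ℤ) : MvPolynomial (Fin N) ℂ) * altPoly l := by
  rw [altPoly, altPoly, alternant, alternant, ← Matrix.det_permute']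
  rfl

lemma laplace_altPoly (l : Fin N → ℕ) : laplace (Equiv.refl (Fin N)) (altPoly l) =
    ∑ c, C ((l c : ℂ) * ((l c - 1 : ℕ) : ℂ)) * altPoly (Function.update l c (l c - 2)) := by
  simp only [altPoly_eq_sum, map_sum, Finset.mul_sum]
  rw [Finset.sum_comm]
  refine Finset.sum_congr rfl fun σ _ => ?_
  rw [laplace_apply, ← Equiv.sum_comp σ]
  refine Finset.sum_congr rfl fun c _ => ?_
  rw [Equiv.refl_apply, pderiv_monomial, pderiv_monomial, C_mul_monomial]
  refine congrArg₂ (fun a b => monomial a b) ?_ ?_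
  · ext i
    by_cases h : σ.symm i = c
    · subst h; simp [Nat.sub_sub]
    · have h' : σ c ≠ i := fun h2 => h (by rw [← h2, Equiv.symm_apply_apply])
      simp [h, h']
  · simp
    ring

lemma laplace_altPoly_staircase :
    laplace (Equiv.refl (Fin N)) (altPoly (staircase N)) = 0 := by
  rw [laplace_altPoly]
  refine Finset.sum_eq_zero fun c _ => ?_
  by_cases h : 2 ≤ staircase N c
  · rw [altPoly_eq_zero, mul_zero]
    intro hi
    simp only [staircase] at h hi
    have h1 := @hi c ⟨c + 2, by omega⟩ (by
      rw [Function.update_self, Function.update_of_ne]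
      · change N - 1 - c - 2 = N - 1 - (c + 2); omega
      · simp [Fin.ext_iff])
    simp [Fin.ext_iff] at h1
  · have : staircase N c = 0 ∨ staircase N c - 1 = 0 := by omega
    rcases this with h | h <;> simp [h]

lemma altPoly_staircase_eq : altPoly (staircase N) =
    ((Equiv.Perm.sign (Fin.revPerm : Equiv.Perm (Fin N)) : ℤ) : MvPolynomial (Fin N) ℂ) *
      ∏ i : Fin N, ∏ j ∈ Finset.Ioi i, (X j - X i) := by
  rw [← Matrix.det_vandermonde, ← Matrix.det_permute', altPoly, alternant]
  congr 1
  ext1 i j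
  simp only [Matrix.of_apply, Matrix.submatrix_apply, Matrix.vandermonde_apply, staircase, id,
    Fin.revPerm_apply, Fin.val_rev]
  congr 1
  omega

lemma altPoly_staircase_ne_zero : altPoly (staircase N) ≠ 0 := by
  rw [altPoly_staircase_eq]
  refine mul_ne_zero ?_ ?_
  · rcases Int.units_eq_one_or (Equiv.Perm.sign (Fin.revPerm : Equiv.Perm (Fin N))) with h | h <;>
      simp [h]
  · refine Finset.prod_ne_zero_iff.2 fun i _ => Finset.prod_ne_zero_iff.2 fun j hj => ?_
    rw [sub_ne_zero]
    intro h
    exact (Finset.mem_Ioi.1 hj).ne' (X_injective h)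

lemma derivation_prod {ι R : Type*} [CommRing R] [Algebra ℂ R] (D : Derivation ℂ R R)
    (s : Finset ι) (f r : ι → R) (h : ∀ p ∈ s, D (f p) = f p * r p) :
    D (∏ p ∈ s, f p) = (∏ p ∈ s, f p) * ∑ p ∈ s, r p := by
  induction s using Finset.induction_on with
  | empty => simp
  | insert a s ha ih =>
    rw [Finset.prod_insert ha, Finset.sum_insert ha, Derivation.leibniz,
      ih fun p hp => h p (Finset.mem_insert_of_mem hp), h a (Finset.mem_insert_self _ _)]
    simp only [smul_eq_mul]
    ring

/-- The derivation `u ↦ ⟨∇φ, ∇u⟩`. -/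
def gradDer (φ : MvPolynomial (Fin N) ℂ) :
    Derivation ℂ (MvPolynomial (Fin N) ℂ) (MvPolynomial (Fin N) ℂ) :=
  ∑ k, pderiv k φ • pderiv k

lemma gradDer_apply (φ u : MvPolynomial (Fin N) ℂ) :
    gradDer φ u = ∑ k, pderiv k φ * pderiv k u := by
  rw [gradDer, derivation_sum_apply]; rfl

lemma gradDer_X (φ : MvPolynomial (Fin N) ℂ) (i : Fin N) : gradDer φ (X i) = pderiv i φ := by
  rw [gradDer_apply]
  simp [pderiv_X, Pi.single_apply]

lemma laplace_refl_mul (u φ : MvPolynomial (Fin N) ℂ) :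
    laplace (Equiv.refl (Fin N)) (u * φ) =
      u * laplace (Equiv.refl (Fin N)) φ + 2 * gradDer φ u +
        φ * laplace (Equiv.refl (Fin N)) u := by
  simp only [laplace_apply, gradDer_apply, Finset.mul_sum, ← Finset.sum_add_distrib]
  refine Finset.sum_congr rfl fun k _ => ?_
  simp only [Equiv.refl_apply, pderiv_mul, map_add]
  ring

lemma diagRestrict_laplace {q : MatPoly N} (hq : q ∈ invariants N) :
    altPoly (staircase N) * diagRestrict N (laplace (transp N) q) =
      laplace (Equiv.refl (Fin N)) (altPoly (staircase N) * diagRestrict N q) := by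
  set φ := diagRestrict N q with hφ
  set r : Fin N → Fin N → MvPolynomial (Fin N) ℂ :=
    fun i j => diagRestrict N (pderiv (i, j) (pderiv (j, i) q)) with hr
  have hgrad : gradDer φ (altPoly (staircase N)) =
      altPoly (staircase N) * ∑ i, ∑ j ∈ Finset.Ioi i, r j i := by
    have h1 : ∀ i j, gradDer φ (X j - X i) = (X j - X i) * r j i := fun i j => by
      rw [map_sub, gradDer_X, gradDer_X, hr, hφ]
      exact (diagRestrict_offdiag hq j i).symm
    have h2 := derivation_prod (gradDer φ) Finset.univ
      (fun i : Fin N => ∏ j ∈ Finset.Ioi i, (X j - X i)) (fun i => ∑ j ∈ Finset.Ioi i, r j i)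
      (fun i _ => derivation_prod (gradDer φ) _ _ _ fun j _ => h1 i j)
    rw [altPoly_staircase_eq, Derivation.leibniz, h2]
    simp only [Derivation.map_intCast, smul_eq_mul, mul_zero, add_zero, mul_assoc]
  have hsum : diagRestrict N (laplace (transp N) q) =
      laplace (Equiv.refl (Fin N)) φ + 2 * ∑ i, ∑ j ∈ Finset.Ioi i, r j i := by
    have hdiag : ∀ i, r i i = pderiv i (pderiv i φ) := fun i => by
      rw [hr, hφ, pderiv_diagRestrict, pderiv_diagRestrict]
    have hsymm : ∀ i j, r i j = r j i := fun i j => by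
      rw [hr]
      dsimp only
      rw [pderiv_comm]
    have hIoi : ∀ i : Fin N, (Finset.univ : Finset (Fin N)) =
        insert i (Finset.Iio i ∪ Finset.Ioi i) := fun i => by
      ext j
      simpa using or_left_comm.1 (lt_trichotomy j i)
    have hrow : ∀ i, ∑ j, r i j = r i i + (∑ j ∈ Finset.Iio i, r i j + ∑ j ∈ Finset.Ioi i, r i j) := by
      intro i
      nth_rw 1 [hIoi i]
      rw [Finset.sum_insert (by simp), Finset.sum_union]
      rw [Finset.disjoint_left]
      intro j h1 h2
      exact lt_asymm (Finset.mem_Iio.1 h1) (Finset.mem_Ioi.1 h2)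
    have hswap : ∑ i, ∑ j ∈ Finset.Iio i, r i j = ∑ i, ∑ j ∈ Finset.Ioi i, r j i := by
      rw [Finset.sum_comm' (t' := Finset.univ) (s' := fun j => Finset.Ioi j)]
      intro x y; simp
    rw [laplace_transp_apply, laplace_apply]
    simp only [map_sum]
    change ∑ i, ∑ j, r i j = _
    simp only [hrow, Finset.sum_add_distrib, hdiag, hswap, Equiv.refl_apply]
    rw [Finset.sum_congr rfl fun i _ => Finset.sum_congr rfl fun j _ => hsymm i j]
    ring
  rw [laplace_refl_mul, hgrad, laplace_altPoly_staircase, hsum]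
  ring

/-- The radial part of iterated commutators with the Laplacian. -/
lemma radial_commutator {p : MatPoly N} (hp : p ∈ invariants N) (n : ℕ) :
    ∀ q ∈ invariants N, (commutator (laplace (transp N)) ^ n) (mulBy p) q ∈ invariants N ∧
      altPoly (staircase N) *
        diagRestrict N ((commutator (laplace (transp N)) ^ n) (mulBy p) q) =
      (commutator (laplace (Equiv.refl (Fin N))) ^ n) (mulBy (diagRestrict N p))
        (altPoly (staircase N) * diagRestrict N q) := by
  induction n with
  | zero =>
    intro q hq
    simp only [pow_zero, Module.End.one_apply]
    refine ⟨Subalgebra.mul_mem _ hp hq, ?_⟩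
    simp
    ring
  | succ n ih =>
    intro q hq
    have hL := laplace_mem_invariants hq
    obtain ⟨i1, i2⟩ := ih q hq
    obtain ⟨j1, j2⟩ := ih _ hL
    rw [pow_succ', pow_succ', Module.End.mul_apply, Module.End.mul_apply, commutator_apply,
      commutator_apply]
    simp only [LinearMap.sub_apply, Module.End.mul_apply]
    refine ⟨Subalgebra.sub_mem _ (laplace_mem_invariants i1) j1, ?_⟩
    rw [map_sub, mul_sub, j2, diagRestrict_laplace i1, diagRestrict_laplace hq, i2]

end Alternants

section Pairing

open MvPolynomial

variable {N : ℕ}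

section Homogeneous

variable {σ : Type*}

lemma isHomogeneous_matrix_pow {M : Matrix (Fin N) (Fin N) (MvPolynomial σ ℂ)}
    (h : ∀ i j, (M i j).IsHomogeneous 1) (k : ℕ) : ∀ i j, ((M ^ k) i j).IsHomogeneous k := by
  induction k with
  | zero =>
    intro i j
    rw [pow_zero, Matrix.one_apply]
    split_ifs
    · exact isHomogeneous_one _ _
    · exact isHomogeneous_zero _ _ _
  | succ k ih =>
    intro i j
    rw [pow_succ, Matrix.mul_apply]
    exact IsHomogeneous.sum _ _ _ fun l _ => (ih i l).mul (h l j)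

lemma isHomogeneous_hMatOver {M : Matrix (Fin N) (Fin N) (MvPolynomial σ ℂ)}
    (h : ∀ i j, (M i j).IsHomogeneous 1) (k : ℕ) : (hMatOver M k).IsHomogeneous k := by
  induction k using Nat.strong_induction_on with
  | _ k ih =>
    cases k with
    | zero => rw [hMatOver_zero]; exact isHomogeneous_one _ _
    | succ k =>
      rw [hMatOver_succ, algebraMap_eq]
      refine IsHomogeneous.C_mul (IsHomogeneous.sum _ _ _ fun m hm => ?_) _
      have hm' := Finset.mem_range.1 hm
      have e : k + 1 = (m + 1) + (k - m) := by omega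
      rw [e]
      refine IsHomogeneous.mul ?_ (ih (k - m) (by omega))
      exact IsHomogeneous.sum _ _ _ fun i _ => isHomogeneous_matrix_pow h (m + 1) i i

lemma isHomogeneous_schurOver {M : Matrix (Fin N) (Fin N) (MvPolynomial σ ℂ)}
    (h : ∀ i j, (M i j).IsHomogeneous 1) (l : Fin N → ℕ) :
    (schurOver l M).IsHomogeneous (∑ i, l i) := by
  rw [schurOver, Matrix.det_apply']
  refine IsHomogeneous.sum _ _ _ fun w _ => ?_
  have hC : (((Equiv.Perm.sign w : ℤ) : MvPolynomial σ ℂ)) =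
      C ((Equiv.Perm.sign w : ℤ) : ℂ) := by simp
  rw [hC]
  refine IsHomogeneous.C_mul ?_ _
  simp only [Matrix.of_apply]
  by_cases hneg : ∃ i, ((l (w i) : ℤ) - (w i : ℤ) + (i : ℤ)) < 0
  · obtain ⟨i, hi⟩ := hneg
    rw [Finset.prod_eq_zero (Finset.mem_univ i)]
    · exact isHomogeneous_zero _ _ _
    · rw [hMatZOver, if_pos hi]
  · push Not at hneg
    have e : ∑ i, l i = ∑ i, ((l (w i) : ℤ) - (w i : ℤ) + (i : ℤ)).toNat := by
      zify
      rw [Finset.sum_congr rfl fun i _ => Int.toNat_of_nonneg (hneg i), Finset.sum_add_distrib,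
        Finset.sum_sub_distrib, Equiv.sum_comp w fun i => (l i : ℤ),
        Equiv.sum_comp w fun i => ((i : ℕ) : ℤ)]
      ring
    rw [e]
    refine IsHomogeneous.prod _ _ _ fun i _ => ?_
    rw [hMatZOver, if_neg (not_lt.2 (hneg i))]
    exact isHomogeneous_hMatOver h _

end Homogeneous

/-- The Schur polynomial on generic matrices. -/
def schurPoly (l : Fin N → ℕ) : MatPoly N := schurOver l (genMat N)

lemma schurPoly_isHomogeneous (l : Fin N → ℕ) : (schurPoly l).IsHomogeneous (∑ i, l i) :=
  isHomogeneous_schurOver (fun _ _ => isHomogeneous_X _ _) l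

lemma eval_schurPoly (l : Fin N → ℕ) (B : Matrix (Fin N) (Fin N) ℂ) :
    aeval (fun k : Fin N × Fin N => B k.1 k.2) (schurPoly l) = schur l B := by
  rw [schurPoly, schurOver_map, ← schurOver_eq_schur]
  congr 1
  ext i j
  simp [AlgHom.mapMatrix_apply, genMat]

lemma diagRestrict_schurPoly (l : Fin N → ℕ) :
    diagRestrict N (schurPoly l) = schurOver l (Matrix.diagonal X) := by
  rw [schurPoly, schurOver_map]
  congr 1
  ext1 i j
  rw [AlgHom.mapMatrix_apply, Matrix.map_apply]
  exact (diagRestrict_X i j).trans (Matrix.diagonal_apply _ _ _).symm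

lemma diagRestrict_schurPoly_isHomogeneous (l : Fin N → ℕ) :
    (diagRestrict N (schurPoly l)).IsHomogeneous (∑ i, l i) := by
  rw [diagRestrict_schurPoly]
  refine isHomogeneous_schurOver (fun i j => ?_) l
  rw [Matrix.diagonal_apply]
  split_ifs
  · exact isHomogeneous_X _ _
  · exact isHomogeneous_zero _ _ _

lemma altPoly_mul_schurPoly (l : Fin N → ℕ) :
    altPoly (staircase N) * diagRestrict N (schurPoly l) =
      altPoly (fun j => l j + staircase N j) := by
  rw [diagRestrict_schurPoly, altPoly, altPoly, alternant_mul_schurOver]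

lemma perm_eq_of_strictAnti {l m : Fin N → ℕ} (hl : StrictAnti l) (hm : StrictAnti m)
    {σ τ : Equiv.Perm (Fin N)} (h : permExp m τ = permExp l σ) : σ = τ ∧ l = m := by
  have h1 : ∀ i, m ((σ.trans τ.symm) i) = l i := fun i => by
    have := DFunLike.congr_fun h (σ i)
    simpa using this
  let e : Fin N ≃o Fin N :=
    { σ.trans τ.symm with
      map_rel_iff' := fun {i j} => by
        rw [← hm.le_iff_ge, h1, h1, hl.le_iff_ge] }
  have he : e = OrderIso.refl _ := Subsingleton.elim _ _
  have h2 : ∀ i, τ.symm (σ i) = i := fun i => DFunLike.congr_fun he i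
  refine ⟨Equiv.ext fun i => by rw [← τ.symm_apply_eq, h2], funext fun i => ?_⟩
  rw [← h1 i]
  exact congrArg m (h2 i)

lemma fischer_altPoly {l m : Fin N → ℕ} (hl : StrictAnti l) (hm : StrictAnti m) :
    fischer (Equiv.refl (Fin N)) (altPoly l) (altPoly m) =
      if l = m then (N.factorial : ℂ) * ∏ i, ((l i).factorial : ℂ) else 0 := by
  rw [altPoly_eq_sum l, map_sum, LinearMap.sum_apply]
  have h : ∀ σ : Equiv.Perm (Fin N),
      fischer (Equiv.refl (Fin N)) (monomial (permExp l σ) ((Equiv.Perm.sign σ : ℤ) : ℂ))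
        (altPoly m) = if l = m then ∏ i, ((l i).factorial : ℂ) else 0 := by
    intro σ
    rw [fischer_monomial, Finsupp.equivMapDomain_refl, altPoly_eq_sum, coeff_sum]
    simp only [coeff_monomial]
    split_ifs with hlm
    · subst hlm
      rw [Finset.sum_eq_single σ]
      · rw [if_pos rfl, mul_left_comm, ← Int.cast_mul, ← Units.val_mul, Int.units_mul_self]
        simp only [permExp_apply, Units.val_one, Int.cast_one, mul_one]
        exact Equiv.prod_comp σ.symm fun i => ((l i).factorial : ℂ)
      · intro τ _ hτ
        exact if_neg fun h => hτ (perm_eq_of_strictAnti hl hl h).1.symm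
      · simp
    · rw [Finset.sum_eq_zero, mul_zero, mul_zero]
      intro τ _
      exact if_neg fun h => hlm (perm_eq_of_strictAnti hl hm h).2
  rw [Finset.sum_congr rfl fun σ _ => h σ]
  simp [Fintype.card_perm]

lemma strictAnti_staircase : StrictAnti (staircase N) := fun i j h => by
  have : (i : ℕ) < j := h
  simp only [staircase]
  omega

lemma strictAnti_add_staircase {l : Fin N → ℕ} (hl : Antitone l) :
    StrictAnti fun j => l j + staircase N j :=
  fun _ _ h => add_lt_add_of_le_of_lt (hl h.le) (strictAnti_staircase h)

lemma poch_mul_factorial (l : Fin N → ℕ) :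
    poch N l * ∏ i, ((staircase N i).factorial : ℂ) =
      ∏ i, ((l i + staircase N i).factorial : ℂ) := by
  rw [poch, ← Finset.prod_mul_distrib]
  refine Finset.prod_congr rfl fun i _ => ?_
  have hs : ((staircase N i : ℕ) : ℂ) = N - 1 - ((i : ℕ) : ℂ) := by
    rw [staircase, Nat.sub_sub, Nat.cast_sub (by omega)]; push_cast; ring
  induction l i with
  | zero => simp
  | succ k ih =>
    rw [Finset.prod_range_succ, mul_right_comm, ih, add_right_comm, Nat.factorial_succ]
    push_cast
    rw [hs]
    ring

lemma poch_ne_zero (l : Fin N → ℕ) : poch N l ≠ 0 := by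
  intro h
  have := poch_mul_factorial l
  rw [h, zero_mul] at this
  exact (Finset.prod_ne_zero_iff.2 fun i _ => Nat.cast_ne_zero.2 (Nat.factorial_ne_zero _)) this.symm

/-- Orthogonality of Schur polynomials on matrix space. -/
theorem fischer_schurPoly {l m : Fin N → ℕ} (hl : Antitone l) (hm : Antitone m) :
    fischer (transp N) (schurPoly l) (schurPoly m) = if l = m then poch N l else 0 := by
  by_cases hdeg : ∑ i, l i = ∑ i, m i
  swap
  · rw [fischer_eq_zero_of_degree hdeg (schurPoly_isHomogeneous l) (schurPoly_isHomogeneous m),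
      if_neg]
    rintro rfl
    exact hdeg rfl
  set n := ∑ i, l i with hn
  set W := (commutator (laplace (transp N)) ^ n) (mulBy (schurPoly l)) (schurPoly m) with hW
  have hpair := fischer_commutator_pow (τ := transp N) transp_transp (schurPoly_isHomogeneous l)
  have hWC : W = C (fischer (transp N) 1 W) := by
    refine eq_C_of_fischer fun α hα => ?_
    rw [hW, hpair, fischer_eq_zero_of_degree _ ((isHomogeneous_monomial 1 rfl).mul
      (schurPoly_isHomogeneous l)) (schurPoly_isHomogeneous m), mul_zero]
    rw [← hdeg, ← hn]
    have : α.degree ≠ 0 := fun h => hα ((Finsupp.degree_eq_zero_iff α).1 h)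
    omega
  have hrad := (radial_commutator (schurOver_genMat_mem l) n _ (schurOver_genMat_mem m)).2
  change altPoly (staircase N) * diagRestrict N W =
    (commutator (laplace (Equiv.refl (Fin N))) ^ n) (mulBy (diagRestrict N (schurPoly l)))
    (_ * diagRestrict N (schurPoly m)) at hrad
  have h2 := congrArg (fischer (Equiv.refl (Fin N)) (altPoly (staircase N))) hrad
  rw [fischer_commutator_pow (τ := Equiv.refl (Fin N)) (fun k => rfl)
    (diagRestrict_schurPoly_isHomogeneous l), altPoly_mul_schurPoly, altPoly_mul_schurPoly,
    fischer_altPoly (strictAnti_add_staircase hl) (strictAnti_add_staircase hm), hWC, hW, hpair,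
    one_mul, ← algebraMap_eq, AlgHom.commutes, mul_comm, ← Algebra.smul_def, map_smul,
    fischer_altPoly strictAnti_staircase strictAnti_staircase, if_pos rfl, smul_eq_mul,
    ← poch_mul_factorial, ← hn, mul_assoc] at h2
  have hne : (2 ^ n * n.factorial : ℂ) ≠ 0 :=
    mul_ne_zero (pow_ne_zero _ two_ne_zero) (Nat.cast_ne_zero.2 (Nat.factorial_ne_zero _))
  have h3 := mul_left_cancel₀ hne h2
  have hf : ((N.factorial : ℂ) * ∏ i, ((staircase N i).factorial : ℂ)) ≠ 0 :=
    mul_ne_zero (Nat.cast_ne_zero.2 (Nat.factorial_ne_zero _))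
      (Finset.prod_ne_zero_iff.2 fun i _ => Nat.cast_ne_zero.2 (Nat.factorial_ne_zero _))
  refine mul_right_cancel₀ hf (h3.trans ?_)
  have hiff : ((fun j => l j + staircase N j) = fun j => m j + staircase N j) ↔ l = m := by
    simp [_root_.funext_iff]
  simp only [hiff]
  split_ifs
  · ring
  · rw [zero_mul]

end Pairing

section ClassFunctions

open MvPolynomial

variable {N : ℕ}

lemma add_sub_le_of_strictAnti {m : Fin N → ℕ} (hm : StrictAnti m) {i j : Fin N} (h : i ≤ j) :
    m j + (j - i : ℕ) ≤ m i := by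
  obtain ⟨j, hj⟩ := j
  induction j with
  | zero =>
    have : i = ⟨0, hj⟩ := le_antisymm h (Fin.mk_le_mk.2 (Nat.zero_le _))
    subst this
    simp
  | succ k ih =>
    rcases h.lt_or_eq with h1 | h1
    · have h2 : i ≤ ⟨k, by omega⟩ := Nat.lt_succ_iff.1 h1
      have h3 := ih (by omega) h2
      have h4 : m ⟨k + 1, hj⟩ < m ⟨k, by omega⟩ := hm (Fin.mk_lt_mk.2 (Nat.lt_succ_self k))
      have h5 : (i : ℕ) ≤ k := h2
      simp only at h3 ⊢
      omega
    · subst h1; simp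

lemma exists_antitone_of_strictAnti {m : Fin N → ℕ} (hm : StrictAnti m) :
    ∃ l : Fin N → ℕ, Antitone l ∧ m = fun j => l j + staircase N j := by
  have hge : ∀ i, staircase N i ≤ m i := fun i => by
    have h := add_sub_le_of_strictAnti hm
      (show i ≤ ⟨N - 1, by have := i.2; omega⟩ from Nat.le_sub_one_of_lt i.2)
    simp only [staircase] at h ⊢
    omega
  refine ⟨fun j => m j - staircase N j, fun i j h => ?_, ?_⟩
  · have h1 := add_sub_le_of_strictAnti hm h
    have h2 := hge j
    have h3 : (i : ℕ) ≤ j := h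
    simp only [staircase] at h2 ⊢
    omega
  · funext j
    rw [Nat.sub_add_cancel (hge j)]

/-- The linear span of Schur polynomials on matrix space. -/
def schurSpan (N : ℕ) : Submodule ℂ (MatPoly N) :=
  Submodule.span ℂ (Set.range fun l : PartitionN N => schurPoly l.1)

/-- Diagonal restriction followed by multiplication by the Vandermonde alternant. -/
def altRestrict (N : ℕ) : MatPoly N →ₗ[ℂ] MvPolynomial (Fin N) ℂ :=
  LinearMap.mulLeft ℂ (altPoly (staircase N)) ∘ₗ (diagRestrict N).toLinearMap

lemma altRestrict_apply (q : MatPoly N) :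
    altRestrict N q = altPoly (staircase N) * diagRestrict N q := rfl

lemma altPoly_mem (l : Fin N → ℕ) : altPoly l ∈ (schurSpan N).map (altRestrict N) := by
  by_cases hl : Function.Injective l
  swap
  · rw [altPoly_eq_zero hl]; exact zero_mem _
  set w : Equiv.Perm (Fin N) := Fin.revPerm.trans (Tuple.sort l) with hw
  have hanti : StrictAnti (l ∘ w) := by
    have h1 : StrictMono (l ∘ Tuple.sort l) :=
      (Tuple.monotone_sort l).strictMono_of_injective (hl.comp (Tuple.sort l).injective)
    exact fun i j hij => h1 (Fin.rev_lt_rev.2 hij)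
  obtain ⟨m, hm, hlm⟩ := exists_antitone_of_strictAnti hanti
  have h2 : altPoly (l ∘ w) ∈ (schurSpan N).map (altRestrict N) := by
    rw [hlm, ← altPoly_mul_schurPoly]
    exact Submodule.mem_map_of_mem (Submodule.subset_span ⟨⟨m, hm⟩, rfl⟩)
  rw [altPoly_comp_perm] at h2
  rcases Int.units_eq_one_or (Equiv.Perm.sign w) with h | h
  · simpa [h] using h2
  · simpa [h] using h2

lemma antisymmetric_mem {p : MvPolynomial (Fin N) ℂ}
    (h : ∀ w : Equiv.Perm (Fin N), rename w p = C ((Equiv.Perm.sign w : ℤ) : ℂ) * p) :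
    p ∈ (schurSpan N).map (altRestrict N) := by
  set T : MvPolynomial (Fin N) ℂ →ₗ[ℂ] MvPolynomial (Fin N) ℂ :=
    ∑ w : Equiv.Perm (Fin N), ((Equiv.Perm.sign w : ℤ) : ℂ) • (rename w).toLinearMap with hT
  have hTapply : ∀ q, T q = ∑ w : Equiv.Perm (Fin N),
      C ((Equiv.Perm.sign w : ℤ) : ℂ) * rename w q := fun q => by
    rw [hT, LinearMap.sum_apply]
    refine Finset.sum_congr rfl fun w _ => ?_
    rw [LinearMap.smul_apply, smul_eq_C_mul]; rfl
  have hTmem : ∀ q, T q ∈ (schurSpan N).map (altRestrict N) := by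
    intro q
    induction q using MvPolynomial.induction_on' with
    | add a b ha hb => rw [map_add]; exact add_mem ha hb
    | monomial α c =>
      have : T (monomial α c) = c • altPoly α := by
        rw [hTapply, altPoly_eq_sum, Finset.smul_sum]
        refine Finset.sum_congr rfl fun w _ => ?_
        rw [rename_monomial, C_mul_monomial, smul_monomial, smul_eq_mul, mul_comm]
        congr 2
        rw [← Finsupp.equivMapDomain_eq_mapDomain]
        ext i
        rfl
      rw [this]
      exact Submodule.smul_mem _ _ (altPoly_mem _)
  have hp : T p = (N.factorial : ℂ) • p := by
    rw [hTapply, Finset.sum_congr rfl fun w _ => by rw [h w, ← mul_assoc, ← C_mul, ← Int.cast_mul,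
      ← Units.val_mul, Int.units_mul_self, Units.val_one, Int.cast_one, C_1, one_mul]]
    rw [Finset.sum_const, Finset.card_univ, Fintype.card_perm, Fintype.card_fin, Nat.cast_smul_eq_nsmul]
  have hf : (N.factorial : ℂ) ≠ 0 := Nat.cast_ne_zero.2 (Nat.factorial_ne_zero _)
  have h2 := Submodule.smul_mem _ (N.factorial : ℂ)⁻¹ (hTmem p)
  rwa [hp, smul_smul, inv_mul_cancel₀ hf, one_smul] at h2

/-- Evaluation of a matrix polynomial. -/
def evalMat (B : Matrix (Fin N) (Fin N) ℂ) : MatPoly N →ₐ[ℂ] ℂ :=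
  aeval fun k : Fin N × Fin N => B k.1 k.2

lemma evalMat_schurPoly (l : Fin N → ℕ) (B : Matrix (Fin N) (Fin N) ℂ) :
    evalMat B (schurPoly l) = schur l B := eval_schurPoly l B

lemma eval_diagRestrict (x : Fin N → ℂ) (q : MatPoly N) :
    eval x (diagRestrict N q) = evalMat (Matrix.diagonal x) q := by
  have h : (aeval x).comp (diagRestrict N) = evalMat (Matrix.diagonal x) := by
    refine MvPolynomial.algHom_ext fun k => ?_
    rw [AlgHom.comp_apply]
    obtain ⟨a, b⟩ := k
    rw [diagRestrict_X, evalMat, aeval_X]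
    by_cases hab : a = b <;> simp [hab]
  exact DFunLike.congr_fun h q

/-- Polynomials on matrix space which are invariant under unitary conjugation. -/
def IsClassPoly (q : MatPoly N) : Prop :=
  ∀ (U : UN N) (B : Matrix (Fin N) (Fin N) ℂ),
    evalMat ((U : Matrix (Fin N) (Fin N) ℂ) * B * star (U : Matrix (Fin N) (Fin N) ℂ)) q =
      evalMat B q

lemma permMatrix_conj_diagonal (w : Equiv.Perm (Fin N)) (x : Fin N → ℂ) :
    w.permMatrix ℂ * Matrix.diagonal x * star (w.permMatrix ℂ) = Matrix.diagonal (x ∘ w) := by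
  rw [Matrix.star_eq_conjTranspose, Matrix.conjTranspose_permMatrix, Equiv.Perm.permMatrix,
    Equiv.Perm.permMatrix, PEquiv.toMatrix_toPEquiv_mul, PEquiv.mul_toMatrix_toPEquiv]
  ext i j
  have h : (w⁻¹).symm j = w j := rfl
  simp [Matrix.diagonal_apply, h]

lemma permMatrix_mem_unitary (w : Equiv.Perm (Fin N)) :
    w.permMatrix ℂ ∈ Matrix.unitaryGroup (Fin N) ℂ := by
  rw [Matrix.mem_unitaryGroup_iff]
  have h := permMatrix_conj_diagonal w (fun _ => (1 : ℂ))
  rw [Matrix.diagonal_one, mul_one] at h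
  rw [h]
  exact Matrix.diagonal_one

lemma IsClassPoly.rename_diagRestrict {q : MatPoly N} (hq : IsClassPoly q)
    (w : Equiv.Perm (Fin N)) : rename w (diagRestrict N q) = diagRestrict N q := by
  refine MvPolynomial.funext fun x => ?_
  rw [eval_rename, eval_diagRestrict, eval_diagRestrict, ← permMatrix_conj_diagonal]
  exact hq ⟨_, permMatrix_mem_unitary w⟩ _

lemma rename_altPoly (l : Fin N → ℕ) (w : Equiv.Perm (Fin N)) :
    rename w (altPoly l) = C ((Equiv.Perm.sign w : ℤ) : ℂ) * altPoly l := by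
  have hC : (C ((Equiv.Perm.sign w : ℤ) : ℂ) : MvPolynomial (Fin N) ℂ) =
      ((Equiv.Perm.sign w : ℤ) : MvPolynomial (Fin N) ℂ) := by simp
  rw [hC, altPoly, alternant, ← Matrix.det_permute, AlgHom.map_det]
  congr 1
  ext1 i j
  simp [AlgHom.mapMatrix_apply]

lemma isClassPoly_schurPoly (l : Fin N → ℕ) : IsClassPoly (schurPoly l) := fun U B => by
  rw [evalMat_schurPoly, evalMat_schurPoly, ← schurOver_eq_schur, ← schurOver_eq_schur]
  exact schurOver_conj (Matrix.mem_unitaryGroup_iff'.1 U.2) B l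

lemma isClassPoly_of_mem {q : MatPoly N} (hq : q ∈ schurSpan N) : IsClassPoly q := by
  intro U B
  induction hq using Submodule.span_induction with
  | mem x hx => obtain ⟨l, rfl⟩ := hx; exact isClassPoly_schurPoly l.1 U B
  | zero => simp
  | add x y _ _ hx hy => rw [map_add, map_add, hx, hy]
  | smul a x _ hx => rw [map_smul, map_smul, hx]

lemma eq_zero_of_hermitian {q : MatPoly N}
    (h : ∀ H : Matrix (Fin N) (Fin N) ℂ, H.IsHermitian → evalMat H q = 0) : q = 0 := by
  refine MvPolynomial.funext fun x => ?_
  set B : Matrix (Fin N) (Fin N) ℂ := Matrix.of fun i j => x (i, j) with hB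
  have hx : eval x q = evalMat B q := rfl
  rw [hx, map_zero]
  set H₁ : Matrix (Fin N) (Fin N) ℂ := (1 / 2 : ℂ) • (B + Bᴴ) with hH₁
  set H₂ : Matrix (Fin N) (Fin N) ℂ := (-Complex.I / 2 : ℂ) • (B - Bᴴ) with hH₂
  have hdec : H₁ + Complex.I • H₂ = B := by
    rw [hH₁, hH₂, smul_smul]
    have : Complex.I * (-Complex.I / 2) = 1 / 2 := by
      linear_combination (-1 / 2 : ℂ) * Complex.I_mul_I
    rw [this]
    module
  have hherm : ∀ t : ℝ, (H₁ + (t : ℂ) • H₂).IsHermitian := by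
    intro t
    rw [Matrix.IsHermitian, hH₁, hH₂]
    simp only [Matrix.conjTranspose_add, Matrix.conjTranspose_smul, Matrix.conjTranspose_sub,
      Matrix.conjTranspose_conjTranspose]
    simp only [RCLike.star_def, Complex.conj_ofReal, map_div₀, map_neg, Complex.conj_I, map_one,
      map_ofNat, neg_neg]
    module
  set P : Polynomial ℂ := aeval (fun k : Fin N × Fin N =>
    Polynomial.C (H₁ k.1 k.2) + Polynomial.X * Polynomial.C (H₂ k.1 k.2)) q with hP
  have heval : ∀ z : ℂ, P.eval z = evalMat (H₁ + z • H₂) q := by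
    intro z
    have h1 : (Polynomial.aeval z).comp (aeval (fun k : Fin N × Fin N =>
        Polynomial.C (H₁ k.1 k.2) + Polynomial.X * Polynomial.C (H₂ k.1 k.2))) =
        evalMat (H₁ + z • H₂) := by
      refine MvPolynomial.algHom_ext fun k => ?_
      simp [evalMat, mul_comm z]
    have h2 := DFunLike.congr_fun h1 q
    rw [AlgHom.comp_apply, ← hP, Polynomial.coe_aeval_eq_eval] at h2
    exact h2
  have hP0 : P = 0 := by
    refine Polynomial.eq_zero_of_infinite_isRoot P ?_
    refine (Set.infinite_range_of_injective Complex.ofReal_injective).mono ?_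
    rintro _ ⟨t, rfl⟩
    exact (heval t).trans (h _ (hherm t))
  rw [← hdec, ← heval, hP0, Polynomial.eval_zero]

/-- Unitarily invariant polynomials are linear combinations of Schur polynomials. -/
theorem IsClassPoly.mem_schurSpan {q : MatPoly N} (hq : IsClassPoly q) : q ∈ schurSpan N := by
  have h1 : altRestrict N q ∈ (schurSpan N).map (altRestrict N) := by
    refine antisymmetric_mem fun w => ?_
    rw [altRestrict_apply, map_mul, hq.rename_diagRestrict, rename_altPoly, mul_assoc]
  obtain ⟨p, hp, hpq⟩ := Submodule.mem_map.1 h1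
  have h2 : diagRestrict N p = diagRestrict N q :=
    mul_left_cancel₀ altPoly_staircase_ne_zero hpq
  have h3 : q - p = 0 := by
    refine eq_zero_of_hermitian fun H hH => ?_
    have hs := hH.spectral_theorem
    rw [Unitary.conjStarAlgAut_apply] at hs
    rw [hs, map_sub, hq, isClassPoly_of_mem hp, ← eval_diagRestrict, ← eval_diagRestrict, h2,
      sub_self]
  rw [sub_eq_zero.1 h3]
  exact hp

end ClassFunctions

section Moments

open MvPolynomial

variable {N : ℕ}

instance instBorelSpaceUN : BorelSpace (UN N) := ⟨rfl⟩

instance instBorelSpaceSUN : BorelSpace (SUN N) := ⟨rfl⟩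

instance instCompactSpaceUN : CompactSpace (UN N) := by
  refine isCompact_iff_compactSpace.1 ?_
  refine IsCompact.of_isClosed_subset (isCompact_univ_pi fun _ : Fin N =>
    isCompact_univ_pi fun _ : Fin N => isCompact_closedBall (0 : ℂ) 1) isClosed_unitary ?_
  intro U hU i _ j _
  rw [mem_closedBall_zero_iff]
  exact entry_norm_bound_of_unitary hU i j

/-- The point `X A X†` of the orbit of `A`. -/
def orbit (A : Matrix (Fin N) (Fin N) ℂ) (X : UN N) : Matrix (Fin N) (Fin N) ℂ :=
  (X : Matrix (Fin N) (Fin N) ℂ) * A * star (X : Matrix (Fin N) (Fin N) ℂ)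

lemma continuous_orbit (A : Matrix (Fin N) (Fin N) ℂ) : Continuous (orbit A) := by
  unfold orbit
  fun_prop

lemma continuous_orbit_apply (A : Matrix (Fin N) (Fin N) ℂ) (i j : Fin N) :
    Continuous fun X => orbit A X i j :=
  (continuous_orbit A).matrix_elem i j

lemma continuous_trace_orbit (A B : Matrix (Fin N) (Fin N) ℂ) :
    Continuous fun X => (orbit A X * B).trace :=
  ((continuous_orbit A).matrix_mul continuous_const).matrix_trace

lemma integrable_of_continuous (ν : Measure (UN N)) [IsFiniteMeasure ν] {f : UN N → ℂ}
    (hf : Continuous f) : Integrable f ν :=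
  hf.integrable_of_hasCompactSupport (HasCompactSupport.of_compactSpace f)

/-- The moment of a monomial along the orbit of `A`. -/
def orbitMoment (ν : Measure (UN N)) (A : Matrix (Fin N) (Fin N) ℂ) (α : Fin N × Fin N → ℕ) : ℂ :=
  ∫ X, ∏ k, orbit A X k.1 k.2 ^ α k ∂ν

/-- The polynomial `B ↦ ∫ Tr(X A X† B)^n / n!`. -/
def momentPoly (ν : Measure (UN N)) (A : Matrix (Fin N) (Fin N) ℂ) (n : ℕ) : MatPoly N :=
  ∑ α ∈ Finset.piAntidiag (Finset.univ : Finset (Fin N × Fin N)) n,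
    monomial ((Finsupp.equivFunOnFinite.symm α).equivMapDomain (transp N))
      ((∏ k, ((α k).factorial : ℂ))⁻¹ * orbitMoment ν A α)

variable (ν : Measure (UN N)) (A B : Matrix (Fin N) (Fin N) ℂ) (n : ℕ)

lemma momentPoly_isHomogeneous : (momentPoly ν A n).IsHomogeneous n := by
  refine IsHomogeneous.sum _ _ _ fun α hα => isHomogeneous_monomial _ ?_
  rw [Finset.mem_piAntidiag] at hα
  rw [Finsupp.degree_eq_sum, ← hα.1]
  exact Equiv.sum_comp (transp N).symm α

lemma coeff_momentPoly {β : Fin N × Fin N →₀ ℕ} (hβ : β.degree = n) :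
    coeff (β.equivMapDomain (transp N)) (momentPoly ν A n) =
      (∏ k, ((β k).factorial : ℂ))⁻¹ * orbitMoment ν A β := by
  rw [momentPoly, coeff_sum, Finset.sum_eq_single (β : Fin N × Fin N → ℕ)]
  · rw [coeff_monomial, if_pos]
    rw [Finsupp.equivFunOnFinite_symm_coe]
  · intro α _ hα
    rw [coeff_monomial, if_neg]
    intro h
    apply hα
    funext k
    exact DFunLike.congr_fun h (transp N k)
  · intro h
    refine absurd ?_ h
    rw [Finset.mem_piAntidiag, ← hβ, Finsupp.degree_eq_sum]
    exact ⟨rfl, fun _ _ => Finset.mem_univ _⟩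

lemma evalMat_eq_sum (Y : Matrix (Fin N) (Fin N) ℂ) (p : MatPoly N) :
    evalMat Y p = ∑ β ∈ p.support, coeff β p * ∏ k, Y k.1 k.2 ^ β k := by
  rw [evalMat, aeval_def, eval₂_eq']
  rfl

lemma fischer_momentPoly [IsFiniteMeasure ν] {p : MatPoly N} (hp : p.IsHomogeneous n) :
    fischer (transp N) p (momentPoly ν A n) = ∫ X, evalMat (orbit A X) p ∂ν := by
  have hint : ∀ β : Fin N × Fin N →₀ ℕ, Integrable
      (fun X => coeff β p * ∏ k, orbit A X k.1 k.2 ^ β k) ν := fun β =>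
    integrable_of_continuous ν (continuous_const.mul
      (continuous_finsetProd _ fun k _ => (continuous_orbit_apply A k.1 k.2).pow _))
  simp only [evalMat_eq_sum]
  rw [integral_finsetSum _ fun β _ => hint β]
  conv_lhs => rw [p.as_sum, map_sum, LinearMap.sum_apply]
  refine Finset.sum_congr rfl fun β hβ => ?_
  have hdeg : β.degree = n := by
    rw [Finsupp.degree_eq_weight_one]
    exact hp (mem_support_iff.1 hβ)
  rw [fischer_monomial, coeff_momentPoly ν A n hdeg, integral_const_mul, orbitMoment,
    mul_inv_cancel_left₀]
  exact Finset.prod_ne_zero_iff.2 fun k _ => Nat.cast_ne_zero.2 (Nat.factorial_ne_zero _)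

lemma trace_orbit_mul_pow (X : UN N) : (orbit A X * B).trace ^ n / n.factorial =
    ∑ α ∈ Finset.piAntidiag (Finset.univ : Finset (Fin N × Fin N)) n,
      (∏ k, ((α k).factorial : ℂ))⁻¹ * (∏ k, orbit A X k.1 k.2 ^ α k) *
        ∏ k : Fin N × Fin N, B k.2 k.1 ^ α k := by
  have htr : (orbit A X * B).trace = ∑ k : Fin N × Fin N, orbit A X k.1 k.2 * B k.2 k.1 := by
    rw [Matrix.trace, Fintype.sum_prod_type]
    exact Finset.sum_congr rfl fun i _ => Matrix.mul_apply
  rw [htr, Finset.sum_pow_eq_sum_piAntidiag, Finset.sum_div]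
  refine Finset.sum_congr rfl fun α hα => ?_
  rw [Finset.mem_piAntidiag] at hα
  have hspec := Nat.multinomial_spec Finset.univ α
  rw [hα.1] at hspec
  have hspec' : (∏ k, ((α k).factorial : ℂ)) * (Nat.multinomial Finset.univ α : ℂ) =
      n.factorial := by exact_mod_cast hspec
  have h1 : (∏ k, ((α k).factorial : ℂ)) ≠ 0 :=
    Finset.prod_ne_zero_iff.2 fun k _ => Nat.cast_ne_zero.2 (Nat.factorial_ne_zero _)
  have h2 : (n.factorial : ℂ) ≠ 0 := Nat.cast_ne_zero.2 (Nat.factorial_ne_zero _)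
  simp only [mul_pow]
  rw [Finset.prod_mul_distrib]
  field_simp
  rw [← hspec']
  ring

lemma evalMat_momentPoly [IsFiniteMeasure ν] : evalMat B (momentPoly ν A n) =
    ∫ X, (orbit A X * B).trace ^ n / n.factorial ∂ν := by
  have hint : ∀ α : Fin N × Fin N → ℕ, Integrable
      (fun X => (∏ k, ((α k).factorial : ℂ))⁻¹ * (∏ k, orbit A X k.1 k.2 ^ α k) *
        ∏ k : Fin N × Fin N, B k.2 k.1 ^ α k) ν := fun α =>
    integrable_of_continuous ν ((continuous_const.mul
      (continuous_finsetProd _ fun k _ => (continuous_orbit_apply A k.1 k.2).pow _)).mul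
      continuous_const)
  simp only [trace_orbit_mul_pow]
  rw [integral_finsetSum _ fun α _ => hint α, momentPoly, map_sum]
  refine Finset.sum_congr rfl fun α _ => ?_
  rw [integral_mul_const, integral_const_mul, evalMat, aeval_monomial, orbitMoment,
    Finsupp.prod_fintype _ _ fun k => pow_zero _,
    ← Equiv.prod_comp (transp N) fun k => B k.1 k.2 ^ _]
  rfl

/-- Invariance under left translation by the special unitary group. -/
def IsSUInvariant (ν : Measure (UN N)) : Prop :=
  ∀ V ∈ SUN N, MeasurePreserving (fun X => V * X) ν ν

lemma exists_special_smul (hN : 1 ≤ N) (U : UN N) : ∃ c : ℂ, ∃ V ∈ SUN N,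
    c * star c = 1 ∧ (U : Matrix (Fin N) (Fin N) ℂ) = c • (V : Matrix (Fin N) (Fin N) ℂ) := by
  obtain ⟨c, hc⟩ := IsAlgClosed.exists_pow_nat_eq (U : Matrix (Fin N) (Fin N) ℂ).det hN
  have hdet : (U : Matrix (Fin N) (Fin N) ℂ).det * star (U : Matrix (Fin N) (Fin N) ℂ).det = 1 :=
    (Unitary.mem_iff.1 (Matrix.det_of_mem_unitary U.2)).2
  have hnorm : ‖c‖ = 1 := by
    have h1 : ‖(U : Matrix (Fin N) (Fin N) ℂ).det‖ = 1 := by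
      have h2 := congrArg norm hdet
      rw [norm_mul, norm_star, norm_one] at h2
      nlinarith [norm_nonneg (U : Matrix (Fin N) (Fin N) ℂ).det]
    rw [← hc, norm_pow] at h1
    exact (pow_eq_one_iff_of_nonneg (norm_nonneg c) (by omega)).1 h1
  have hcc : c * star c = 1 := by
    rw [RCLike.star_def, RCLike.mul_conj, hnorm]; simp
  have hcc' : star c * c = 1 := by rw [mul_comm, hcc]
  have hV : star c • (U : Matrix (Fin N) (Fin N) ℂ) ∈ Matrix.unitaryGroup (Fin N) ℂ := by
    rw [Matrix.mem_unitaryGroup_iff, star_smul, star_star, smul_mul_smul_comm, hcc', one_smul]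
    exact Matrix.mem_unitaryGroup_iff.1 U.2
  refine ⟨c, ⟨_, hV⟩, ?_, hcc, ?_⟩
  · change (star c • (U : Matrix (Fin N) (Fin N) ℂ)).det = 1
    rw [Matrix.det_smul, Fintype.card_fin, ← hc, ← mul_pow, hcc', one_pow]
  · rw [smul_smul, hcc, one_smul]

lemma isClassPoly_momentPoly [IsFiniteMeasure ν] (hN : 1 ≤ N) (hν : IsSUInvariant ν) :
    IsClassPoly (momentPoly ν A n) := by
  intro U B
  rw [evalMat_momentPoly, evalMat_momentPoly]
  obtain ⟨c, V, hV, hc, hU⟩ := exists_special_smul hN U⁻¹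
  have hU' : star (U : Matrix (Fin N) (Fin N) ℂ) = c • (V : Matrix (Fin N) (Fin N) ℂ) := hU
  have hU'' : (U : Matrix (Fin N) (Fin N) ℂ) = star c • star (V : Matrix (Fin N) (Fin N) ℂ) := by
    rw [← star_smul, ← hU', star_star]
  have htr : ∀ X : UN N, (orbit A X * ((U : Matrix (Fin N) (Fin N) ℂ) * B *
      star (U : Matrix (Fin N) (Fin N) ℂ))).trace = (orbit A (V * X) * B).trace := by
    intro X
    rw [← mul_assoc, ← mul_assoc, Matrix.trace_mul_comm, ← mul_assoc, ← mul_assoc]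
    congr 2
    rw [hU', hU'', orbit, orbit, Submonoid.coe_mul, star_mul]
    simp only [Matrix.smul_mul, Matrix.mul_smul, smul_smul, mul_assoc]
    rw [mul_comm, hc, one_smul]
  simp only [htr]
  have hcont : Continuous fun X => (orbit A X * B).trace ^ n / (n.factorial : ℂ) :=
    ((continuous_trace_orbit A B).pow n).div_const _
  have hmap := (hν V hV).map_eq
  conv_rhs => rw [← hmap]
  rw [integral_map (hν V hV).measurable.aemeasurable
    (integrable_of_continuous _ hcont).aestronglyMeasurable]

/-- Expansion of the moments of the orbital integral in Schur polynomials. -/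
theorem hasSum_moment [IsProbabilityMeasure ν] (hN : 1 ≤ N) (hν : IsSUInvariant ν) :
    HasSum (fun l : PartitionN N =>
      if ∑ i, l.1 i = n then schur l.1 A * schur l.1 B / poch N l.1 else 0)
      (∫ X, (orbit A X * B).trace ^ n / n.factorial ∂ν) := by
  have hmem := (isClassPoly_momentPoly ν A n hN hν).mem_schurSpan
  obtain ⟨c, hc⟩ := Finsupp.mem_span_range_iff_exists_finsupp.1 hmem
  have hcoef : ∀ l : PartitionN N, c l * poch N l.1 =
      if ∑ i, l.1 i = n then schur l.1 A else 0 := by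
    intro l
    have h1 : fischer (transp N) (schurPoly l.1) (momentPoly ν A n) = c l * poch N l.1 := by
      rw [← hc, Finsupp.sum, map_sum]
      simp only [map_smul, smul_eq_mul]
      rw [Finset.sum_eq_single l]
      · rw [fischer_schurPoly l.2 l.2, if_pos rfl]
      · intro m _ hm
        rw [fischer_schurPoly l.2 m.2, if_neg (fun h => hm (Subtype.ext h.symm)), mul_zero]
      · intro hl
        rw [Finsupp.notMem_support_iff.1 hl, zero_mul]
    rw [← h1]
    split_ifs with hn
    · rw [fischer_momentPoly ν A n (hn ▸ schurPoly_isHomogeneous l.1)]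
      have : ∀ X : UN N, evalMat (orbit A X) (schurPoly l.1) = schur l.1 A := fun X => by
        rw [← evalMat_schurPoly l.1 A]
        exact isClassPoly_schurPoly l.1 X A
      simp [this]
    · exact fischer_eq_zero_of_degree hn (schurPoly_isHomogeneous l.1)
        (momentPoly_isHomogeneous ν A n)
  have hterm : ∀ l : PartitionN N, (if ∑ i, l.1 i = n then
      schur l.1 A * schur l.1 B / poch N l.1 else 0) = c l * schur l.1 B := by
    intro l
    have h := hcoef l
    split_ifs at h ⊢
    · rw [← h, mul_right_comm, mul_div_cancel_right₀ _ (poch_ne_zero l.1)]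
    · rw [(mul_eq_zero.1 h).resolve_right (poch_ne_zero l.1), zero_mul]
  have hval : (∫ X, (orbit A X * B).trace ^ n / n.factorial ∂ν) =
      ∑ l ∈ c.support, c l * schur l.1 B := by
    rw [← evalMat_momentPoly, ← hc, Finsupp.sum, map_sum]
    exact Finset.sum_congr rfl fun l _ => by rw [map_smul, evalMat_schurPoly, smul_eq_mul]
  rw [hval]
  simp only [hterm]
  exact hasSum_sum_of_ne_finset_zero fun l hl => by
    rw [Finsupp.notMem_support_iff.1 hl, zero_mul]

end Moments

section Convergence

variable {N : ℕ}

lemma exists_trace_orbit_bound (A B : Matrix (Fin N) (Fin N) ℂ) :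
    ∃ K : ℝ, ∀ X : UN N, ‖(orbit A X * B).trace‖ ≤ K := by
  obtain ⟨K, hK⟩ := (isCompact_univ (X := UN N)).exists_bound_of_continuousOn
    (continuous_trace_orbit A B).continuousOn
  exact ⟨K, fun X => hK X (Set.mem_univ _)⟩

lemma norm_trace_pow_le {A B : Matrix (Fin N) (Fin N) ℂ} {K : ℝ}
    (hK : ∀ X : UN N, ‖(orbit A X * B).trace‖ ≤ K) (n : ℕ) (X : UN N) :
    ‖(orbit A X * B).trace ^ n / (n.factorial : ℂ)‖ ≤ K ^ n / n.factorial := by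
  rw [norm_div, norm_pow, RCLike.norm_natCast]
  gcongr
  exact hK X

lemma hasSum_integral_exp_trace (ν : Measure (UN N)) [IsProbabilityMeasure ν]
    (A B : Matrix (Fin N) (Fin N) ℂ) :
    HasSum (fun n : ℕ => ∫ X, (orbit A X * B).trace ^ n / n.factorial ∂ν)
      (∫ X, Complex.exp (orbit A X * B).trace ∂ν) := by
  obtain ⟨K, hK⟩ := exists_trace_orbit_bound A B
  have hcont : ∀ n : ℕ, Continuous fun X => (orbit A X * B).trace ^ n / (n.factorial : ℂ) :=
    fun n => ((continuous_trace_orbit A B).pow n).div_const _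
  have h := hasSum_integral_of_summable_integral_norm (μ := ν)
    (F := fun (n : ℕ) X => (orbit A X * B).trace ^ n / (n.factorial : ℂ))
    (fun n => integrable_of_continuous ν (hcont n)) (by
      refine Summable.of_nonneg_of_le (fun n => integral_nonneg fun X => norm_nonneg _)
        (fun n => ?_) (Real.summable_pow_div_factorial K)
      have h1 := integral_mono (μ := ν) (integrable_of_continuous ν (hcont n)).norm
        (integrable_const (K ^ n / (n.factorial : ℝ))) (norm_trace_pow_le hK n)
      simpa using h1)
  have hexp : (fun X => Complex.exp (orbit A X * B).trace) =
      fun X => ∑' n : ℕ, (orbit A X * B).trace ^ n / (n.factorial : ℂ) := by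
    funext X
    rw [Complex.exp_eq_exp_ℂ]
    exact (NormedSpace.expSeries_div_hasSum_exp _).tsum_eq.symm
  rw [hexp]
  exact h

lemma norm_poch (l : Fin N → ℕ) : ((‖poch N l‖ : ℝ) : ℂ) = poch N l := by
  have h := poch_mul_factorial l
  have h1 : (∏ i, ((staircase N i).factorial : ℂ)) ≠ 0 :=
    Finset.prod_ne_zero_iff.2 fun k _ => Nat.cast_ne_zero.2 (Nat.factorial_ne_zero _)
  have h2 : poch N l = (((∏ i, ((l i + staircase N i).factorial : ℝ)) /
      ∏ i, ((staircase N i).factorial : ℝ) : ℝ) : ℂ) := by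
    rw [eq_div_of_mul_eq h1 h]
    push_cast
    rfl
  rw [h2, Complex.norm_real, Real.norm_of_nonneg]
  positivity

/-- The terms of the Schur expansion with `B = A†`, in absolute value. -/
def schurWeight (A : Matrix (Fin N) (Fin N) ℂ) (l : PartitionN N) : ℝ :=
  ‖schur l.1 A‖ ^ 2 / ‖poch N l.1‖

lemma schurWeight_nonneg (A : Matrix (Fin N) (Fin N) ℂ) (l : PartitionN N) :
    0 ≤ schurWeight A l := by
  unfold schurWeight
  positivity

lemma coe_schurWeight (A : Matrix (Fin N) (Fin N) ℂ) (l : PartitionN N) :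
    ((schurWeight A l : ℝ) : ℂ) = schur l.1 A * schur l.1 Aᴴ / poch N l.1 := by
  rw [schurWeight, schur_conjTranspose, RCLike.star_def, RCLike.mul_conj, Complex.ofReal_div,
    norm_poch]
  simp

lemma summable_schurWeight (hN : 1 ≤ N) (ν : Measure (UN N)) [IsProbabilityMeasure ν]
    (hν : IsSUInvariant ν) (A : Matrix (Fin N) (Fin N) ℂ) : Summable (schurWeight A) := by
  obtain ⟨K, hK⟩ := exists_trace_orbit_bound A Aᴴ
  set g : ℕ × PartitionN N → ℝ := fun x =>
    if ∑ i, x.2.1 i = x.1 then schurWeight A x.2 else 0 with hg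
  have hsum : ∀ n : ℕ, HasSum (fun l : PartitionN N => ((g (n, l) : ℝ) : ℂ))
      (∫ X, (orbit A X * Aᴴ).trace ^ n / n.factorial ∂ν) := by
    intro n
    have hcoe : (fun l : PartitionN N => ((g (n, l) : ℝ) : ℂ)) = fun l : PartitionN N =>
        if ∑ i, l.1 i = n then schur l.1 A * schur l.1 Aᴴ / poch N l.1 else 0 := by
      funext l
      simp only [hg]
      split_ifs
      · exact coe_schurWeight A l
      · exact Complex.ofReal_zero
    rw [hcoe]
    exact hasSum_moment ν A Aᴴ n hN hν
  have hs : ∀ n : ℕ, Summable fun l : PartitionN N => g (n, l) := fun n =>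
    Complex.summable_ofReal.1 (hsum n).summable
  have hle : ∀ n : ℕ, ∑' l : PartitionN N, g (n, l) ≤ K ^ n / n.factorial := by
    intro n
    have h1 : ((∑' l : PartitionN N, g (n, l) : ℝ) : ℂ) =
        ∫ X, (orbit A X * Aᴴ).trace ^ n / n.factorial ∂ν := by
      rw [Complex.ofReal_tsum, (hsum n).tsum_eq]
    have h2 : ‖((∑' l : PartitionN N, g (n, l) : ℝ) : ℂ)‖ ≤ K ^ n / n.factorial := by
      rw [h1]
      have h3 := norm_integral_le_of_norm_le_const (μ := ν)
        (Filter.Eventually.of_forall (norm_trace_pow_le hK n))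
      simpa using h3
    rw [Complex.norm_real] at h2
    exact (Real.le_norm_self _).trans h2
  have hg0 : 0 ≤ g := fun x => by
    simp only [hg, Pi.zero_apply]
    split_ifs
    · exact schurWeight_nonneg A _
    · exact le_rfl
  have hprod : Summable g := (summable_prod_of_nonneg hg0).2 ⟨hs,
    Summable.of_nonneg_of_le (fun n => tsum_nonneg fun l => hg0 (n, l)) hle
      (Real.summable_pow_div_factorial K)⟩
  have hinj : Function.Injective fun l : PartitionN N => (∑ i, l.1 i, l) :=
    fun l m h => (Prod.ext_iff.1 h).2
  have hcomp : schurWeight A = g ∘ fun l : PartitionN N => (∑ i, l.1 i, l) := by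
    funext l
    simp [hg]
  rw [hcomp]
  exact hprod.comp_injective hinj

lemma summable_schur (hN : 1 ≤ N) (ν : Measure (UN N)) [IsProbabilityMeasure ν]
    (hν : IsSUInvariant ν) (A B : Matrix (Fin N) (Fin N) ℂ) :
    Summable fun l : PartitionN N => schur l.1 A * schur l.1 B / poch N l.1 := by
  refine Summable.of_norm_bounded
    ((summable_schurWeight hN ν hν A).add (summable_schurWeight hN ν hν B)) fun l => ?_
  rw [norm_div, norm_mul, schurWeight, schurWeight, ← add_div]
  gcongr
  nlinarith [sq_nonneg (‖schur l.1 A‖ - ‖schur l.1 B‖), norm_nonneg (schur l.1 A),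
    norm_nonneg (schur l.1 B)]

/-- The Harish-Chandra–Itzykson–Zuber integral as a sum over partitions. -/
theorem integral_exp_trace_orbit (hN : 1 ≤ N) (ν : Measure (UN N)) [IsProbabilityMeasure ν]
    (hν : IsSUInvariant ν) (A B : Matrix (Fin N) (Fin N) ℂ) :
    ∫ X, Complex.exp (orbit A X * B).trace ∂ν =
      ∑' l : PartitionN N, schur l.1 A * schur l.1 B / poch N l.1 := by
  refine (hasSum_integral_exp_trace ν A B).unique ?_
  have h := (summable_schur hN ν hν A B).hasSum.tsum_fiberwise
    (fun l : PartitionN N => ∑ i, l.1 i)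
  have hfiber : (fun n : ℕ => ∫ X, (orbit A X * B).trace ^ n / n.factorial ∂ν) = fun n =>
      ∑' l : (fun l : PartitionN N => ∑ i, l.1 i) ⁻¹' {n},
        schur l.1.1 A * schur l.1.1 B / poch N l.1.1 := by
    funext n
    rw [← (hasSum_moment ν A B n hN hν).tsum_eq, tsum_subtype ((fun l : PartitionN N =>
      ∑ i, l.1 i) ⁻¹' {n}) fun l : PartitionN N => schur l.1 A * schur l.1 B / poch N l.1]
    refine tsum_congr fun l => ?_
    simp only [Set.indicator_apply, Set.mem_preimage, Set.mem_singleton_iff]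
  rw [hfiber]
  exact h

lemma isSUInvariant_haar (μU : Measure (UN N)) [μU.IsHaarMeasure] : IsSUInvariant μU :=
  fun V _ => measurePreserving_mul_left μU V

lemma isSUInvariant_map (μSU : Measure (SUN N)) [μSU.IsHaarMeasure] :
    IsSUInvariant (μSU.map Subtype.val) := by
  intro V hV
  have hval : Measurable (Subtype.val : SUN N → UN N) := continuous_subtype_val.measurable
  have hmul : Measurable fun X : UN N => V * X := (continuous_const_mul V).measurable
  refine ⟨hmul, ?_⟩
  rw [Measure.map_map hmul hval]
  have h : (fun X : UN N => V * X) ∘ (Subtype.val : SUN N → UN N) =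
      Subtype.val ∘ fun X : SUN N => (⟨V, hV⟩ : SUN N) * X := rfl
  rw [h, ← Measure.map_map hval (measurable_const_mul _), map_mul_left_eq_self]

end Convergence

end HCIZ

/-- `∫_{SU(N)} exp(Tr(XAX†B)) dμ(X) = ∫_{U(N)} exp(Tr(XAX†B)) d_*X
= Σ_{λ : ℓ(λ) ≤ N} s_λ(A)s_λ(B)/(N)_λ`, the sum converging absolutely. -/
theorem statement16 {N : ℕ} (hN : 1 ≤ N)
    (A B : Matrix (Fin N) (Fin N) ℂ)
    (μU : Measure (UN N)) [μU.IsHaarMeasure] [IsProbabilityMeasure μU]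
    (μSU : Measure (SUN N)) [μSU.IsHaarMeasure] [IsProbabilityMeasure μSU] :
    Summable (fun l : PartitionN N => schur l.1 A * schur l.1 B / poch N l.1) ∧
    (∫ V : SUN N,
        Complex.exp ((((V : UN N) : Matrix (Fin N) (Fin N) ℂ) * A * star ((V : UN N) : Matrix (Fin N) (Fin N) ℂ) * B).trace) ∂μSU) =
      (∫ X : UN N,
        Complex.exp (((X : Matrix (Fin N) (Fin N) ℂ) * A * star (X : Matrix (Fin N) (Fin N) ℂ) * B).trace) ∂μU) ∧
    (∫ X : UN N,
        Complex.exp (((X : Matrix (Fin N) (Fin N) ℂ) * A * star (X : Matrix (Fin N) (Fin N) ℂ) * B).trace) ∂μU) =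
      ∑' l : PartitionN N, schur l.1 A * schur l.1 B / poch N l.1 := by
  have hU := HCIZ.integral_exp_trace_orbit hN μU (HCIZ.isSUInvariant_haar μU) A B
  have hval : Measurable (Subtype.val : SUN N → UN N) := continuous_subtype_val.measurable
  have : IsProbabilityMeasure (μSU.map (Subtype.val : SUN N → UN N)) :=
    Measure.isProbabilityMeasure_map hval.aemeasurable
  have hSU := HCIZ.integral_exp_trace_orbit hN _ (HCIZ.isSUInvariant_map μSU) A B
  have hcont : Continuous fun X : UN N => Complex.exp (HCIZ.orbit A X * B).trace :=
    Complex.continuous_exp.comp (HCIZ.continuous_trace_orbit A B)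
  rw [integral_map hval.aemeasurable
    (HCIZ.integrable_of_continuous _ hcont).aestronglyMeasurable] at hSU
  exact ⟨HCIZ.summable_schur hN μU (HCIZ.isSUInvariant_haar μU) A B, hSU.trans hU.symm, hU⟩

end
end
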